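/- Let d ≥ 2 be even and let n = p + q > d with p, q ≥ 1. Let 0 ≤ η < min{d, n−d} and let 0 < κ < (n−d−η)/2. Let N(t) be a non-decreasing function with N(t) = O(t^η). Then there exists ν > 0 such that for almost all F ∈ Y_{p,q}^{(d)} there are constants c_F > 0, C_F > 0 and t_F > 0 such that for every t > t_F and every interval I ⊂ [−N(t), N(t)] with |I| ≥ t^{−κ}: | #{v ∈ ℤⁿ : F(v) ∈ I and ‖v‖ ≤ t} − c_F·|I|·t^{n−d} | ≤ C_F·|I|·t^{n−d−ν}. -/

import Mathlib

open MeasureTheory Matrix Filter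

noncomputable section

/-- `SL_n(ℝ)`. -/
abbrev SLR (n : ℕ) := Matrix.SpecialLinearGroup (Fin n) ℝ

instance (n : ℕ) : TopologicalSpace (SLR n) :=
  TopologicalSpace.induced (fun g => (g : Matrix (Fin n) (Fin n) ℝ)) inferInstance

instance (n : ℕ) : MeasurableSpace (SLR n) := borel _

/-- Euclidean norm on `ℝⁿ`. -/
def eucNorm {n : ℕ} (v : Fin n → ℝ) : ℝ := Real.sqrt (∑ i, v i ^ 2)

/-- `F₀(v) = Σ_{i=1}^p v_i^d − Σ_{i=p+1}^n v_i^d` on `ℝ^{p+q}`. -/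
def F0 (p q d : ℕ) (v : Fin (p + q) → ℝ) : ℝ :=
  ∑ i : Fin (p + q), (if (i : ℕ) < p then (1 : ℝ) else -1) * v i ^ d

/-- The polynomial `F = g·F₀`, i.e. `F(v) = F₀(v g)` (row vectors, right action). -/
def Fg (p q d : ℕ) (g : SLR (p + q)) (v : Fin (p + q) → ℝ) : ℝ :=
  F0 p q d (Matrix.vecMul v (g : Matrix (Fin (p + q)) (Fin (p + q)) ℝ))

/-- The coercion `ℤⁿ → ℝⁿ`. -/
def intVec {n : ℕ} (v : Fin n → ℤ) : Fin n → ℝ := fun i => (v i : ℝ)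

/-- `#{v ∈ ℤⁿ : F(v) ∈ I, ‖v‖ ≤ t}` for `F = g·F₀`. -/
def NF (p q d : ℕ) (g : SLR (p + q)) (I : Set ℝ) (t : ℝ) : ℕ :=
  Nat.card {v : Fin (p + q) → ℤ | Fg p q d g (intVec v) ∈ I ∧ eucNorm (intVec v) ≤ t}

open scoped ENNReal

/-- Real square matrices, as a plain function space carrying Lebesgue measure. -/
abbrev RM (n : ℕ) := Fin n → Fin n → ℝ

/-- `SL_n(ℤ)`. -/
abbrev SLZ (n : ℕ) := Matrix.SpecialLinearGroup (Fin n) ℤ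

instance (n : ℕ) : Countable (SLZ n) :=
  (Subtype.val_injective.countable : Countable {A : Fin n → Fin n → ℤ // Matrix.det A = 1})

/-- Determinant on `RM n`. -/
def mdet {n : ℕ} (g : RM n) : ℝ := Matrix.det (Matrix.of g)

/-- Left action of `SL_n(ℤ)` on real matrices. -/
def gact {n : ℕ} (γ : SLZ n) (g : RM n) : RM n :=
  ((γ : Matrix (Fin n) (Fin n) ℤ).map (Int.cast : ℤ → ℝ) * Matrix.of g : Matrix _ _ ℝ)

/-- The lattice vector `v g`. -/
def vact {n : ℕ} (v : Fin n → ℤ) (g : RM n) : Fin n → ℝ := intVec v ᵥ* Matrix.of g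

/-- Matrices of determinant in `[1,2]`. -/
def DD (n : ℕ) : Set (RM n) := {g | 1 ≤ mdet g ∧ mdet g ≤ 2}

lemma continuous_mdet {n : ℕ} : Continuous (mdet : RM n → ℝ) := by
  unfold mdet
  exact Continuous.matrix_det (A := fun g : RM n => Matrix.of g) continuous_id

@[fun_prop]
lemma measurable_mdet {n : ℕ} : Measurable (mdet : RM n → ℝ) := continuous_mdet.measurable

lemma measurableSet_DD (n : ℕ) : MeasurableSet (DD n) :=
  (measurableSet_le measurable_const measurable_mdet).inter
    (measurableSet_le measurable_mdet measurable_const)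

lemma gact_mul {n : ℕ} (γ γ' : SLZ n) (g : RM n) : gact (γ * γ') g = gact γ (gact γ' g) := by
  have : ((γ * γ' : SLZ n) : Matrix (Fin n) (Fin n) ℤ).map (Int.cast : ℤ → ℝ)
      = (γ : Matrix (Fin n) (Fin n) ℤ).map (Int.cast : ℤ → ℝ) *
        (γ' : Matrix (Fin n) (Fin n) ℤ).map (Int.cast : ℤ → ℝ) := by
    rw [Matrix.SpecialLinearGroup.coe_mul]
    exact Matrix.map_mul (f := Int.castRingHom ℝ)
  unfold gact
  rw [this, Matrix.mul_assoc]
  rfl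

lemma gact_one {n : ℕ} (g : RM n) : gact 1 g = g := by
  unfold gact
  rw [Matrix.SpecialLinearGroup.coe_one, Matrix.map_one _ (by simp) (by simp), Matrix.one_mul]
  rfl

lemma mdet_gact {n : ℕ} (γ : SLZ n) (g : RM n) : mdet (gact γ g) = mdet g := by
  have : Matrix.det ((γ : Matrix (Fin n) (Fin n) ℤ).map (Int.cast : ℤ → ℝ)) = 1 := by
    have := (Int.castRingHom ℝ).map_det (γ : Matrix (Fin n) (Fin n) ℤ)
    rw [γ.2] at this
    simpa using this.symm
  show Matrix.det ((γ : Matrix (Fin n) (Fin n) ℤ).map (Int.cast : ℤ → ℝ) * Matrix.of g) = _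
  rw [Matrix.det_mul, this, one_mul]; rfl

lemma gact_mem_DD {n : ℕ} {γ : SLZ n} {g : RM n} : gact γ g ∈ DD n ↔ g ∈ DD n := by
  simp [DD, mdet_gact]

lemma intVec_vecMul {n : ℕ} (v : Fin n → ℤ) (A : Matrix (Fin n) (Fin n) ℤ) :
    intVec (v ᵥ* A) = intVec v ᵥ* A.map (Int.cast : ℤ → ℝ) := by
  ext j
  simp [intVec, Matrix.vecMul, dotProduct]

lemma vact_gact {n : ℕ} (v : Fin n → ℤ) (γ : SLZ n) (g : RM n) :
    vact v (gact γ g) = vact (v ᵥ* (γ : Matrix (Fin n) (Fin n) ℤ)) g := by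
  unfold vact
  rw [intVec_vecMul, Matrix.vecMul_vecMul]
  rfl

lemma continuous_vact {n : ℕ} (v : Fin n → ℤ) : Continuous (vact v : RM n → Fin n → ℝ) := by
  unfold vact Matrix.vecMul dotProduct
  simp only [Matrix.of_apply]
  fun_prop

lemma measurable_vact {n : ℕ} (v : Fin n → ℤ) : Measurable (vact v : RM n → Fin n → ℝ) :=
  (continuous_vact v).measurable

lemma vact_smul {n : ℕ} (a : ℤ) (v : Fin n → ℤ) (g : RM n) :
    vact (a • v) g = (a : ℝ) • vact v g := by
  ext j
  simp [vact, intVec, Matrix.vecMul, dotProduct, Finset.mul_sum, mul_assoc]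

/-- A linear endomorphism of determinant `±1` preserves Lebesgue measure. -/
lemma measurePreserving_of_abs_det {E : Type*} [NormedAddCommGroup E] [NormedSpace ℝ E]
    [MeasurableSpace E] [BorelSpace E] [FiniteDimensional ℝ E] (μ : Measure E)
    [μ.IsAddHaarMeasure] (f : E →ₗ[ℝ] E) (hf : |LinearMap.det f| = 1) :
    MeasurePreserving f μ μ := by
  refine ⟨f.continuous_of_finiteDimensional.measurable, ?_⟩
  have h0 : LinearMap.det f ≠ 0 := by
    intro h; simp [h] at hf
  rw [Measure.map_linearMap_addHaar_eq_smul_addHaar μ h0, abs_inv, hf]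
  simp

lemma measurePreserving_vecMul {n : ℕ} (A : Matrix (Fin n) (Fin n) ℝ) (hA : A.det = 1) :
    MeasurePreserving (fun v : Fin n → ℝ => v ᵥ* A) volume volume := by
  have := measurePreserving_of_abs_det (volume : Measure (Fin n → ℝ)) (Matrix.toLin' Aᵀ)
    (by rw [LinearMap.det_toLin', Matrix.det_transpose, hA, abs_one])
  convert this using 2
  ext v
  simp [Matrix.mulVec_transpose]

/-- Right multiplication by a unimodular matrix. -/
def rmulR {k n : ℕ} (A : Matrix (Fin n) (Fin n) ℝ) (g : Fin k → Fin n → ℝ) : Fin k → Fin n → ℝ :=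
  fun i => g i ᵥ* A

lemma measurePreserving_rmulR {k n : ℕ} (A : Matrix (Fin n) (Fin n) ℝ) (hA : A.det = 1) :
    MeasurePreserving (rmulR A : (Fin k → Fin n → ℝ) → (Fin k → Fin n → ℝ)) volume volume :=
  volume_preserving_pi (fun _ => measurePreserving_vecMul A hA)

/-- Transposition on `RM n`. -/
def trL (n : ℕ) : RM n →ₗ[ℝ] RM n where
  toFun g := fun i j => g j i
  map_add' _ _ := rfl
  map_smul' _ _ := rfl

lemma measurePreserving_trL (n : ℕ) : MeasurePreserving (trL n) volume volume := by
  apply measurePreserving_of_abs_det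
  have h : trL n ∘ₗ trL n = LinearMap.id := rfl
  have := congrArg LinearMap.det h
  rw [LinearMap.det_comp, LinearMap.det_id] at this
  have h2 : |LinearMap.det (trL n)| * |LinearMap.det (trL n)| = 1 := by rw [← abs_mul, this, abs_one]
  nlinarith [abs_nonneg (LinearMap.det (trL n))]

lemma measurePreserving_gact {n : ℕ} (γ : SLZ n) :
    MeasurePreserving (gact γ : RM n → RM n) volume volume := by
  have hdet : Matrix.det ((γ : Matrix (Fin n) (Fin n) ℤ).map (Int.cast : ℤ → ℝ))ᵀ = 1 := by
    have := (Int.castRingHom ℝ).map_det (γ : Matrix (Fin n) (Fin n) ℤ)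
    rw [γ.2] at this
    rw [Matrix.det_transpose]
    simpa using this.symm
  have := (measurePreserving_trL n).comp
    ((measurePreserving_rmulR (k := n) _ hdet).comp (measurePreserving_trL n))
  convert this using 1
  ext g i j
  simp [gact, trL, rmulR, Matrix.vecMul, dotProduct, Matrix.mul_apply, mul_comm]

lemma measurable_gact {n : ℕ} (γ : SLZ n) : Measurable (gact γ : RM n → RM n) :=
  (measurePreserving_gact γ).measurable

/-- Interchanging the roles of two functions in an unfolded integral. -/
lemma lintegral_mul_tsum_swap {X ι : Type*} [MeasurableSpace X] [Countable ι] (μ : Measure X)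
    (T : ι → X → X) (e : ι ≃ ι) (hT : ∀ i, MeasurePreserving (T i) μ μ)
    (he : ∀ i x, T (e i) (T i x) = x) {α β : X → ℝ≥0∞} (hα : Measurable α) (hβ : Measurable β) :
    ∫⁻ x, α x * ∑' i, β (T i x) ∂μ = ∫⁻ x, β x * ∑' i, α (T i x) ∂μ := by
  simp_rw [← ENNReal.tsum_mul_left]
  rw [lintegral_tsum fun i => (show Measurable fun x => α x * β (T i x) from
      hα.mul (hβ.comp (hT i).measurable)).aemeasurable,
    lintegral_tsum fun i => (show Measurable fun x => β x * α (T i x) from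
      hβ.mul (hα.comp (hT i).measurable)).aemeasurable, ← e.tsum_eq]
  refine tsum_congr fun i => ?_
  rw [← (hT i).lintegral_comp (show Measurable fun x => α x * β (T (e i) x) from
      hα.mul (hβ.comp (hT (e i)).measurable))]
  simp_rw [he, mul_comm]

/-- The integer vector `a e₀`. -/
def ae0 (m : ℕ) (a : ℤ) : Fin (m + 1) → ℤ := Pi.single 0 a

/-- `v` is a positive multiple of the first row of a unimodular integer matrix. -/
def IsMulRow {m : ℕ} (v : Fin (m + 1) → ℤ) : Prop :=
  ∃ (a : ℕ) (γ : SLZ (m + 1)), 1 ≤ a ∧ ae0 m a ᵥ* γ.1 = v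

lemma IsMulRow.of_mul {m : ℕ} {v : Fin (m + 1) → ℤ} (δ : SLZ (m + 1))
    (h : IsMulRow (v ᵥ* δ.1)) : IsMulRow v := by
  obtain ⟨a, γ, ha, h⟩ := h
  refine ⟨a, γ * δ⁻¹, ha, ?_⟩
  rw [Matrix.SpecialLinearGroup.coe_mul, ← Matrix.vecMul_vecMul, h, Matrix.vecMul_vecMul,
    ← Matrix.SpecialLinearGroup.coe_mul, mul_inv_cancel, Matrix.SpecialLinearGroup.coe_one,
    Matrix.vecMul_one]

lemma vecMul_transvection {m : ℕ} (v : Fin m → ℤ) {i j : Fin m} (hij : i ≠ j) (c : ℤ) :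
    v ᵥ* (Matrix.SpecialLinearGroup.transvection hij c).1
      = v + Pi.single j (v i * c) := by
  rw [Matrix.SpecialLinearGroup.transvection_coe, Matrix.vecMul_add, Matrix.vecMul_one]
  congr 1
  ext k
  simp [Matrix.vecMul, dotProduct, Matrix.single_apply, Pi.single_apply, ite_and, eq_comm]

lemma isMulRow_single {m : ℕ} (i : Fin (m + 2)) (hi : i ≠ 0) (b : ℤ) (hb : b ≠ 0) :
    IsMulRow (Pi.single i b : Fin (m + 2) → ℤ) := by
  refine .of_mul (Matrix.SpecialLinearGroup.transvection hi b.sign) ?_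
  rw [vecMul_transvection]
  refine .of_mul (Matrix.SpecialLinearGroup.transvection hi.symm (-b.sign)) ?_
  rw [vecMul_transvection]
  refine ⟨b.natAbs, 1, Int.natAbs_pos.mpr hb, ?_⟩
  rw [Matrix.SpecialLinearGroup.coe_one, Matrix.vecMul_one]
  ext k
  simp only [ae0, Pi.add_apply, Pi.single_apply, hi.symm]
  have h1 : b * b.sign = |b| := by rw [mul_comm]; exact Int.sign_mul_self_eq_abs b
  by_cases h0 : k = 0
  · subst h0; simp [hi.symm, h1]
  · by_cases h2 : k = i
    · subst h2
      have : |b| * b.sign = b := by rw [mul_comm]; exact Int.sign_mul_abs b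
      simp [hi, h1, this]
    · simp [h0, h2]

lemma isMulRow_of_ne_zero {m : ℕ} (v : Fin (m + 2) → ℤ) (hv : v ≠ 0) : IsMulRow v := by
  induction hN : ∑ i, (v i).natAbs using Nat.strong_induction_on generalizing v with
  | _ N ih =>
  by_cases h : ∃ i j, i ≠ j ∧ v i ≠ 0 ∧ (v i).natAbs ≤ (v j).natAbs
  · obtain ⟨i, j, hij, hi, hle⟩ := h
    have hj : v j ≠ 0 := by
      intro h; simp [h] at hle; exact hi hle
    refine .of_mul (Matrix.SpecialLinearGroup.transvection hij (-(v i).sign * (v j).sign)) ?_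
    rw [vecMul_transvection]
    have hkey : (v j + v i * (-(v i).sign * (v j).sign)).natAbs < (v j).natAbs := by
      have e : v i * (-(v i).sign * (v j).sign) = -(|v i| * (v j).sign) := by
        rw [← Int.sign_mul_self_eq_abs (v i)]; ring
      have hvi : 1 ≤ (v i).natAbs := Int.natAbs_pos.mpr hi
      rw [e, Int.abs_eq_natAbs]
      rcases lt_or_gt_of_ne hj with h1 | h1
      · rw [Int.sign_eq_neg_one_of_neg h1]
        omega
      · rw [Int.sign_eq_one_of_pos h1]
        omega
    refine ih _ ?_ _ ?_ rfl
    · rw [← hN]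
      refine Finset.sum_lt_sum (fun k _ => ?_) ⟨j, Finset.mem_univ _, ?_⟩
      · by_cases hk : k = j
        · subst hk; simp only [Pi.add_apply, Pi.single_eq_same]; exact hkey.le
        · simp [hk]
      · simp only [Pi.add_apply, Pi.single_eq_same]; exact hkey
    · intro h0
      have := congrFun h0 i
      simp [hij, hi] at this
  · push Not at h
    obtain ⟨i, hi⟩ : ∃ i, v i ≠ 0 := by
      by_contra! hc; exact hv (funext hc)
    have hz : ∀ j, j ≠ i → v j = 0 := by
      intro j hj
      by_contra hj0
      have h1 := h i j hj.symm hi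
      have h2 := h j i hj hj0
      omega
    have hvs : v = Pi.single i (v i) := by
      ext k; by_cases hk : k = i
      · subst hk; simp
      · simp [hk, hz k hk]
    by_cases h0 : i = 0
    · subst h0
      have h01 : (0 : Fin (m + 2)) ≠ 1 := by simp
      refine .of_mul (Matrix.SpecialLinearGroup.transvection h01 1) ?_
      rw [vecMul_transvection]
      refine .of_mul (Matrix.SpecialLinearGroup.transvection h01.symm (-1)) ?_
      rw [vecMul_transvection]
      have : v + Pi.single 1 (v 0 * 1) +
          Pi.single 0 ((v + Pi.single 1 (v 0 * 1) : Fin (m + 2) → ℤ) 1 * -1)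
          = Pi.single 1 (v 0) := by
        rw [hvs]
        ext k
        by_cases hk : k = 0
        · subst hk; simp 
        · by_cases hk1 : k = 1
          · subst hk1; simp
          · simp [hk, hk1]
      rw [this]
      exact isMulRow_single 1 h01.symm _ hi
    · rw [hvs]; exact isMulRow_single i h0 _ hi

/-- The block matrix `[[1,0],[x,g]]`. -/
def blk {R : Type*} [Zero R] [One R] {m : ℕ} (x : Fin m → R) (g : Matrix (Fin m) (Fin m) R) :
    Matrix (Fin (m + 1)) (Fin (m + 1)) R :=
  Matrix.of (Fin.cons (Fin.cons 1 0) fun i => Fin.cons (x i) (g i))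

section blk
variable {R : Type*} [CommRing R] {m : ℕ}

@[simp] lemma blk_zero_zero (x : Fin m → R) (g : Matrix (Fin m) (Fin m) R) : blk x g 0 0 = 1 := rfl
@[simp] lemma blk_zero_succ (x : Fin m → R) (g : Matrix (Fin m) (Fin m) R) (j : Fin m) :
    blk x g 0 j.succ = 0 := rfl
@[simp] lemma blk_succ_zero (x : Fin m → R) (g : Matrix (Fin m) (Fin m) R) (i : Fin m) :
    blk x g i.succ 0 = x i := rfl
@[simp] lemma blk_succ_succ (x : Fin m → R) (g : Matrix (Fin m) (Fin m) R) (i j : Fin m) :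
    blk x g i.succ j.succ = g i j := rfl

lemma det_blk (x : Fin m → R) (g : Matrix (Fin m) (Fin m) R) : (blk x g).det = g.det := by
  rw [Matrix.det_succ_row_zero, Fin.sum_univ_succ]
  simp only [blk_zero_zero, blk_zero_succ]
  simp
  congr 1

lemma blk_mul (x y : Fin m → R) (g h : Matrix (Fin m) (Fin m) R) :
    blk x g * blk y h = blk (x + g *ᵥ y) (g * h) := by
  ext i j
  rw [Matrix.mul_apply, Fin.sum_univ_succ]
  refine Fin.cases ?_ (fun i => ?_) i <;> refine Fin.cases ?_ (fun j => ?_) j <;>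
    simp [Matrix.mul_apply, Matrix.mulVec, dotProduct]

lemma vecMul_blk_zero (v : Fin (m + 1) → R) (x : Fin m → R) (g : Matrix (Fin m) (Fin m) R) :
    v ᵥ* blk x g = Fin.cons (v 0 + ∑ i, v i.succ * x i) ((fun i => v i.succ) ᵥ* g) := by
  ext j
  rw [Matrix.vecMul, dotProduct, Fin.sum_univ_succ]
  refine Fin.cases ?_ (fun j => ?_) j <;> simp [Matrix.vecMul, dotProduct]

lemma blk_map {S : Type*} [CommRing S] (f : R →+* S) (x : Fin m → R)
    (g : Matrix (Fin m) (Fin m) R) : (blk x g).map f = blk (fun i => f (x i)) (g.map f) := by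
  ext i j
  refine Fin.cases ?_ (fun i => ?_) i <;> refine Fin.cases ?_ (fun j => ?_) j <;> simp

end blk

/-- The stabiliser of `e₀`. -/
def stab {m : ℕ} (i : (Fin m → ℤ) × SLZ m) : SLZ (m + 1) :=
  ⟨blk i.1 i.2.1, by rw [det_blk]; exact i.2.2⟩

lemma stab_injective {m : ℕ} : Function.Injective (stab (m := m)) := by
  rintro ⟨x, g⟩ ⟨y, h⟩ e
  have e' : ∀ i j, blk x g.1 i j = blk y h.1 i j := fun i j =>
    congrFun (congrFun (congrArg Subtype.val e) i) j
  refine Prod.ext (funext fun i => by simpa using e' i.succ 0) (Subtype.ext ?_)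
  ext i j
  simpa using e' i.succ j.succ

lemma ae0_vecMul {m : ℕ} (a : ℤ) (A : Matrix (Fin (m + 1)) (Fin (m + 1)) ℤ) :
    ae0 m a ᵥ* A = a • A 0 := by
  ext j; simp [ae0]

lemma ae0_stab {m : ℕ} (a : ℤ) (i : (Fin m → ℤ) × SLZ m) :
    ae0 m a ᵥ* (stab i).1 = ae0 m a := by
  rw [ae0_vecMul]
  ext j
  refine Fin.cases ?_ (fun j => ?_) j <;> simp [stab, ae0]

lemma exists_stab {m : ℕ} (γ : SLZ (m + 1)) (h : ae0 m 1 ᵥ* γ.1 = ae0 m 1) :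
    ∃ i, stab i = γ := by
  rw [ae0_vecMul, one_smul] at h
  have hb : blk (fun i => γ.1 i.succ 0) (Matrix.of fun i j : Fin m => γ.1 i.succ j.succ) = γ.1 := by
    ext i j
    refine Fin.cases ?_ (fun i => ?_) i
    · rw [h]; refine Fin.cases ?_ (fun j => ?_) j <;> simp [ae0]
    · refine Fin.cases ?_ (fun j => ?_) j <;> simp
  exact ⟨(fun i => γ.1 i.succ 0, ⟨Matrix.of fun i j : Fin m => γ.1 i.succ j.succ, by
    rw [← det_blk (fun i => γ.1 i.succ 0), hb]; exact γ.2⟩), Subtype.ext hb⟩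

/-- The positive multiplicity of a nonzero integer vector. -/
def mulOf {m : ℕ} (v : {v : Fin (m + 2) → ℤ // v ≠ 0}) : ℕ :=
  (isMulRow_of_ne_zero v.1 v.2).choose

/-- A unimodular matrix whose first row is the primitive vector below `v`. -/
def rowOf {m : ℕ} (v : {v : Fin (m + 2) → ℤ // v ≠ 0}) : SLZ (m + 2) :=
  (isMulRow_of_ne_zero v.1 v.2).choose_spec.choose

lemma one_le_mulOf {m : ℕ} (v : {v : Fin (m + 2) → ℤ // v ≠ 0}) : 1 ≤ mulOf v :=
  (isMulRow_of_ne_zero v.1 v.2).choose_spec.choose_spec.1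

lemma ae0_rowOf {m : ℕ} (v : {v : Fin (m + 2) → ℤ // v ≠ 0}) :
    ae0 (m + 1) (mulOf v) ᵥ* (rowOf v).1 = v.1 :=
  (isMulRow_of_ne_zero v.1 v.2).choose_spec.choose_spec.2

lemma vecMul_inv_of_eq {n : ℕ} {γ : SLZ n} {u w : Fin n → ℤ}
    (h : u ᵥ* γ.1 = w) : w ᵥ* (γ⁻¹ : SLZ n).1 = u := by
  rw [← h, Matrix.vecMul_vecMul, ← Matrix.SpecialLinearGroup.coe_mul, mul_inv_cancel,
    Matrix.SpecialLinearGroup.coe_one, Matrix.vecMul_one]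

lemma eq_of_ae0_vecMul {m : ℕ} {a b : ℕ} {γ : SLZ (m + 1)}
    (h : ae0 m a ᵥ* γ.1 = ae0 m b) : a = b := by
  have key : ∀ (a b : ℕ) (γ : SLZ (m + 1)), ae0 m a ᵥ* γ.1 = ae0 m b → a ∣ b := by
    intro a b γ h
    rw [ae0_vecMul] at h
    have := congrFun h 0
    simp only [ae0, Pi.smul_apply, Pi.single_eq_same, smul_eq_mul] at this
    exact Int.natCast_dvd_natCast.mp ⟨_, this.symm⟩
  exact Nat.dvd_antisymm (key _ _ _ h) (key _ _ _ (vecMul_inv_of_eq h))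

/-- The parametrisation of `ℕ₊ × SL_{m+2}(ℤ)` by nonzero vectors and the stabiliser of `e₀`. -/
lemma bijective_mulOf_stab {m : ℕ} : Function.Bijective
    (fun p : {v : Fin (m + 2) → ℤ // v ≠ 0} × ((Fin (m + 1) → ℤ) × SLZ (m + 1)) =>
      ((⟨mulOf p.1, one_le_mulOf p.1⟩ : {a : ℕ // 1 ≤ a}), (rowOf p.1)⁻¹ * stab p.2)) := by
  constructor
  · rintro ⟨v, i⟩ ⟨w, j⟩ h
    simp only [Prod.mk.injEq, Subtype.mk.injEq] at h
    obtain ⟨ha, hγ⟩ := h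
    have hv : v = w := by
      have h1 : ae0 (m + 1) (mulOf v) ᵥ* (((rowOf v)⁻¹ * stab i)⁻¹ : SLZ (m + 2)).1 = v.1 := by
        rw [_root_.mul_inv_rev, inv_inv, Matrix.SpecialLinearGroup.coe_mul, ← Matrix.vecMul_vecMul,
          vecMul_inv_of_eq (ae0_stab _ _), ae0_rowOf]
      have h2 : ae0 (m + 1) (mulOf w) ᵥ* (((rowOf w)⁻¹ * stab j)⁻¹ : SLZ (m + 2)).1 = w.1 := by
        rw [_root_.mul_inv_rev, inv_inv, Matrix.SpecialLinearGroup.coe_mul, ← Matrix.vecMul_vecMul,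
          vecMul_inv_of_eq (ae0_stab _ _), ae0_rowOf]
      exact Subtype.ext (by rw [← h1, ← h2, hγ, ha])
    subst hv
    rw [mul_right_inj] at hγ
    rw [stab_injective hγ]
  · rintro ⟨⟨a, ha⟩, γ⟩
    set w := ae0 (m + 1) a ᵥ* (γ⁻¹ : SLZ (m + 2)).1 with hw
    have hwγ : w ᵥ* γ.1 = ae0 (m + 1) a := by
      have := vecMul_inv_of_eq hw.symm
      rwa [inv_inv] at this
    have hw0 : w ≠ 0 := by
      intro h0
      rw [h0, Matrix.zero_vecMul] at hwγ
      have := congrFun hwγ 0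
      simp [ae0] at this
      omega
    have h1 := ae0_rowOf ⟨w, hw0⟩
    have h2 : ae0 (m + 1) (mulOf ⟨w, hw0⟩) ᵥ* (rowOf ⟨w, hw0⟩ * γ : SLZ (m + 2)).1
        = ae0 (m + 1) a := by
      rw [Matrix.SpecialLinearGroup.coe_mul, ← Matrix.vecMul_vecMul, h1]
      exact hwγ
    have h3 := eq_of_ae0_vecMul h2
    rw [h3] at h2
    have h4 : ae0 (m + 1) 1 ᵥ* (rowOf ⟨w, hw0⟩ * γ : SLZ (m + 2)).1
        = ae0 (m + 1) 1 := by
      rw [ae0_vecMul] at h2 ⊢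
      ext j
      have := congrFun h2 j
      have ha' : (a : ℤ) ≠ 0 := by positivity
      apply mul_left_cancel₀ ha'
      simp only [Pi.smul_apply, smul_eq_mul, ae0, one_mul] at this ⊢
      rw [this]
      refine Fin.cases ?_ (fun j => ?_) j <;> simp
    obtain ⟨i, hi⟩ := exists_stab _ h4
    refine ⟨(⟨w, hw0⟩, i), ?_⟩
    simp only [Prod.mk.injEq, Subtype.mk.injEq]
    exact ⟨h3, by rw [hi]; group⟩

/-- A matrix of determinant one with first row `v`. -/
def rowMat {m : ℕ} (v : Fin (m + 2) → ℝ) : Matrix (Fin (m + 2)) (Fin (m + 2)) ℝ :=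
  Matrix.of (Fin.cons v fun j : Fin (m + 1) => Pi.single j.succ (if j = 0 then (v 0)⁻¹ else 1))

lemma det_rowMat {m : ℕ} (v : Fin (m + 2) → ℝ) (hv : v 0 ≠ 0) : (rowMat v).det = 1 := by
  have h : (rowMat v).BlockTriangular id := by
    intro i j hij
    refine Fin.cases (fun h => ?_) (fun i h => ?_) i hij
    · simp at h
    · have : j ≠ i.succ := by rintro rfl; simp at h
      simp [rowMat, this]
  rw [Matrix.det_of_isUpperTriangular h, Fin.prod_univ_succ, Fin.prod_univ_succ]
  simp [rowMat, hv]

/-- Coordinates adapted to the stabiliser of `e₀`. -/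
def Theta {m : ℕ} (v : Fin (m + 2) → ℝ) (x : Fin (m + 1) → ℝ) (g : RM (m + 1)) : RM (m + 2) :=
  (blk x (Matrix.of g) * rowMat v : Matrix _ _ ℝ)

lemma Theta_eq_cons {m : ℕ} (v : Fin (m + 2) → ℝ) (x : Fin (m + 1) → ℝ) (g : RM (m + 1)) :
    Theta v x g = Fin.cons v (rmulR (rowMat v) fun i => Fin.cons (x i) (g i)) := by
  ext i j
  refine Fin.cases ?_ (fun i => ?_) i
  · simp only [Theta, Matrix.mul_apply, Fin.sum_univ_succ (n := m + 1), Fin.cons_zero,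
      blk_zero_zero, blk_zero_succ]
    simp [rowMat]
  · simp only [Theta, Matrix.mul_apply, Fin.cons_succ, rmulR, Matrix.vecMul, dotProduct]
    rfl

lemma mdet_Theta {m : ℕ} (v : Fin (m + 2) → ℝ) (hv : v 0 ≠ 0) (x : Fin (m + 1) → ℝ)
    (g : RM (m + 1)) : mdet (Theta v x g) = mdet g := by
  show Matrix.det (blk x (Matrix.of g) * rowMat v) = Matrix.det (Matrix.of g)
  rw [Matrix.det_mul, det_blk, det_rowMat v hv, mul_one]

lemma vact_Theta {m : ℕ} (w : Fin (m + 2) → ℤ) (v : Fin (m + 2) → ℝ) (x : Fin (m + 1) → ℝ)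
    (g : RM (m + 1)) : vact w (Theta v x g) =
      (Fin.cons (w 0 + ∑ i, (w i.succ : ℝ) * x i) (vact (fun i => w i.succ) g) :
        Fin (m + 2) → ℝ) ᵥ* rowMat v := by
  show intVec w ᵥ* (blk x (Matrix.of g) * rowMat v) = _
  rw [← Matrix.vecMul_vecMul, vecMul_blk_zero]
  rfl

lemma vact_ae0_Theta {m : ℕ} (a : ℤ) (v : Fin (m + 2) → ℝ) (x : Fin (m + 1) → ℝ)
    (g : RM (m + 1)) : vact (ae0 (m + 1) a) (Theta v x g) = (a : ℝ) • v := by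
  have : ae0 (m + 1) a = a • ae0 (m + 1) 1 := by
    ext j; simp [ae0, Pi.single_apply]
  rw [this, vact_smul]
  congr 1
  ext j
  simp only [vact, Theta_eq_cons, Matrix.vecMul, dotProduct, Fin.sum_univ_succ (n := m + 1)]
  simp [intVec, ae0]

lemma gact_stab_Theta {m : ℕ} (i : (Fin (m + 1) → ℤ) × SLZ (m + 1)) (v : Fin (m + 2) → ℝ)
    (x : Fin (m + 1) → ℝ) (g : RM (m + 1)) :
    gact (stab i) (Theta v x g) =
      Theta v (intVec i.1 + i.2.1.map (Int.cast : ℤ → ℝ) *ᵥ x) (gact i.2 g) := by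
  show (blk i.1 i.2.1).map (Int.cast : ℤ → ℝ) * (blk x (Matrix.of g) * rowMat v) = _
  rw [← Matrix.mul_assoc]
  have := blk_map (Int.castRingHom ℝ) i.1 i.2.1
  simp only [Int.coe_castRingHom] at this
  rw [this, blk_mul]
  rfl

lemma continuous_Theta {m : ℕ} (v : Fin (m + 2) → ℝ) :
    Continuous fun p : (Fin (m + 1) → ℝ) × RM (m + 1) => Theta v p.1 p.2 := by
  simp only [Theta_eq_cons]
  refine continuous_pi fun i => ?_
  refine Fin.cases ?_ (fun i => ?_) i
  · simp only [Fin.cons_zero]; exact continuous_const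
  · simp only [Fin.cons_succ, rmulR]
    refine Continuous.matrix_vecMul ?_ continuous_const
    refine continuous_pi fun j => ?_
    refine Fin.cases ?_ (fun j => ?_) j
    · simp only [Fin.cons_zero]; fun_prop
    · simp only [Fin.cons_succ]; fun_prop

lemma measurable_Theta {m : ℕ} :
    Measurable fun p : (Fin (m + 2) → ℝ) × (Fin (m + 1) → ℝ) × RM (m + 1) =>
      Theta p.1 p.2.1 p.2.2 := by
  simp only [Theta_eq_cons]
  refine measurable_pi_lambda _ fun i => ?_
  refine Fin.cases ?_ (fun i => ?_) i
  · simp only [Fin.cons_zero]; exact measurable_fst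
  · simp only [Fin.cons_succ, rmulR]
    refine measurable_pi_lambda _ fun j => ?_
    simp only [Matrix.vecMul, dotProduct, Fin.sum_univ_succ (n := m + 1), Fin.cons_zero,
      Fin.cons_succ]
    refine Measurable.add ?_ (Finset.measurable_fun_sum _ fun k _ => ?_)
    · simp only [rowMat, Matrix.of_apply, Fin.cons_zero]; fun_prop
    · refine Measurable.mul (by fun_prop) ?_
      simp only [rowMat, Matrix.of_apply, Fin.cons_succ, Pi.single_apply]
      split_ifs <;> fun_prop

/-- `ℝ^{k+1}`-valued families split off their first coordinates. -/
def splitRows (k n : ℕ) : (Fin k → Fin (n + 1) → ℝ) ≃ᵐ (Fin k → ℝ) × (Fin k → Fin n → ℝ) :=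
  (MeasurableEquiv.piCongrRight fun _ => MeasurableEquiv.piFinSuccAbove (fun _ => ℝ) 0).trans
    (MeasurableEquiv.arrowProdEquivProdArrow ℝ (Fin n → ℝ) (Fin k))

lemma measurePreserving_splitRows (k n : ℕ) :
    MeasurePreserving (splitRows k n) volume volume :=
  (volume_measurePreserving_arrowProdEquivProdArrow ℝ (Fin n → ℝ) (Fin k)).comp
    (volume_preserving_pi fun _ => volume_preserving_piFinSuccAbove (fun _ : Fin (n + 1) => ℝ) 0)

lemma splitRows_symm_apply (k n : ℕ) (p : (Fin k → ℝ) × (Fin k → Fin n → ℝ)) :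
    (splitRows k n).symm p = fun i => Fin.cons (p.1 i) (p.2 i) := by
  rw [MeasurableEquiv.symm_apply_eq]
  rfl

lemma lintegral_cons {n : ℕ} {X : Type*} [MeasureSpace X] [SigmaFinite (volume : Measure X)]
    {f : (Fin (n + 1) → X) → ℝ≥0∞} (hf : Measurable f) :
    ∫⁻ g, f g = ∫⁻ v : X, ∫⁻ r : Fin n → X, f (Fin.cons v r) := by
  have h := volume_preserving_piFinSuccAbove (fun _ : Fin (n + 1) => X) 0
  rw [← h.symm.lintegral_comp hf]
  rw [show (volume : Measure (X × (Fin n → X))) = volume.prod volume from rfl,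
    lintegral_prod _ (show Measurable fun a : X × (Fin n → X) =>
      f ((MeasurableEquiv.piFinSuccAbove (fun _ => X) 0).symm a) from
        hf.comp (MeasurableEquiv.measurable _)).aemeasurable]
  have e : ∀ (x : X) (y : Fin n → X),
      (Fin.insertNthEquiv (fun _ => X) 0) (x, y) = Fin.cons x y := fun x y =>
    Fin.insertNth_zero' x y
  simp only [MeasurableEquiv.piFinSuccAbove_symm_apply, e]

lemma ae_zero_ne_zero (m : ℕ) : ∀ᵐ v : Fin (m + 1) → ℝ, v 0 ≠ 0 := by
  exact Measure.ae_eval_ne (μ := fun _ : Fin (m + 1) => (volume : Measure ℝ)) 0 0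

lemma lintegral_Theta {m : ℕ} {f : RM (m + 2) → ℝ≥0∞} (hf : Measurable f) :
    ∫⁻ g, f g = ∫⁻ v : Fin (m + 2) → ℝ, ∫⁻ p : (Fin (m + 1) → ℝ) × RM (m + 1),
      f (Theta v p.1 p.2) := by
  rw [lintegral_cons hf]
  refine lintegral_congr_ae ?_
  filter_upwards [ae_zero_ne_zero (m + 1)] with v hv
  have hfv : Measurable fun r : Fin (m + 1) → Fin (m + 2) → ℝ => f (Fin.cons v r) := by
    refine hf.comp (measurable_pi_lambda _ fun i => ?_)
    refine Fin.cases ?_ (fun i => ?_) i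
    · simp only [Fin.cons_zero]; exact measurable_const
    · simp only [Fin.cons_succ]; fun_prop
  have h1 := measurePreserving_rmulR (k := m + 1) _ (det_rowMat v hv)
  rw [← h1.lintegral_comp hfv,
    ← (measurePreserving_splitRows (m + 1) (m + 1)).symm.lintegral_comp
 (show Measurable fun r => f (Fin.cons v (rmulR (rowMat v) r)) from
        hfv.comp h1.measurable)]
  simp only [splitRows_symm_apply, Theta_eq_cons]

lemma setLIntegral_Theta {m : ℕ} {f : RM (m + 2) → ℝ≥0∞} (hf : Measurable f) :
    ∫⁻ g in DD (m + 2), f g = ∫⁻ v : Fin (m + 2) → ℝ,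
      ∫⁻ p : (Fin (m + 1) → ℝ) × RM (m + 1) in Set.univ ×ˢ DD (m + 1), f (Theta v p.1 p.2) := by
  rw [← lintegral_indicator (measurableSet_DD _),
    lintegral_Theta (hf.indicator (measurableSet_DD _))]
  refine lintegral_congr_ae ?_
  filter_upwards [ae_zero_ne_zero (m + 1)] with v hv
  rw [← lintegral_indicator (MeasurableSet.univ.prod (measurableSet_DD _))]
  refine lintegral_congr fun p => ?_
  simp only [Set.indicator, DD, Set.mem_ofPred_eq, mdet_Theta v hv, Set.mem_prod, Set.mem_univ,
    true_and]

/-- A measurable function whose periodisation over `SL_n(ℤ)` is `1` on `DD n`. -/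
structure IsWeight {n : ℕ} (φ : RM n → ℝ≥0∞) : Prop where
  measurable : Measurable φ
  tsum_eq_one : ∀ g ∈ DD n, ∑' γ : SLZ n, φ (gact γ g) = 1

lemma measurePreserving_gact_DD {n : ℕ} (γ : SLZ n) :
    MeasurePreserving (gact γ : RM n → RM n) (volume.restrict (DD n)) (volume.restrict (DD n)) := by
  have h := (measurePreserving_gact γ).restrict_preimage (measurableSet_DD n)
  rwa [show gact γ ⁻¹' DD n = DD n from Set.ext fun g => gact_mem_DD] at h

/-- Half-open unit box. -/
def ubox (m : ℕ) : Set (Fin m → ℝ) := Set.pi Set.univ fun _ => Set.Ioc 0 1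

lemma measurableSet_ubox (m : ℕ) : MeasurableSet (ubox m) :=
  MeasurableSet.univ_pi fun _ => measurableSet_Ioc

lemma tsum_ubox {m : ℕ} (y : Fin m → ℝ) :
    ∑' k : Fin m → ℤ, (ubox m).indicator (1 : (Fin m → ℝ) → ℝ≥0∞) (intVec k + y) = 1 := by
  have h : ∀ i, ∃! k : ℤ, y i + k • (1 : ℝ) ∈ Set.Ioc (0 : ℝ) (0 + 1) := fun i =>
    existsUnique_add_zsmul_mem_Ioc one_pos (y i) 0
  choose k hk hu using h
  have hk1 : intVec k + y ∈ ubox m := by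
    intro i _
    have := hk i
    simpa [intVec, add_comm] using this
  rw [tsum_eq_single k]
  · simp [hk1]
  · intro k' hk'
    refine Set.indicator_of_notMem (fun hmem => hk' ?_) _
    funext i
    refine hu i (k' i) ?_
    have := hmem i trivial
    simpa [intVec, add_comm] using this

/-- Action of the stabiliser on the adapted coordinates. -/
def stabAct {m : ℕ} (i : (Fin m → ℤ) × SLZ m) (p : (Fin m → ℝ) × RM m) : (Fin m → ℝ) × RM m :=
  (intVec i.1 + i.2.1.map (Int.cast : ℤ → ℝ) *ᵥ p.1, gact i.2 p.2)

/-- Inversion in the stabiliser. -/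
def stabInv (m : ℕ) : ((Fin m → ℤ) × SLZ m) ≃ ((Fin m → ℤ) × SLZ m) :=
  Function.Involutive.toPerm (fun i => (-((i.2⁻¹).1 *ᵥ i.1), i.2⁻¹)) (by
    rintro ⟨k, γ⟩
    simp only [inv_inv, Prod.mk.injEq, and_true, Matrix.mulVec_neg, neg_neg, Matrix.mulVec_mulVec]
    rw [← Matrix.SpecialLinearGroup.coe_mul, mul_inv_cancel, Matrix.SpecialLinearGroup.coe_one,
      Matrix.one_mulVec])

lemma map_intCast_det {n : ℕ} (γ : SLZ n) :
    Matrix.det (γ.1.map (Int.cast : ℤ → ℝ)) = 1 := by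
  have := (Int.castRingHom ℝ).map_det γ.1
  rw [γ.2] at this
  simpa using this.symm

lemma stabAct_stabInv {m : ℕ} (i : (Fin m → ℤ) × SLZ m) (p : (Fin m → ℝ) × RM m) :
    stabAct (stabInv m i) (stabAct i p) = p := by
  obtain ⟨k, γ⟩ := i
  obtain ⟨x, g⟩ := p
  show (intVec (-((γ⁻¹).1 *ᵥ k)) + (γ⁻¹).1.map (Int.cast : ℤ → ℝ) *ᵥ
    (intVec k + γ.1.map (Int.cast : ℤ → ℝ) *ᵥ x), gact γ⁻¹ (gact γ g)) = (x, g)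
  rw [← gact_mul, inv_mul_cancel, gact_one, Matrix.mulVec_add, Matrix.mulVec_mulVec]
  have h1 : (γ⁻¹).1.map (Int.cast : ℤ → ℝ) * γ.1.map (Int.cast : ℤ → ℝ) = 1 := by
    have := Matrix.map_mul (f := Int.castRingHom ℝ) (L := (γ⁻¹).1) (M := γ.1)
    rw [← Matrix.SpecialLinearGroup.coe_mul, inv_mul_cancel,
      Matrix.SpecialLinearGroup.coe_one, Matrix.map_one _ (by simp) (by simp)] at this
    exact this.symm
  have h2 : intVec (-((γ⁻¹).1 *ᵥ k)) = -((γ⁻¹).1.map (Int.cast : ℤ → ℝ) *ᵥ intVec k) := by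
    ext j; simp [intVec, Matrix.mulVec, dotProduct]
  rw [h1, h2, Matrix.one_mulVec]
  simp

lemma measurePreserving_mulVec {n : ℕ} (A : Matrix (Fin n) (Fin n) ℝ) (hA : A.det = 1) :
    MeasurePreserving (fun v : Fin n → ℝ => A *ᵥ v) volume volume := by
  have := measurePreserving_vecMul Aᵀ (by rw [Matrix.det_transpose, hA])
  simpa only [Matrix.vecMul_transpose] using this

lemma measurePreserving_stabAct {m : ℕ} (i : (Fin m → ℤ) × SLZ m) :
    MeasurePreserving (stabAct i) (volume.restrict (Set.univ ×ˢ DD m))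
      (volume.restrict (Set.univ ×ˢ DD m)) := by
  have h1 : MeasurePreserving (fun x : Fin m → ℝ =>
      intVec i.1 + i.2.1.map (Int.cast : ℤ → ℝ) *ᵥ x) volume volume :=
    (measurePreserving_add_left volume (intVec i.1)).comp
      (measurePreserving_mulVec _ (map_intCast_det i.2))
  have h := h1.prod (measurePreserving_gact i.2)
  have h2 := MeasurePreserving.restrict_preimage (f := stabAct i) (μa := volume) (μb := volume)
    h (MeasurableSet.univ.prod (measurableSet_DD m))
  rwa [show stabAct i ⁻¹' (Set.univ ×ˢ DD m) = Set.univ ×ˢ DD m from by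
    ext p; simp [stabAct, gact_mem_DD]] at h2

/-- The weight on the adapted coordinates. -/
def cwt {m : ℕ} (φ : RM m → ℝ≥0∞) (p : (Fin m → ℝ) × RM m) : ℝ≥0∞ :=
  (ubox m).indicator 1 p.1 * φ p.2

lemma measurable_cwt {m : ℕ} {φ : RM m → ℝ≥0∞} (hφ : Measurable φ) : Measurable (cwt φ) := by
  unfold cwt
  exact ((measurable_one.indicator (measurableSet_ubox m)).comp measurable_fst).mul
    (hφ.comp measurable_snd)

lemma tsum_cwt {m : ℕ} {φ : RM m → ℝ≥0∞} (hφ : IsWeight φ) (p : (Fin m → ℝ) × RM m)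
    (hp : p.2 ∈ DD m) : ∑' i, cwt φ (stabAct i p) = 1 := by
  rw [ENNReal.tsum_prod', ENNReal.tsum_comm]
  simp only [cwt, stabAct]
  simp_rw [ENNReal.tsum_mul_right, tsum_ubox, one_mul]
  exact hφ.tsum_eq_one _ hp

lemma unfold {m : ℕ} {φ : RM (m + 2) → ℝ≥0∞} (hφ : IsWeight φ) {φ' : RM (m + 1) → ℝ≥0∞}
    (hφ' : IsWeight φ') (Φ : (Fin (m + 2) → ℤ) → RM (m + 2) → ℝ≥0∞)
    (hΦm : ∀ v, Measurable (Φ v)) (hΦ : ∀ v (γ : SLZ (m + 2)) g, Φ v (gact γ g) = Φ (v ᵥ* γ.1) g) :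
    ∫⁻ g in DD (m + 2), φ g * ∑' v : {v : Fin (m + 2) → ℤ // v ≠ 0}, Φ v g =
      ∫⁻ v : Fin (m + 2) → ℝ, ∫⁻ p : (Fin (m + 1) → ℝ) × RM (m + 1) in Set.univ ×ˢ DD (m + 1),
        cwt φ' p * ∑' a : {a : ℕ // 1 ≤ a}, Φ (ae0 (m + 1) (a : ℕ)) (Theta v p.1 p.2) := by
  have hTm : ∀ u : Fin (m + 2) → ℝ, Measurable fun p : (Fin (m + 1) → ℝ) × RM (m + 1) =>
      Theta u p.1 p.2 := fun u => (continuous_Theta u).measurable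
  have hF : ∀ v : {v : Fin (m + 2) → ℤ // v ≠ 0}, Measurable fun g =>
      φ (gact (rowOf v)⁻¹ g) * Φ (ae0 (m + 1) (mulOf v)) g := fun v =>
    (hφ.measurable.comp (measurable_gact _)).mul (hΦm _)
  simp_rw [← ENNReal.tsum_mul_left (a := φ _)]
  rw [lintegral_tsum fun v => (hφ.measurable.fun_mul (hΦm _)).aemeasurable]
  have step : ∀ v : {v : Fin (m + 2) → ℤ // v ≠ 0},
      ∫⁻ g in DD (m + 2), φ g * Φ v g = ∫⁻ u : Fin (m + 2) → ℝ,
        ∫⁻ p : (Fin (m + 1) → ℝ) × RM (m + 1) in Set.univ ×ˢ DD (m + 1),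
          φ (gact (rowOf v)⁻¹ (Theta u p.1 p.2)) *
            Φ (ae0 (m + 1) (mulOf v)) (Theta u p.1 p.2) := by
    intro v
    rw [← (measurePreserving_gact_DD (rowOf v)⁻¹).lintegral_comp (hφ.measurable.fun_mul (hΦm v)),
      ← setLIntegral_Theta (hF v)]
    refine lintegral_congr fun g => ?_
    rw [hΦ, vecMul_inv_of_eq (ae0_rowOf v)]
  simp_rw [step]
  rw [← lintegral_tsum]
  swap
  · intro v
    refine Measurable.aemeasurable ?_
    exact Measurable.lintegral_prod_right' (f := fun q : (Fin (m + 2) → ℝ) ×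
      ((Fin (m + 1) → ℝ) × RM (m + 1)) => φ (gact (rowOf v)⁻¹ (Theta q.1 q.2.1 q.2.2)) *
            Φ (ae0 (m + 1) (mulOf v)) (Theta q.1 q.2.1 q.2.2)) ((hF v).comp measurable_Theta)
  refine lintegral_congr_ae ?_
  filter_upwards [ae_zero_ne_zero (m + 1)] with u hu
  have step2 : ∀ v : {v : Fin (m + 2) → ℤ // v ≠ 0},
      ∫⁻ p : (Fin (m + 1) → ℝ) × RM (m + 1) in Set.univ ×ˢ DD (m + 1),
          φ (gact (rowOf v)⁻¹ (Theta u p.1 p.2)) *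
            Φ (ae0 (m + 1) (mulOf v)) (Theta u p.1 p.2) =
      ∫⁻ p : (Fin (m + 1) → ℝ) × RM (m + 1) in Set.univ ×ˢ DD (m + 1), cwt φ' p *
        ∑' i, φ (gact ((rowOf v)⁻¹ * stab i) (Theta u p.1 p.2)) *
            Φ (ae0 (m + 1) (mulOf v)) (Theta u p.1 p.2) := by
    intro v
    have h := lintegral_mul_tsum_swap (volume.restrict (Set.univ ×ˢ DD (m + 1)))
      (stabAct (m := m + 1)) (stabInv (m + 1)) measurePreserving_stabAct stabAct_stabInv
      ((hF v).comp (hTm u)) (measurable_cwt hφ'.measurable)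
    rw [setLIntegral_congr_fun (g := fun p => (((fun g =>
      φ (gact (rowOf v)⁻¹ g) * Φ (ae0 (m + 1) (mulOf v)) g) ∘ fun p : (Fin (m + 1) → ℝ) ×
      RM (m + 1) => Theta u p.1 p.2) p) * ∑' i, cwt φ' (stabAct i p))
      (MeasurableSet.univ.prod (measurableSet_DD _)) ?_, h]
    · refine lintegral_congr fun p => ?_
      congr 1
      refine tsum_congr fun i => ?_
      simp only [Function.comp, stabAct]
      rw [← gact_stab_Theta, ← gact_mul, hΦ, ae0_stab]
    · intro p hp
      simp only [Function.comp]
      rw [tsum_cwt hφ' p hp.2, mul_one]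
  simp_rw [step2]
  rw [← lintegral_tsum]
  swap
  · intro v
    refine Measurable.aemeasurable ((measurable_cwt hφ'.measurable).fun_mul
      (Measurable.tsum fun i => ?_))
    exact ((hφ.measurable.comp (measurable_gact _)).mul (hΦm _)).comp (hTm u)
  refine setLIntegral_congr_fun (MeasurableSet.univ.prod (measurableSet_DD _)) fun p hp => ?_
  rw [ENNReal.tsum_mul_left, ← ENNReal.tsum_prod]
  congr 1
  have := (Equiv.ofBijective _ (bijective_mulOf_stab (m := m))).tsum_eq
    (fun q : {a : ℕ // 1 ≤ a} × SLZ (m + 2) => φ (gact q.2 (Theta u p.1 p.2)) *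
      Φ (ae0 (m + 1) (q.1 : ℕ)) (Theta u p.1 p.2))
  refine this.trans ?_
  rw [ENNReal.tsum_prod']
  refine tsum_congr fun a => ?_
  dsimp only
  rw [ENNReal.tsum_mul_right, hφ.tsum_eq_one, one_mul]
  have := mdet_Theta u hu p.1 p.2
  simp only [DD, Set.mem_ofPred_eq, this]
  exact hp.2

/-- Bounded part of `DD n`. -/
def KK (n j : ℕ) : Set (RM n) := {g | g ∈ DD n ∧ ∀ i k, |g i k| ≤ j}

lemma isCompact_KK (n j : ℕ) : IsCompact (KK n j) := by
  have h : KK n j = DD n ∩ Metric.closedBall 0 j := by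
    ext g
    simp [KK, pi_norm_le_iff_of_nonneg (Nat.cast_nonneg j : (0 : ℝ) ≤ j)]
  rw [h]
  exact (isCompact_closedBall _ _).inter_left
    ((isClosed_le continuous_const continuous_mdet).inter
      (isClosed_le continuous_mdet continuous_const))

lemma measurableSet_KK (n j : ℕ) : MeasurableSet (KK n j) := (isCompact_KK n j).measurableSet

lemma finite_KK_return (n j : ℕ) : {γ : SLZ n | ∃ g ∈ KK n j, gact γ g ∈ KK n j}.Finite := by
  obtain ⟨B, hB⟩ : ∃ B : ℤ, ∀ h ∈ KK n j, ∀ g ∈ KK n j, ∀ i k,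
      |(Matrix.of h * (Matrix.of g).adjugate) i k| ≤ B := by
    have hc : Continuous fun p : RM n × RM n => (Matrix.of p.1 * (Matrix.of p.2).adjugate) := by
      have h1 : Continuous fun p : RM n × RM n => (Matrix.of p.1) := continuous_fst
      have h2 : Continuous fun p : RM n × RM n => (Matrix.of p.2) := continuous_snd
      exact h1.matrix_mul h2.matrix_adjugate
    have hb : ∀ i k, ∃ b : ℝ, ∀ p ∈ KK n j ×ˢ KK n j,
        |(Matrix.of p.1 * (Matrix.of p.2).adjugate) i k| ≤ b := fun i k =>
      ((isCompact_KK n j).prod (isCompact_KK n j)).exists_bound_of_continuousOn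
        ((continuous_apply_apply i k).comp hc).continuousOn
    choose b hb using hb
    refine ⟨⌈∑ i, ∑ k, |b i k|⌉, fun h hh g hg i k => ?_⟩
    refine (hb i k (h, g) ⟨hh, hg⟩).trans ((le_abs_self _).trans (le_trans ?_ (Int.le_ceil _)))
    exact (Finset.single_le_sum (f := fun k => |b i k|) (fun _ _ => abs_nonneg _)
      (Finset.mem_univ k)).trans (Finset.single_le_sum (f := fun i => ∑ k, |b i k|)
      (fun _ _ => Finset.sum_nonneg fun _ _ => abs_nonneg _) (Finset.mem_univ i))
  have hfin : (Set.pi Set.univ fun _ : Fin n => Set.pi Set.univ fun _ : Fin n =>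
      Set.Icc (-B) B).Finite := Set.Finite.pi fun _ => Set.Finite.pi fun _ => Set.finite_Icc _ _
  refine Set.Finite.of_finite_image (f := fun γ : SLZ n => (γ.1 : Fin n → Fin n → ℤ))
    (hfin.subset ?_) Subtype.val_injective.injOn
  rintro _ ⟨γ, ⟨g, hg, hγ⟩, rfl⟩ i - k -
  have h1 : Matrix.of (gact γ g) * (Matrix.of g).adjugate
      = mdet g • γ.1.map (Int.cast : ℤ → ℝ) := by
    show (γ.1.map (Int.cast : ℤ → ℝ) * Matrix.of g) * (Matrix.of g).adjugate = _
    rw [Matrix.mul_assoc, Matrix.mul_adjugate, Matrix.mul_smul, Matrix.mul_one]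
    rfl
  have h2 := hB _ hγ _ hg i k
  rw [h1, Matrix.smul_apply, Matrix.map_apply, smul_eq_mul, abs_mul] at h2
  have h3 : (1 : ℝ) ≤ |mdet g| := hg.1.1.trans (le_abs_self _)
  have h4 : |((γ.1 i k : ℤ) : ℝ)| ≤ B :=
    (le_mul_of_one_le_left (abs_nonneg _) h3).trans h2
  rw [Set.mem_Icc, ← abs_le]
  exact_mod_cast h4

/-- Number of translates of `g` in `KK n j`. -/
def KKcount (n j : ℕ) (g : RM n) : ℝ≥0∞ := ∑' γ : SLZ n, (KK n j).indicator 1 (gact γ g)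

/-- A uniform bound for `KKcount`. -/
def KKbound (n j : ℕ) : ℕ := {γ : SLZ n | ∃ g ∈ KK n j, gact γ g ∈ KK n j}.ncard

lemma tsum_gact_invariant {n : ℕ} (f : RM n → ℝ≥0∞) (γ : SLZ n) (g : RM n) :
    ∑' δ : SLZ n, f (gact δ (gact γ g)) = ∑' δ : SLZ n, f (gact δ g) := by
  simp_rw [← gact_mul]
  exact (Equiv.mulRight γ).tsum_eq fun δ => f (gact δ g)

lemma KKcount_le (n j : ℕ) (g : RM n) : KKcount n j g ≤ KKbound n j := by
  by_cases h : ∃ γ : SLZ n, gact γ g ∈ KK n j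
  · obtain ⟨γ, hγ⟩ := h
    rw [KKcount, ← tsum_gact_invariant _ γ]
    have hfin := finite_KK_return n j
    rw [tsum_eq_sum (s := hfin.toFinset), KKbound, Set.ncard_eq_toFinset_card _ hfin]
    · refine (Finset.sum_le_card_nsmul _ _ 1 fun δ _ => ?_).trans (by simp)
      exact Set.indicator_le_self' (fun _ _ => zero_le) _
    · intro δ hδ
      refine Set.indicator_of_notMem (fun hm => hδ ?_) _
      exact hfin.mem_toFinset.mpr ⟨_, hγ, hm⟩
  · push Not at h
    simp [KKcount, h]

/-- A positive function with finite periodisation. -/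
def preWt (n : ℕ) (g : RM n) : ℝ≥0∞ :=
  ∑' j : ℕ, (2⁻¹ ^ (j + 1) * ((KKbound n j : ℝ≥0∞) + 1)⁻¹) * (KK n j).indicator 1 g

lemma measurable_preWt (n : ℕ) : Measurable (preWt n) :=
  Measurable.tsum fun j => (measurable_one.indicator (measurableSet_KK n j)).const_mul _

lemma tsum_preWt_le (n : ℕ) (g : RM n) : ∑' γ : SLZ n, preWt n (gact γ g) ≤ 1 := by
  unfold preWt
  rw [ENNReal.tsum_comm]
  calc ∑' j : ℕ, ∑' γ : SLZ n, (2⁻¹ ^ (j + 1) * ((KKbound n j : ℝ≥0∞) + 1)⁻¹) *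
        (KK n j).indicator 1 (gact γ g)
      ≤ ∑' j : ℕ, (2⁻¹ : ℝ≥0∞) ^ (j + 1) := by
        refine ENNReal.tsum_le_tsum fun j => ?_
        rw [ENNReal.tsum_mul_left, mul_assoc]
        refine mul_le_of_le_one_right' ?_
        calc ((KKbound n j : ℝ≥0∞) + 1)⁻¹ * KKcount n j g
            ≤ ((KKbound n j : ℝ≥0∞) + 1)⁻¹ * ((KKbound n j : ℝ≥0∞) + 1) := by
              gcongr
              exact (KKcount_le n j g).trans le_self_add
          _ = 1 := ENNReal.inv_mul_cancel (by simp) (by finiteness)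
    _ = 1 := by rw [ENNReal.tsum_geometric_add_one]; simp [ENNReal.inv_mul_cancel]

lemma preWt_pos {n : ℕ} {g : RM n} (hg : g ∈ DD n) : preWt n g ≠ 0 := by
  obtain ⟨j, hj⟩ := exists_nat_ge (∑ i, ∑ k, |g i k|)
  have hj' : g ∈ KK n j := ⟨hg, fun i k => le_trans
    ((Finset.single_le_sum (f := fun k => |g i k|) (fun _ _ => abs_nonneg _)
      (Finset.mem_univ k)).trans (Finset.single_le_sum (f := fun i => ∑ k, |g i k|)
      (fun _ _ => Finset.sum_nonneg fun _ _ => abs_nonneg _) (Finset.mem_univ i))) hj⟩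
  intro h0
  have := ENNReal.tsum_eq_zero.mp h0 j
  simp [hj'] at this

/-- The normalised weight. -/
def wt (n : ℕ) (g : RM n) : ℝ≥0∞ := preWt n g / ∑' γ : SLZ n, preWt n (gact γ g)

lemma isWeight_wt (n : ℕ) : IsWeight (wt n) := by
  refine ⟨(measurable_preWt n).div
    (Measurable.tsum fun γ => (measurable_preWt n).comp (measurable_gact γ)), fun g hg => ?_⟩
  unfold wt
  simp_rw [tsum_gact_invariant (preWt n)]
  simp_rw [div_eq_mul_inv]
  rw [ENNReal.tsum_mul_right]
  refine ENNReal.mul_inv_cancel (fun h => ?_) ((tsum_preWt_le n g).trans_lt ENNReal.one_lt_top).ne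
  have := ENNReal.tsum_eq_zero.mp h 1
  rw [gact_one] at this
  exact preWt_pos hg this

/-- Integrals over bounded sets are controlled by weighted integrals. -/
lemma setLIntegral_KK_le {n : ℕ} (j : ℕ) {G : RM n → ℝ≥0∞} (hG : Measurable G)
    (hinv : ∀ (γ : SLZ n) g, G (gact γ g) = G g) :
    ∫⁻ g in KK n j, G g ≤ KKbound n j * ∫⁻ g in DD n, wt n g * G g := by
  have hsub : KK n j ⊆ DD n := fun g hg => hg.1
  have h := lintegral_mul_tsum_swap (volume.restrict (DD n)) (gact (n := n))
    (Equiv.inv (SLZ n)) measurePreserving_gact_DD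
    (fun γ g => by rw [Equiv.inv_apply, ← gact_mul, inv_mul_cancel, gact_one])
    (α := (KK n j).indicator G) (β := wt n) (hG.indicator (measurableSet_KK n j))
    (isWeight_wt n).measurable
  calc ∫⁻ g in KK n j, G g = ∫⁻ g in DD n, (KK n j).indicator G g := by
        rw [lintegral_indicator (measurableSet_KK n j),
          Measure.restrict_restrict (measurableSet_KK n j), Set.inter_eq_left.mpr hsub]
    _ = ∫⁻ g in DD n, (KK n j).indicator G g * ∑' γ : SLZ n, wt n (gact γ g) :=
        setLIntegral_congr_fun (measurableSet_DD n) fun g hg => by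
          rw [(isWeight_wt n).tsum_eq_one g hg, mul_one]
    _ = _ := h
    _ ≤ ∫⁻ g in DD n, KKbound n j * (wt n g * G g) := by
        refine lintegral_mono fun g => ?_
        have : ∀ γ : SLZ n, (KK n j).indicator G (gact γ g)
            = (KK n j).indicator 1 (gact γ g) * G g := by
          intro γ
          by_cases hm : gact γ g ∈ KK n j <;> simp [hm, hinv]
        simp_rw [this]
        rw [ENNReal.tsum_mul_right, ← mul_assoc, ← mul_assoc, mul_comm (wt n g)]
        gcongr
        exact KKcount_le n j g
    _ = _ := lintegral_const_mul _ ((isWeight_wt n).measurable.mul hG)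

/-- `ζ(n)` in `[0, ∞]`. -/
def zetaE (n : ℕ) : ℝ≥0∞ := ∑' a : {a : ℕ // 1 ≤ a}, ENNReal.ofReal (((a : ℕ) : ℝ) ^ n)⁻¹

lemma zetaE_ne_top {n : ℕ} (hn : 2 ≤ n) : zetaE n ≠ ⊤ := by
  have h : Summable fun a : ℕ => (((a : ℕ) : ℝ) ^ n)⁻¹ := by
    simpa using Real.summable_nat_pow_inv.mpr hn
  exact (h.comp_injective Subtype.val_injective).tsum_ofReal_ne_top

lemma lintegral_comp_smul_pi {n : ℕ} {f : (Fin n → ℝ) → ℝ≥0∞} (hf : Measurable f) {a : ℝ}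
    (ha : 0 < a) : ∫⁻ v, f (a • v) = ENNReal.ofReal (a ^ n)⁻¹ * ∫⁻ v, f v := by
  have h := Measure.map_addHaar_smul (volume : Measure (Fin n → ℝ)) ha.ne'
  rw [← lintegral_map hf (measurable_const_smul a), h, lintegral_smul_measure]
  simp [abs_of_pos ha]

lemma restrict_univ_prod_DD (m : ℕ) :
    (volume : Measure ((Fin m → ℝ) × RM m)).restrict (Set.univ ×ˢ DD m) =
      (volume : Measure (Fin m → ℝ)).prod (volume.restrict (DD m)) := by
  rw [show (volume : Measure ((Fin m → ℝ) × RM m)) = volume.prod volume from rfl,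
    ← Measure.prod_restrict, Measure.restrict_univ]

lemma volume_ubox (m : ℕ) : volume (ubox m) = 1 := by
  rw [ubox, volume_pi, Measure.pi_pi]
  simp

lemma lintegral_cwt {m : ℕ} {φ : RM m → ℝ≥0∞} (hφ : Measurable φ)
    {H : RM m → ℝ≥0∞} (hH : Measurable H) :
    ∫⁻ p : (Fin m → ℝ) × RM m in Set.univ ×ˢ DD m, cwt φ p * H p.2 = ∫⁻ g in DD m, φ g * H g := by
  rw [restrict_univ_prod_DD]
  have := lintegral_prod_mul (μ := (volume : Measure (Fin m → ℝ))) (ν := volume.restrict (DD m))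
    (f := (ubox m).indicator 1) (g := fun g => φ g * H g)
    (measurable_one.indicator (measurableSet_ubox m)).aemeasurable (hφ.mul hH).aemeasurable
  rw [lintegral_indicator_one (measurableSet_ubox m), volume_ubox, one_mul] at this
  rw [← this]
  refine lintegral_congr fun p => ?_
  rw [cwt, mul_assoc]

/-- First moment formula. -/
lemma first_moment {m : ℕ} (f : (Fin (m + 2) → ℝ) → ℝ → ℝ≥0∞)
    (hf : Measurable (Function.uncurry f)) :
    ∫⁻ g in DD (m + 2), wt (m + 2) g *
        ∑' v : {v : Fin (m + 2) → ℤ // v ≠ 0}, f (vact v.1 g) (mdet g) =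
      zetaE (m + 2) * ∫⁻ z : Fin (m + 2) → ℝ, ∫⁻ g in DD (m + 1), wt (m + 1) g * f z (mdet g) := by
  rw [unfold (isWeight_wt _) (isWeight_wt (m + 1)) (fun v g => f (vact v g) (mdet g))
    (fun v => hf.comp ((measurable_vact v).prodMk measurable_mdet))
    (fun v γ g => by rw [vact_gact, mdet_gact])]
  have hw := (isWeight_wt (m + 1)).measurable
  set G : (Fin (m + 2) → ℝ) → ℝ≥0∞ := fun z => ∫⁻ g in DD (m + 1), wt (m + 1) g * f z (mdet g)
    with hG
  have hGm : Measurable G := by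
    refine Measurable.lintegral_prod_right' (f := fun q : (Fin (m + 2) → ℝ) × RM (m + 1) =>
      wt (m + 1) q.2 * f q.1 (mdet q.2)) ?_
    exact (hw.comp measurable_snd).mul
      (hf.comp (measurable_fst.prodMk (measurable_mdet.comp measurable_snd)))
  have h1 : ∀ a : {a : ℕ // 1 ≤ a}, ∀ u : Fin (m + 2) → ℝ,
      Measurable fun g : RM (m + 1) => f (((a : ℕ) : ℝ) • u) (mdet g) := fun a u =>
    hf.comp (measurable_const.prodMk measurable_mdet)
  calc _ = ∫⁻ u : Fin (m + 2) → ℝ, ∑' a : {a : ℕ // 1 ≤ a}, G (((a : ℕ) : ℝ) • u) := by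
        refine lintegral_congr_ae ?_
        filter_upwards [ae_zero_ne_zero (m + 1)] with u hu
        simp_rw [mdet_Theta u hu, vact_ae0_Theta, Int.cast_natCast]
        rw [lintegral_cwt (H := fun g => ∑' a : {a : ℕ // 1 ≤ a},
          f (((a : ℕ) : ℝ) • u) (mdet g)) hw (Measurable.tsum fun a => h1 a u)]
        simp_rw [← ENNReal.tsum_mul_left]
        rw [lintegral_tsum fun a => (hw.fun_mul (h1 a u)).aemeasurable]
    _ = ∑' a : {a : ℕ // 1 ≤ a}, ∫⁻ u : Fin (m + 2) → ℝ, G (((a : ℕ) : ℝ) • u) :=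
        lintegral_tsum fun a => (hGm.comp (measurable_const_smul _)).aemeasurable
    _ = _ := by
        rw [zetaE, ← ENNReal.tsum_mul_right]
        refine tsum_congr fun a => ?_
        exact lintegral_comp_smul_pi hGm (by exact_mod_cast a.2)

/-- Total mass of the weight. -/
def wtI (n : ℕ) : ℝ≥0∞ := ∫⁻ g in DD n, wt n g

lemma volume_supBox {n : ℕ} {r : ℝ} :
    volume {z : Fin n → ℝ | ∀ i, |z i| ≤ r} = ENNReal.ofReal (2 * r) ^ n := by
  have : {z : Fin n → ℝ | ∀ i, |z i| ≤ r} = Set.pi Set.univ fun _ => Set.Icc (-r) r := by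
    ext z; simp only [Set.mem_ofPred_eq, Set.mem_pi, Set.mem_univ, true_imp_iff, Set.mem_Icc, abs_le]
  rw [this, volume_pi, Measure.pi_pi]
  simp [two_mul]

lemma exists_short_vector {m : ℕ} {g : RM (m + 2)} (hg : g ∈ DD (m + 2)) :
    ∃ v : Fin (m + 2) → ℤ, v ≠ 0 ∧ ∀ i, |vact v g i| ≤ 2 := by
  set s : Set (Fin (m + 2) → ℝ) :=
    {x | ∀ i, |(x ᵥ* Matrix.of g) i| ≤ 2} with hs
  set L := (Submodule.span ℤ (Set.range (Pi.basisFun ℝ (Fin (m + 2))))).toAddSubgroup with hL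
  have hdet : LinearMap.det (Matrix.toLin' (Matrix.of g)ᵀ) = mdet g := by
    rw [LinearMap.det_toLin', Matrix.det_transpose]; rfl
  have hg0 : 0 < mdet g := lt_of_lt_of_le one_pos hg.1
  have hvol : volume s = ENNReal.ofReal |(mdet g)⁻¹| * ENNReal.ofReal (2 * 2) ^ (m + 2) := by
    rw [← volume_supBox, ← hdet,
      ← Measure.addHaar_preimage_linearMap volume (by rw [hdet]; exact hg0.ne')]
    congr 1
    ext x
    simp [hs, Matrix.mulVec_transpose]
  have hlt : volume (ZSpan.fundamentalDomain (Pi.basisFun ℝ (Fin (m + 2)))) *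
      2 ^ Module.finrank ℝ (Fin (m + 2) → ℝ) < volume s := by
    rw [ZSpan.volume_fundamentalDomain, hvol]
    have h1 : (Matrix.of (Pi.basisFun ℝ (Fin (m + 2)))).det = 1 := by
      rw [show (Matrix.of (Pi.basisFun ℝ (Fin (m + 2))) : Matrix _ _ ℝ) = 1 from by
        ext i j; simp [Matrix.one_apply, Pi.single_apply, eq_comm], Matrix.det_one]
    rw [h1, abs_one, ENNReal.ofReal_one, one_mul, Module.finrank_fin_fun,
      ← ENNReal.ofReal_pow (by norm_num), ← ENNReal.ofReal_mul (abs_nonneg _)]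
    rw [show (2 : ℝ≥0∞) ^ (m + 2) = ENNReal.ofReal (2 ^ (m + 2)) from by
      rw [ENNReal.ofReal_pow (by norm_num)]; simp]
    rw [ENNReal.ofReal_lt_ofReal_iff (by positivity), abs_of_pos (by positivity)]
    have h2 : (1 / 2 : ℝ) ≤ (mdet g)⁻¹ := by
      rw [one_div]; exact inv_anti₀ hg0 hg.2
    have h3 : (1 : ℝ) ≤ 2 ^ m := one_le_pow₀ (by norm_num)
    calc (2 : ℝ) ^ (m + 2) < 1 / 2 * (2 * 2) ^ (m + 2) := by
          rw [mul_pow, pow_succ 2 (m + 1), pow_succ 2 m]; nlinarith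
      _ ≤ _ := by gcongr
  have hconv : Convex ℝ s := by
    have : s = (Matrix.toLin' (Matrix.of g)ᵀ) ⁻¹' (Set.pi Set.univ fun _ => Set.Icc (-2) 2) := by
      ext x
      simp only [hs, Set.mem_preimage, Matrix.toLin'_apply, Matrix.mulVec_transpose, Set.mem_ofPred_eq,
        Set.mem_pi, Set.mem_univ, true_imp_iff, Set.mem_Icc, abs_le]
    rw [this]
    exact (convex_pi fun _ _ => convex_Icc _ _).linear_preimage _
  have hsymm : ∀ x ∈ s, -x ∈ s := by
    intro x hx i
    rw [Matrix.neg_vecMul, Pi.neg_apply, abs_neg]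
    exact hx i
  have : Countable L := (inferInstance :
    Countable (Submodule.span ℤ (Set.range (Pi.basisFun ℝ (Fin (m + 2))))))
  obtain ⟨x, hx0, hxs⟩ := exists_ne_zero_mem_lattice_of_measure_mul_two_pow_lt_measure
    (ZSpan.isAddFundamentalDomain' (Pi.basisFun ℝ (Fin (m + 2))) volume) hsymm hconv hlt
  have hx := ((Pi.basisFun ℝ (Fin (m + 2))).mem_span_iff_repr_mem ℤ (x : Fin (m + 2) → ℝ)).mp x.2
  choose v hv using hx
  have hvx : intVec v = (x : Fin (m + 2) → ℝ) := by
    funext i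
    simpa [intVec] using hv i
  refine ⟨v, ?_, ?_⟩
  · rintro rfl
    apply hx0
    apply Subtype.ext
    rw [← hvx]
    ext i; simp [intVec]
  · intro i
    rw [vact, hvx]
    exact hxs i

lemma wtI_one : wtI 1 ≠ ⊤ := by
  have h1 : ∀ g ∈ DD 1, wt 1 g = 1 := by
    intro g hg
    rw [← (isWeight_wt 1).tsum_eq_one g hg, tsum_eq_single 1 (fun γ hγ => ?_), gact_one]
    exact absurd (Subsingleton.elim γ 1) hγ
  rw [wtI, setLIntegral_congr_fun (g := fun _ => 1) (measurableSet_DD 1) h1, setLIntegral_one]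
  have hsub : DD 1 ⊆ Metric.closedBall 0 2 := by
    intro g hg
    rw [mem_closedBall_zero_iff, pi_norm_le_iff_of_nonneg (by norm_num)]
    intro i
    rw [pi_norm_le_iff_of_nonneg (by norm_num)]
    intro k
    have : mdet g = g i k := by
      rw [mdet, Matrix.det_unique]; simp [Subsingleton.elim i default, Subsingleton.elim k default]
    rw [← this, Real.norm_eq_abs, abs_of_nonneg (by linarith [hg.1])]
    exact hg.2
  exact ((measure_mono hsub).trans_lt measure_closedBall_lt_top).ne

lemma wtI_ne_top (m : ℕ) : wtI (m + 1) ≠ ⊤ := by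
  induction m with
  | zero => exact wtI_one
  | succ m ih =>
    have hm : MeasurableSet {z : Fin (m + 2) → ℝ | ∀ i, |z i| ≤ 2} := by
      simp only [Set.ofPred_forall]
      exact MeasurableSet.iInter fun i =>
        measurableSet_le (measurable_pi_apply i).abs measurable_const
    have h := first_moment (m := m)
      (fun z _ => {z : Fin (m + 2) → ℝ | ∀ i, |z i| ≤ 2}.indicator 1 z)
      ((measurable_one.indicator hm).comp measurable_fst)
    have hle : wtI (m + 2) ≤ ∫⁻ g in DD (m + 2), wt (m + 2) g *
        ∑' v : {v : Fin (m + 2) → ℤ // v ≠ 0},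
          {z : Fin (m + 2) → ℝ | ∀ i, |z i| ≤ 2}.indicator 1 (vact v.1 g) := by
      refine setLIntegral_mono' (measurableSet_DD _) fun g hg => ?_
      obtain ⟨v, hv0, hv⟩ := exists_short_vector hg
      refine le_mul_of_one_le_right' ?_
      refine le_trans ?_ (ENNReal.le_tsum ⟨v, hv0⟩)
      rw [Set.indicator_of_mem (show _ ∈ {z : Fin (m + 2) → ℝ | ∀ i, |z i| ≤ 2} from hv)]
      rfl
    refine (hle.trans_lt ?_).ne
    rw [h]
    refine ENNReal.mul_lt_top (zetaE_ne_top (by omega)).lt_top ?_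
    have : ∀ z : Fin (m + 2) → ℝ, ∫⁻ g in DD (m + 1), wt (m + 1) g *
        {z : Fin (m + 2) → ℝ | ∀ i, |z i| ≤ 2}.indicator 1 z
        = wtI (m + 1) * {z : Fin (m + 2) → ℝ | ∀ i, |z i| ≤ 2}.indicator 1 z := fun z =>
      lintegral_mul_const _ (isWeight_wt (m + 1)).measurable
    simp_rw [this]
    rw [lintegral_const_mul _ (measurable_one.indicator hm), lintegral_indicator_one hm,
      volume_supBox]
    exact ENNReal.mul_lt_top ih.lt_top (by finiteness)

/-- Linear dependence of integer vectors. -/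
def Dep {n : ℕ} (v w : Fin n → ℤ) : Prop := ∃ c d : ℤ, (c ≠ 0 ∨ d ≠ 0) ∧ c • v = d • w

lemma dep_vecMul {n : ℕ} (v w : Fin n → ℤ) (γ : SLZ n) : Dep (v ᵥ* γ.1) (w ᵥ* γ.1) ↔ Dep v w := by
  have key : ∀ (v w : Fin n → ℤ) (γ : SLZ n), Dep v w → Dep (v ᵥ* γ.1) (w ᵥ* γ.1) := by
    rintro v w γ ⟨c, d, h0, h⟩
    exact ⟨c, d, h0, by rw [← Matrix.smul_vecMul, ← Matrix.smul_vecMul, h]⟩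
  refine ⟨fun h => ?_, key v w γ⟩
  have := key _ _ γ⁻¹ h
  rwa [vecMul_inv_of_eq rfl, vecMul_inv_of_eq rfl] at this

lemma dep_ae0 {m : ℕ} {a : ℤ} (ha : a ≠ 0) (w : Fin (m + 1) → ℤ) :
    Dep (ae0 m a) w ↔ (fun i : Fin m => w i.succ) = 0 := by
  constructor
  · rintro ⟨c, d, h0, h⟩
    have hd : d ≠ 0 := by
      rintro rfl
      have := congrFun h 0
      simp [ae0, ha] at this
      simp [this] at h0
    funext i
    have := congrFun h i.succ
    simpa [ae0, hd] using this
  · intro h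
    refine ⟨w 0, a, Or.inr ha, ?_⟩
    funext i
    refine Fin.cases ?_ (fun i => ?_) i
    · simp [ae0, mul_comm]
    · have := congrFun h i
      simp only [Pi.zero_apply] at this
      simp [ae0, this]

/-- Right action of `SL_n(ℤ)` on integer vectors. -/
def vecMulEquiv {n : ℕ} (γ : SLZ n) : (Fin n → ℤ) ≃ (Fin n → ℤ) where
  toFun v := v ᵥ* γ.1
  invFun v := v ᵥ* (γ⁻¹ : SLZ n).1
  left_inv v := vecMul_inv_of_eq rfl
  right_inv v := by
    have := vecMul_inv_of_eq (γ := γ⁻¹) (u := v) rfl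
    rwa [inv_inv] at this

lemma lintegral_ubox_translate {m : ℕ} {P : (Fin m → ℝ) → ℝ≥0∞} (hP : Measurable P)
    (hper : ∀ (k : Fin m → ℤ) x, P (intVec k + x) = P x) (t : Fin m → ℝ) :
    ∫⁻ x in ubox m, P (x + t) = ∫⁻ x in ubox m, P x := by
  have h := lintegral_mul_tsum_swap (volume : Measure (Fin m → ℝ))
    (fun (k : Fin m → ℤ) x => intVec k + x) (Equiv.neg _)
    (fun k => measurePreserving_add_left volume (intVec k))
    (fun k x => by
      have : intVec (-k) = -intVec k := by ext i; simp [intVec]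
      simp [this])
    (α := (ubox m).indicator P) (β := fun x => (ubox m).indicator 1 (x + -t))
    (hP.indicator (measurableSet_ubox m))
    ((measurable_one.indicator (measurableSet_ubox m)).comp (measurable_add_const (-t)))
  have h1 : ∀ x : Fin m → ℝ, ∑' k : Fin m → ℤ,
      (ubox m).indicator (1 : (Fin m → ℝ) → ℝ≥0∞) (intVec k + x + -t) = 1 := by
    intro x; simp_rw [add_assoc]; exact tsum_ubox _
  have h2 : ∀ x : Fin m → ℝ, ∑' k : Fin m → ℤ, (ubox m).indicator P (intVec k + x) = P x := by
    intro x
    have : ∀ k : Fin m → ℤ, (ubox m).indicator P (intVec k + x)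
        = (ubox m).indicator 1 (intVec k + x) * P x := by
      intro k
      by_cases hm : intVec k + x ∈ ubox m <;> simp [hm, hper]
    simp_rw [this]
    rw [ENNReal.tsum_mul_right, tsum_ubox, one_mul]
  simp_rw [h1, h2, mul_one] at h
  rw [lintegral_indicator (measurableSet_ubox m)] at h
  rw [h, ← (measurePreserving_add_right volume t).lintegral_comp
    (show Measurable fun x => (ubox m).indicator 1 (x + -t) * P x from
      ((measurable_one.indicator (measurableSet_ubox m)).comp
        (measurable_add_const (-t))).fun_mul hP),
    ← lintegral_indicator (measurableSet_ubox m)]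
  refine lintegral_congr fun x => ?_
  by_cases hm : x ∈ ubox m <;> simp [hm]

lemma lintegral_Ioc_tsum {H : ℝ → ℝ≥0∞} (hH : Measurable H) :
    ∫⁻ s in Set.Ioc (0 : ℝ) 1, ∑' b : ℤ, H (b + s) = ∫⁻ s, H s := by
  have h := lintegral_mul_tsum_swap (volume : Measure ℝ)
    (fun (k : ℤ) x => (k : ℝ) + x) (Equiv.neg _)
    (fun k => measurePreserving_add_left volume (k : ℝ)) (fun k x => by simp)
    (α := (Set.Ioc (0 : ℝ) 1).indicator 1) (β := H)
    (measurable_one.indicator measurableSet_Ioc) hH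
  have h1 : ∀ x : ℝ, ∑' k : ℤ, (Set.Ioc (0 : ℝ) 1).indicator (1 : ℝ → ℝ≥0∞) (k + x) = 1 := by
    intro x
    obtain ⟨k, hk, hu⟩ := existsUnique_add_zsmul_mem_Ioc one_pos x 0
    rw [tsum_eq_single k]
    · have : (k : ℝ) + x ∈ Set.Ioc (0 : ℝ) 1 := by simpa [add_comm] using hk
      simp only [Set.indicator_of_mem this, Pi.one_apply]
    · intro k' hk'
      refine Set.indicator_of_notMem (fun hmem => hk' (hu k' ?_)) _
      simpa [add_comm] using hmem
  simp_rw [h1, mul_one] at h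
  rw [← h, ← lintegral_indicator measurableSet_Ioc]
  refine lintegral_congr fun x => ?_
  by_cases hm : x ∈ Set.Ioc (0 : ℝ) 1 <;> simp [hm]

lemma lintegral_ubox_tsum {m : ℕ} {w : Fin m → ℤ} (hw : w ≠ 0) {H : ℝ → ℝ≥0∞}
    (hH : Measurable H) :
    ∫⁻ x in ubox m, ∑' b : ℤ, H (b + ∑ i, (w i : ℝ) * x i) = ∫⁻ s, H s := by
  obtain ⟨i₀, hi₀⟩ : ∃ i, w i ≠ 0 := by
    by_contra! hc; exact hw (funext hc)
  have hlin : Measurable fun x : Fin m → ℝ => ∑ i, (w i : ℝ) * x i :=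
    Finset.measurable_fun_sum _ fun i _ => (measurable_pi_apply i).const_mul _
  have hPm : Measurable fun x : Fin m → ℝ => ∑' b : ℤ, H (b + ∑ i, (w i : ℝ) * x i) :=
    Measurable.tsum fun b => hH.comp (hlin.const_add _)
  have htr : ∀ s : ℝ, ∫⁻ x in ubox m, ∑' b : ℤ, H (b + (∑ i, (w i : ℝ) * x i + s))
      = ∫⁻ x in ubox m, ∑' b : ℤ, H (b + ∑ i, (w i : ℝ) * x i) := by
    intro s
    rw [← lintegral_ubox_translate hPm ?_ (Pi.single i₀ (s / w i₀))]
    · refine lintegral_congr fun x => tsum_congr fun b => ?_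
      congr 2
      simp only [Pi.add_apply, mul_add, Finset.sum_add_distrib, Pi.single_apply, mul_ite,
        mul_zero, Finset.sum_ite_eq', Finset.mem_univ, if_true]
      field_simp
    · intro k x
      rw [← (Equiv.addRight (∑ i, w i * k i)).tsum_eq fun b : ℤ => H (b + ∑ i, (w i : ℝ) * x i)]
      refine tsum_congr fun b => ?_
      congr 1
      simp [intVec, mul_add, Finset.sum_add_distrib, add_assoc]
  calc _ = ∫⁻ s in Set.Ioc (0 : ℝ) 1,
        ∫⁻ x in ubox m, ∑' b : ℤ, H (b + (∑ i, (w i : ℝ) * x i + s)) := by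
        simp_rw [htr]
        rw [lintegral_const]
        simp
    _ = ∫⁻ x in ubox m, ∫⁻ s in Set.Ioc (0 : ℝ) 1,
          ∑' b : ℤ, H (b + (∑ i, (w i : ℝ) * x i + s)) := by
        refine lintegral_lintegral_swap (Measurable.aemeasurable ?_)
        refine Measurable.tsum fun b => hH.comp (measurable_const.add ?_)
        exact (hlin.comp measurable_snd).add measurable_fst
    _ = ∫⁻ x in ubox m, ∫⁻ s, H s := by
        refine lintegral_congr fun x => ?_
        rw [← lintegral_add_left_eq_self H (∑ i, (w i : ℝ) * x i), ← lintegral_Ioc_tsum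
          (H := fun s => H (∑ i, (w i : ℝ) * x i + s)) (hH.comp (measurable_const_add _))]
        refine lintegral_congr fun s => tsum_congr fun b => ?_
        congr 1
        ring
    _ = _ := by rw [lintegral_const, Measure.restrict_apply_univ, volume_ubox, mul_one]

/-- Vectors independent of `ae0 a`, split off their first coordinate. -/
def indepEquiv {m : ℕ} {a : ℤ} (ha : a ≠ 0) :
    {w : Fin (m + 1) → ℤ // ¬ Dep (ae0 m a) w} ≃ {w : Fin m → ℤ // w ≠ 0} × ℤ where
  toFun w := (⟨fun i => w.1 i.succ, fun h => w.2 ((dep_ae0 ha _).mpr h)⟩, w.1 0)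
  invFun p := ⟨Fin.cons p.2 p.1.1, fun h => p.1.2 (by simpa using (dep_ae0 ha _).mp h)⟩
  left_inv w := Subtype.ext (Fin.cons_self_tail w.1)
  right_inv p := by simp

/-- Nonzero vectors dependent on `ae0 a` are the nonzero multiples of the first basis vector. -/
def depEquiv {m : ℕ} {a : ℤ} (ha : a ≠ 0) :
    {w : Fin (m + 1) → ℤ // w ≠ 0 ∧ Dep (ae0 m a) w} ≃ {b : ℤ // b ≠ 0} where
  toFun w := ⟨w.1 0, fun h => w.2.1 <| by
    have h2 := (dep_ae0 ha _).mp w.2.2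
    funext i
    exact Fin.cases h (fun i => congrFun h2 i) i⟩
  invFun b := ⟨ae0 m b, fun h => b.2 (by simpa [ae0] using congrFun h 0), by
    rw [dep_ae0 ha]; funext i; simp [ae0]⟩
  left_inv w := by
    apply Subtype.ext
    have h2 := (dep_ae0 ha _).mp w.2.2
    funext i
    refine Fin.cases ?_ (fun i => ?_) i
    · simp [ae0]
    · simpa [ae0] using (congrFun h2 i).symm
  right_inv b := by simp [ae0]

lemma measurable_Theta_right {m : ℕ} (u : Fin (m + 2) → ℝ) :
    Measurable fun p : (Fin (m + 1) → ℝ) × RM (m + 1) => Theta u p.1 p.2 :=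
  (continuous_Theta u).measurable

lemma lintegral_cons_rowMat {m : ℕ} {u : Fin (m + 2) → ℝ} (hu : u 0 ≠ 0)
    {H : (Fin (m + 2) → ℝ) → ℝ≥0∞} (hH : Measurable H) :
    ∫⁻ z : Fin (m + 1) → ℝ, ∫⁻ τ : ℝ, H ((Fin.cons τ z : Fin (m + 2) → ℝ) ᵥ* rowMat u)
      = ∫⁻ y, H y := by
  have hmp := measurePreserving_vecMul _ (det_rowMat u hu)
  have hH2 : Measurable fun y => H (y ᵥ* rowMat u) := hH.comp hmp.measurable
  rw [← hmp.lintegral_comp hH, lintegral_cons hH2]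
  refine lintegral_lintegral_swap (Measurable.aemeasurable ?_)
  refine hH2.comp ?_
  refine measurable_pi_lambda _ fun i => ?_
  refine Fin.cases ?_ (fun i => ?_) i
  · exact measurable_snd
  · exact (measurable_pi_apply i).comp measurable_fst

lemma measurable_cons_prod {m : ℕ} :
    Measurable fun p : ℝ × (Fin m → ℝ) => (Fin.cons p.1 p.2 : Fin (m + 1) → ℝ) := by
  refine measurable_pi_lambda _ fun i => ?_
  refine Fin.cases ?_ (fun i => ?_) i
  · exact measurable_fst
  · exact (measurable_pi_apply i).comp measurable_snd

lemma lintegral_cwt_mul {m : ℕ} {φ : RM m → ℝ≥0∞} (hφ : Measurable φ)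
    {K : (Fin m → ℝ) × RM m → ℝ≥0∞} (hK : Measurable K) {K' : RM m → ℝ≥0∞}
    (h : ∀ g, ∫⁻ x in ubox m, K (x, g) = K' g) :
    ∫⁻ p in Set.univ ×ˢ DD m, cwt φ p * K p = ∫⁻ g in DD m, φ g * K' g := by
  rw [restrict_univ_prod_DD, lintegral_prod_symm _ ((measurable_cwt hφ).fun_mul hK).aemeasurable]
  refine lintegral_congr fun g => ?_
  have hKg : Measurable fun x => K (x, g) := hK.comp (measurable_id.prodMk measurable_const)
  rw [← h g, ← lintegral_const_mul _ hKg, ← lintegral_indicator (measurableSet_ubox _)]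
  refine lintegral_congr fun x => ?_
  by_cases hx : x ∈ ubox m <;> simp [cwt, hx]

/-- The value of `f` at a vector of the unfolded lattice that is independent of the first one. -/
def sliceTerm {m : ℕ} (u : Fin (m + 3) → ℝ) (f : (Fin (m + 3) → ℝ) → ℝ → ℝ≥0∞)
    (w : {w : Fin (m + 2) → ℤ // w ≠ 0} × ℤ) (p : (Fin (m + 2) → ℝ) × RM (m + 2)) : ℝ≥0∞ :=
  f ((Fin.cons (w.2 + ∑ i, (w.1.1 i : ℝ) * p.1 i) (vact w.1.1 p.2) : Fin (m + 3) → ℝ)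
    ᵥ* rowMat u) (mdet p.2)

lemma indep_inner {m : ℕ} {u : Fin (m + 3) → ℝ} (hu : u 0 ≠ 0)
    (f : (Fin (m + 3) → ℝ) → ℝ → ℝ≥0∞) (hf : Measurable (Function.uncurry f)) (c : ℝ → ℝ≥0∞)
    (hc : Measurable c) :
    ∫⁻ p : (Fin (m + 2) → ℝ) × RM (m + 2) in Set.univ ×ˢ DD (m + 2), cwt (wt (m + 2)) p *
      (c (mdet p.2) * ∑' w : {w : Fin (m + 2) → ℤ // w ≠ 0} × ℤ,
        sliceTerm u f w p)
      = zetaE (m + 2) * ∫⁻ g in DD (m + 1), wt (m + 1) g *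
          (c (mdet g) * ∫⁻ y, f y (mdet g)) := by
  have hw := (isWeight_wt (m + 2)).measurable
  have hR : Measurable fun y : Fin (m + 3) → ℝ => y ᵥ* rowMat u :=
    (measurePreserving_vecMul _ (det_rowMat u hu)).measurable
  have hfm : ∀ w : {w : Fin (m + 2) → ℤ // w ≠ 0} × ℤ,
      Measurable fun p : (Fin (m + 2) → ℝ) × RM (m + 2) =>
        sliceTerm u f w p := by
    intro w
    refine hf.comp (Measurable.prodMk (hR.comp (measurable_cons_prod.comp
      (Measurable.prodMk ?_ ((measurable_vact _).comp measurable_snd))))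
      (measurable_mdet.comp measurable_snd))
    exact (Finset.measurable_fun_sum _ fun i _ =>
      ((measurable_pi_apply i).comp measurable_fst).const_mul _).const_add _
  set f₂ : (Fin (m + 2) → ℝ) → ℝ → ℝ≥0∞ := fun z t =>
    c t * ∫⁻ τ : ℝ, f ((Fin.cons τ z : Fin (m + 3) → ℝ) ᵥ* rowMat u) t with hf₂
  have hf₂m : Measurable (Function.uncurry f₂) := by
    refine (hc.comp measurable_snd).mul ?_
    refine Measurable.lintegral_prod_right' (f := fun q : ((Fin (m + 2) → ℝ) × ℝ) × ℝ =>
      f ((Fin.cons q.2 q.1.1 : Fin (m + 3) → ℝ) ᵥ* rowMat u) q.1.2) ?_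
    exact hf.comp (Measurable.prodMk (hR.comp (measurable_cons_prod.comp
      (measurable_snd.prodMk (measurable_fst.comp measurable_fst))))
      (measurable_snd.comp measurable_fst))
  have hstep : ∀ g : RM (m + 2), ∫⁻ x in ubox (m + 2),
      (c (mdet g) * ∑' w : {w : Fin (m + 2) → ℤ // w ≠ 0} × ℤ,
        sliceTerm u f w (x, g)) = ∑' w : {w : Fin (m + 2) → ℤ // w ≠ 0},
            f₂ (vact w.1 g) (mdet g) := by
    intro g
    have hfx : ∀ w : {w : Fin (m + 2) → ℤ // w ≠ 0} × ℤ, Measurable fun x : Fin (m + 2) → ℝ =>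
        sliceTerm u f w (x, g) := fun w =>
      (hfm w).comp (measurable_id.prodMk measurable_const)
    rw [lintegral_const_mul _ (Measurable.tsum hfx)]
    simp_rw [hf₂, ENNReal.tsum_mul_left]
    congr 1
    simp_rw [ENNReal.tsum_prod']
    rw [lintegral_tsum fun w => (Measurable.tsum fun b => hfx (w, b)).aemeasurable]
    refine tsum_congr fun w => ?_
    refine lintegral_ubox_tsum w.2
      (H := fun τ => f ((Fin.cons τ (vact w.1 g) : Fin (m + 3) → ℝ) ᵥ* rowMat u) (mdet g)) ?_
    exact hf.comp (Measurable.prodMk (hR.comp (measurable_cons_prod.comp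
      (measurable_id.prodMk measurable_const))) measurable_const)
  have hfirst := first_moment (m := m) f₂ hf₂m
  have hK : Measurable fun p : (Fin (m + 2) → ℝ) × RM (m + 2) =>
      c (mdet p.2) * ∑' w, sliceTerm u f w p :=
    (hc.comp (measurable_mdet.comp measurable_snd)).fun_mul (Measurable.tsum hfm)
  rw [lintegral_cwt_mul hw hK hstep]
  calc _ = _ := hfirst
    _ = _ := by
        congr 1
        have hm1 : Measurable fun q : (Fin (m + 2) → ℝ) × RM (m + 1) =>
            wt (m + 1) q.2 * f₂ q.1 (mdet q.2) :=
          ((isWeight_wt _).measurable.comp measurable_snd).mul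
            (hf₂m.comp (measurable_fst.prodMk (measurable_mdet.comp measurable_snd)))
        rw [lintegral_lintegral_swap hm1.aemeasurable]
        refine lintegral_congr fun g => ?_
        have hm2 : Measurable fun z => f₂ z (mdet g) :=
          hf₂m.comp (measurable_id.prodMk measurable_const)
        rw [lintegral_const_mul _ hm2]
        congr 1
        simp only [hf₂]
        have hm3 : Measurable fun z : Fin (m + 2) → ℝ =>
            ∫⁻ τ : ℝ, f ((Fin.cons τ z : Fin (m + 3) → ℝ) ᵥ* rowMat u) (mdet g) := by
          refine Measurable.lintegral_prod_right' (f := fun q : (Fin (m + 2) → ℝ) × ℝ =>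
            f ((Fin.cons q.2 q.1 : Fin (m + 3) → ℝ) ᵥ* rowMat u) (mdet g)) ?_
          exact hf.comp (Measurable.prodMk (hR.comp (measurable_cons_prod.comp
            (measurable_snd.prodMk measurable_fst))) measurable_const)
        rw [lintegral_const_mul _ hm3]
        congr 1
        exact lintegral_cons_rowMat hu (H := fun y => f y (mdet g))
          (hf.comp (measurable_id.prodMk measurable_const))

lemma lintegral_tsum_smul {n : ℕ} {G : (Fin n → ℝ) → ℝ≥0∞} (hG : Measurable G) :
    ∫⁻ u, ∑' a : {a : ℕ // 1 ≤ a}, G (((a : ℕ) : ℝ) • u) = zetaE n * ∫⁻ u, G u := by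
  have hm : ∀ a : {a : ℕ // 1 ≤ a}, Measurable fun u => G (((a : ℕ) : ℝ) • u) := fun a =>
    hG.comp (measurable_const_smul _)
  rw [lintegral_tsum fun a => (hm a).aemeasurable, zetaE, ← ENNReal.tsum_mul_right]
  exact tsum_congr fun a => lintegral_comp_smul_pi hG (by exact_mod_cast a.2)

lemma tsum_vecMul_indep {n : ℕ} (F : (Fin n → ℤ) → ℝ≥0∞) (v : Fin n → ℤ) (γ : SLZ n) :
    ∑' w : {w // ¬ Dep v w}, F (w.1 ᵥ* γ.1) = ∑' w : {w // ¬ Dep (v ᵥ* γ.1) w}, F w.1 := by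
  rw [← ((vecMulEquiv γ).subtypeEquiv (p := fun w => ¬ Dep v w)
    (q := fun w => ¬ Dep (v ᵥ* γ.1) w) fun w => (not_congr (dep_vecMul v w γ)).symm).tsum_eq]
  rfl

lemma tsum_vecMul_dep {n : ℕ} (F : (Fin n → ℤ) → ℝ≥0∞) (v : Fin n → ℤ) (γ : SLZ n) :
    ∑' w : {w // w ≠ 0 ∧ Dep v w}, F (w.1 ᵥ* γ.1)
      = ∑' w : {w // w ≠ 0 ∧ Dep (v ᵥ* γ.1) w}, F w.1 := by
  rw [← ((vecMulEquiv γ).subtypeEquiv (p := fun w => w ≠ 0 ∧ Dep v w)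
    (q := fun w => w ≠ 0 ∧ Dep (v ᵥ* γ.1) w) fun w => ?_).tsum_eq]
  · rfl
  · refine and_congr (not_congr ?_) (dep_vecMul v w γ).symm
    rw [← (vecMulEquiv γ).injective.eq_iff]
    simp [vecMulEquiv]

lemma indep_moment {m : ℕ} (f : (Fin (m + 3) → ℝ) → ℝ → ℝ≥0∞)
    (hf : Measurable (Function.uncurry f)) :
    ∫⁻ g in DD (m + 3), wt (m + 3) g * ∑' v : {v : Fin (m + 3) → ℤ // v ≠ 0},
        f (vact v.1 g) (mdet g) *
          ∑' w : {w : Fin (m + 3) → ℤ // ¬ Dep v.1 w}, f (vact w.1 g) (mdet g) =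
      zetaE (m + 3) * (zetaE (m + 2) * ∫⁻ g in DD (m + 1), wt (m + 1) g *
        ((∫⁻ y, f y (mdet g)) * ∫⁻ y, f y (mdet g))) := by
  have hfv : ∀ v : Fin (m + 3) → ℤ, Measurable fun g : RM (m + 3) => f (vact v g) (mdet g) :=
    fun v => hf.comp ((measurable_vact v).prodMk measurable_mdet)
  have hΦm : ∀ v : Fin (m + 3) → ℤ, Measurable fun g : RM (m + 3) => f (vact v g) (mdet g) *
      ∑' w : {w : Fin (m + 3) → ℤ // ¬ Dep v w}, f (vact w.1 g) (mdet g) := fun v =>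
    (hfv v).fun_mul (Measurable.tsum fun w => hfv w.1)
  rw [unfold (isWeight_wt _) (isWeight_wt (m + 2)) (fun v g => f (vact v g) (mdet g) *
      ∑' w : {w : Fin (m + 3) → ℤ // ¬ Dep v w}, f (vact w.1 g) (mdet g)) hΦm
    (fun v γ g => by
      simp_rw [vact_gact, mdet_gact]
      rw [tsum_vecMul_indep (fun w => f (vact w g) (mdet g))])]
  have hw := (isWeight_wt (m + 1)).measurable
  have hI : Measurable fun t : ℝ => ∫⁻ y, f y t :=
    Measurable.lintegral_prod_left' (f := Function.uncurry f) hf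
  set G : (Fin (m + 3) → ℝ) → ℝ≥0∞ := fun z =>
    ∫⁻ g in DD (m + 1), wt (m + 1) g * (f z (mdet g) * ∫⁻ y, f y (mdet g)) with hG
  have hGm' : Measurable fun q : (Fin (m + 3) → ℝ) × RM (m + 1) =>
      wt (m + 1) q.2 * (f q.1 (mdet q.2) * ∫⁻ y, f y (mdet q.2)) := by
    refine (hw.comp measurable_snd).mul ((hf.comp (measurable_fst.prodMk
      (measurable_mdet.comp measurable_snd))).mul
      (hI.comp (measurable_mdet.comp measurable_snd)))
  have hGm : Measurable G := Measurable.lintegral_prod_right' hGm'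
  have key : ∀ᵐ u : Fin (m + 3) → ℝ, (∫⁻ p : (Fin (m + 2) → ℝ) × RM (m + 2) in
      Set.univ ×ˢ DD (m + 2), cwt (wt (m + 2)) p * ∑' a : {a : ℕ // 1 ≤ a},
        (f (vact (ae0 (m + 2) (a : ℕ)) (Theta u p.1 p.2)) (mdet (Theta u p.1 p.2)) *
      ∑' w : {w : Fin (m + 3) → ℤ // ¬ Dep (ae0 (m + 2) ((a : ℕ) : ℤ)) w},
        f (vact w.1 (Theta u p.1 p.2)) (mdet (Theta u p.1 p.2))))
      = ∑' a : {a : ℕ // 1 ≤ a}, zetaE (m + 2) * G (((a : ℕ) : ℝ) • u) := by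
    filter_upwards [ae_zero_ne_zero (m + 2)] with u hu
    simp_rw [← ENNReal.tsum_mul_left (a := cwt _ _)]
    have hTm := measurable_Theta_right (m := m + 1) u
    have hm : ∀ a : {a : ℕ // 1 ≤ a}, Measurable fun p : (Fin (m + 2) → ℝ) × RM (m + 2) =>
        cwt (wt (m + 2)) p *
        (f (vact (ae0 (m + 2) (a : ℕ)) (Theta u p.1 p.2)) (mdet (Theta u p.1 p.2)) *
      ∑' w : {w : Fin (m + 3) → ℤ // ¬ Dep (ae0 (m + 2) ((a : ℕ) : ℤ)) w},
        f (vact w.1 (Theta u p.1 p.2)) (mdet (Theta u p.1 p.2))) := fun a =>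
      (measurable_cwt (isWeight_wt _).measurable).mul ((hΦm _).comp hTm)
    rw [lintegral_tsum fun a => (hm a).aemeasurable]
    refine tsum_congr fun a => ?_
    have ha : ((a : ℕ) : ℤ) ≠ 0 := by have := a.2; omega
    rw [hG, ← indep_inner hu f hf (fun t => f (((a : ℕ) : ℝ) • u) t)
      (hf.comp (measurable_const.prodMk measurable_id))]
    refine lintegral_congr fun p => ?_
    rw [vact_ae0_Theta, Int.cast_natCast, mdet_Theta u hu, ← (indepEquiv ha).symm.tsum_eq]
    congr 2
    refine tsum_congr fun w => ?_
    rw [vact_Theta]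
    simp [indepEquiv, sliceTerm]
  rw [lintegral_congr_ae key]
  simp_rw [ENNReal.tsum_mul_left]
  have hm : Measurable fun u => ∑' a : {a : ℕ // 1 ≤ a}, G (((a : ℕ) : ℝ) • u) :=
    Measurable.tsum fun a => hGm.comp (measurable_const_smul _)
  rw [lintegral_const_mul _ hm, lintegral_tsum_smul hGm, mul_left_comm]
  congr 2
  rw [hG, lintegral_lintegral_swap hGm'.aemeasurable]
  refine lintegral_congr fun g => ?_
  have hfz : Measurable fun z => f z (mdet g) := hf.comp (measurable_id.prodMk measurable_const)
  rw [lintegral_const_mul _ (hfz.mul_const _), lintegral_mul_const _ hfz]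

/-- The constant in the estimate for dependent pairs. -/
def depConst : ℝ≥0∞ :=
  (∑' a : {a : ℕ // 1 ≤ a}, ENNReal.ofReal (((a : ℕ) : ℝ) ^ (-(3 / 2) : ℝ))) *
    ∑' b : {b : ℤ // b ≠ 0}, ENNReal.ofReal (|(b : ℤ)| ^ (-(3 / 2) : ℝ) : ℝ)

lemma depConst_ne_top : depConst ≠ ⊤ := by
  refine ENNReal.mul_ne_top ?_ ?_
  · have h : Summable fun a : ℕ => (a : ℝ) ^ (-(3 / 2) : ℝ) :=
      Real.summable_nat_rpow.mpr (by norm_num)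
    exact (h.subtype {a : ℕ | 1 ≤ a}).tsum_ofReal_ne_top
  · have h : Summable fun b : ℤ => |(b : ℝ)| ^ (-(3 / 2) : ℝ) :=
      Real.summable_abs_int_rpow (by norm_num)
    have h2 := (h.subtype {b : ℤ | b ≠ 0}).tsum_ofReal_ne_top
    simp_rw [Int.cast_abs]
    exact h2

lemma lintegral_comp_zsmul_pi {n : ℕ} {f : (Fin n → ℝ) → ℝ≥0∞} (hf : Measurable f) {b : ℤ}
    (hb : b ≠ 0) :
    ∫⁻ v : Fin n → ℝ, f ((b : ℝ) • v) = ENNReal.ofReal (|(b : ℝ)| ^ n)⁻¹ * ∫⁻ v, f v := by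
  have hb' : (0 : ℝ) < |(b : ℝ)| := by simpa using hb
  rcases lt_or_gt_of_ne hb with h | h
  · rw [← lintegral_comp_smul_pi hf hb', ← lintegral_neg_eq_self]
    refine lintegral_congr fun v => ?_
    rw [abs_of_neg (by exact_mod_cast h)]
    simp
  · rw [← lintegral_comp_smul_pi hf hb', abs_of_pos (by exact_mod_cast h)]

lemma rpow_pair_bound {n : ℕ} (hn : 3 ≤ n) {a b : ℝ} (ha : 1 ≤ a) (hb : 1 ≤ b) (hab : a ≤ b) :
    (b ^ n)⁻¹ ≤ a ^ (-(3 / 2) : ℝ) * b ^ (-(3 / 2) : ℝ) := by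
  have h1 : b ^ (-(3 / 2) : ℝ) ≤ a ^ (-(3 / 2) : ℝ) :=
    Real.rpow_le_rpow_of_nonpos (by linarith) hab (by norm_num)
  have h0 : (0 : ℝ) ≤ b ^ (-(3 / 2) : ℝ) := Real.rpow_nonneg (by linarith) _
  calc (b ^ n)⁻¹ ≤ (b ^ 3)⁻¹ := by gcongr
    _ = b ^ (-(3 / 2) : ℝ) * b ^ (-(3 / 2) : ℝ) := by
        rw [← Real.rpow_add (by linarith), ← Real.rpow_natCast, ← Real.rpow_neg (by linarith)]
        norm_num
    _ ≤ _ := by gcongr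

lemma lintegral_smul_mul_zsmul_le {n : ℕ} (hn : 3 ≤ n) {f : (Fin n → ℝ) → ℝ≥0∞}
    (hf : Measurable f) (hf1 : ∀ v, f v ≤ 1) {a : ℕ} (ha : 1 ≤ a) {b : ℤ} (hb : b ≠ 0) :
    ∫⁻ v, f ((a : ℝ) • v) * f ((b : ℝ) • v) ≤ ENNReal.ofReal ((a : ℝ) ^ (-(3 / 2) : ℝ)) *
      ENNReal.ofReal (|(b : ℝ)| ^ (-(3 / 2) : ℝ)) * ∫⁻ v, f v := by
  have ha' : (1 : ℝ) ≤ a := by exact_mod_cast ha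
  have hb' : (1 : ℝ) ≤ |(b : ℝ)| := by exact_mod_cast Int.one_le_abs hb
  rw [← ENNReal.ofReal_mul (by positivity)]
  rcases le_total (a : ℝ) |(b : ℝ)| with h | h
  · calc _ ≤ ∫⁻ v, f ((b : ℝ) • v) := lintegral_mono fun v => mul_le_of_le_one_left' (hf1 _)
      _ = _ := lintegral_comp_zsmul_pi hf hb
      _ ≤ _ := by gcongr; exact rpow_pair_bound hn ha' hb' h
  · calc _ ≤ ∫⁻ v, f ((a : ℝ) • v) := lintegral_mono fun v => mul_le_of_le_one_right' (hf1 _)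
      _ = _ := lintegral_comp_smul_pi hf (by linarith)
      _ ≤ _ := by gcongr; rw [mul_comm]; exact rpow_pair_bound hn hb' ha' h

lemma dep_moment_le {m : ℕ} (f : (Fin (m + 3) → ℝ) → ℝ → ℝ≥0∞)
    (hf : Measurable (Function.uncurry f)) (hf1 : ∀ v t, f v t ≤ 1) :
    ∫⁻ g in DD (m + 3), wt (m + 3) g * ∑' v : {v : Fin (m + 3) → ℤ // v ≠ 0},
        f (vact v.1 g) (mdet g) *
          ∑' w : {w : Fin (m + 3) → ℤ // w ≠ 0 ∧ Dep v.1 w}, f (vact w.1 g) (mdet g) ≤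
      depConst * ∫⁻ g in DD (m + 2), wt (m + 2) g * ∫⁻ y, f y (mdet g) := by
  have hfv : ∀ v : Fin (m + 3) → ℤ, Measurable fun g : RM (m + 3) => f (vact v g) (mdet g) :=
    fun v => hf.comp ((measurable_vact v).prodMk measurable_mdet)
  have hΦm : ∀ v : Fin (m + 3) → ℤ, Measurable fun g : RM (m + 3) => f (vact v g) (mdet g) *
      ∑' w : {w : Fin (m + 3) → ℤ // w ≠ 0 ∧ Dep v w}, f (vact w.1 g) (mdet g) := fun v =>
    (hfv v).fun_mul (Measurable.tsum fun w => hfv w.1)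
  rw [unfold (isWeight_wt _) (isWeight_wt (m + 2)) (fun v g => f (vact v g) (mdet g) *
      ∑' w : {w : Fin (m + 3) → ℤ // w ≠ 0 ∧ Dep v w}, f (vact w.1 g) (mdet g)) hΦm
    (fun v γ g => by
      simp_rw [vact_gact, mdet_gact]
      rw [tsum_vecMul_dep (fun w => f (vact w g) (mdet g))])]
  have hw := (isWeight_wt (m + 2)).measurable
  have hI : Measurable fun t : ℝ => ∫⁻ y, f y t :=
    Measurable.lintegral_prod_left' (f := Function.uncurry f) hf
  set H : (Fin (m + 3) → ℝ) → ℝ → ℝ≥0∞ := fun u t =>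
    ∑' a : {a : ℕ // 1 ≤ a}, ∑' b : {b : ℤ // b ≠ 0},
      f (((a : ℕ) : ℝ) • u) t * f (((b : ℤ) : ℝ) • u) t with hH
  have hab : ∀ c : ℝ, Measurable fun q : (Fin (m + 3) → ℝ) × ℝ => f (c • q.1) q.2 := fun c =>
    hf.comp ((measurable_fst.const_smul c).prodMk measurable_snd)
  have hHm : Measurable (Function.uncurry H) :=
    Measurable.tsum fun a => Measurable.tsum fun b => (hab _).fun_mul (hab _)
  have key : ∀ᵐ u : Fin (m + 3) → ℝ, (∫⁻ p : (Fin (m + 2) → ℝ) × RM (m + 2) in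
      Set.univ ×ˢ DD (m + 2), cwt (wt (m + 2)) p * ∑' a : {a : ℕ // 1 ≤ a},
        (f (vact (ae0 (m + 2) (a : ℕ)) (Theta u p.1 p.2)) (mdet (Theta u p.1 p.2)) *
      ∑' w : {w : Fin (m + 3) → ℤ // w ≠ 0 ∧ Dep (ae0 (m + 2) ((a : ℕ) : ℤ)) w},
        f (vact w.1 (Theta u p.1 p.2)) (mdet (Theta u p.1 p.2))))
      = ∫⁻ g in DD (m + 2), wt (m + 2) g * H u (mdet g) := by
    filter_upwards [ae_zero_ne_zero (m + 2)] with u hu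
    rw [← lintegral_cwt (H := fun g => H u (mdet g)) hw
      (hHm.comp (measurable_const.prodMk measurable_mdet))]
    refine lintegral_congr fun p => ?_
    congr 1
    refine tsum_congr fun a => ?_
    have ha : ((a : ℕ) : ℤ) ≠ 0 := by have := a.2; omega
    rw [vact_ae0_Theta, Int.cast_natCast, mdet_Theta u hu, ← (depEquiv ha).symm.tsum_eq,
      ENNReal.tsum_mul_left]
    congr 1
    refine tsum_congr fun b => ?_
    simp only [depEquiv, Equiv.coe_fn_symm_mk]
    rw [vact_ae0_Theta]
  rw [lintegral_congr_ae key, lintegral_lintegral_swap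
    (((hw.comp measurable_snd).fun_mul (hHm.comp (measurable_fst.prodMk
      (measurable_mdet.comp measurable_snd)))).aemeasurable), ← lintegral_const_mul _
      (show Measurable fun g => wt (m + 2) g * ∫⁻ y, f y (mdet g) from
        hw.fun_mul (hI.comp measurable_mdet))]
  refine lintegral_mono fun g => ?_
  have hfg : Measurable fun y => f y (mdet g) := hf.comp (measurable_id.prodMk measurable_const)
  have hab' : ∀ c : ℝ, Measurable fun u : Fin (m + 3) → ℝ => f (c • u) (mdet g) := fun c =>
    (hab c).comp (measurable_id.prodMk measurable_const)
  have h2 : ∫⁻ u, H u (mdet g) ≤ depConst * ∫⁻ y, f y (mdet g) := by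
    simp only [hH]
    rw [lintegral_tsum fun a => (Measurable.tsum fun b =>
      (hab' _).fun_mul (hab' _)).aemeasurable, depConst, ← ENNReal.tsum_mul_right,
      ← ENNReal.tsum_mul_right]
    refine ENNReal.tsum_le_tsum fun a => ?_
    rw [lintegral_tsum fun b => ((hab' _).fun_mul (hab' _)).aemeasurable,
      ← ENNReal.tsum_mul_left, ← ENNReal.tsum_mul_right]
    refine ENNReal.tsum_le_tsum fun b => ?_
    refine (lintegral_smul_mul_zsmul_le (by omega) hfg (fun v => hf1 v _) a.2 b.2).trans ?_
    simp
  have hHg : Measurable fun u => H u (mdet g) := hHm.comp (measurable_id.prodMk measurable_const)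
  show ∫⁻ u, wt (m + 2) g * H u (mdet g) ≤ _
  rw [lintegral_const_mul _ hHg, mul_left_comm]
  gcongr

/-- The factor normalising a lattice of covolume `t` to covolume one. -/
def scl (n : ℕ) (t : ℝ) : ℝ := t ^ (-(1 / (n : ℝ)))

/-- Indicator of `A` at the normalised vector. -/
def nind {n : ℕ} (A : Set (Fin n → ℝ)) (z : Fin n → ℝ) (t : ℝ) : ℝ≥0∞ :=
  A.indicator 1 (scl n t • z)

/-- Number of nonzero points of the normalised lattice `ℤⁿ g` in `A`. -/
def cnt {n : ℕ} (A : Set (Fin n → ℝ)) (g : RM n) : ℝ≥0∞ :=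
  ∑' v : {v : Fin n → ℤ // v ≠ 0}, nind A (vact v.1 g) (mdet g)

lemma scl_pos (n : ℕ) {t : ℝ} (ht : 0 < t) : 0 < scl n t := Real.rpow_pos_of_pos ht _

lemma scl_pow {n : ℕ} (hn : n ≠ 0) {t : ℝ} (ht : 0 < t) : scl n t ^ n = t⁻¹ := by
  rw [scl, ← Real.rpow_natCast, ← Real.rpow_mul ht.le, ← Real.rpow_neg_one]
  congr 1
  field_simp

lemma measurable_nind {n : ℕ} {A : Set (Fin n → ℝ)} (hA : MeasurableSet A) :
    Measurable (Function.uncurry (nind A)) := by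
  refine (measurable_one.indicator hA).comp ?_
  exact Measurable.smul (measurable_snd.pow_const _) measurable_fst

lemma measurable_nind_left {n : ℕ} {A : Set (Fin n → ℝ)} (hA : MeasurableSet A) (t : ℝ) :
    Measurable fun z => nind A z t :=
  (measurable_one.indicator hA).comp (measurable_const_smul _)

lemma nind_le_one {n : ℕ} (A : Set (Fin n → ℝ)) (z : Fin n → ℝ) (t : ℝ) : nind A z t ≤ 1 :=
  Set.indicator_le_self' (fun _ _ => zero_le) _

lemma lintegral_nind {n : ℕ} (hn : n ≠ 0) {A : Set (Fin n → ℝ)} (hA : MeasurableSet A) {t : ℝ}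
    (ht : 0 < t) : ∫⁻ z, nind A z t = ENNReal.ofReal t * volume A := by
  simp only [nind]
  rw [lintegral_comp_smul_pi (measurable_one.indicator hA) (scl_pos n ht), scl_pow hn ht, inv_inv,
    lintegral_indicator_one hA]

lemma measurable_nind_vact {n : ℕ} {A : Set (Fin n → ℝ)} (hA : MeasurableSet A) (v : Fin n → ℤ) :
    Measurable fun g : RM n => nind A (vact v g) (mdet g) :=
  (measurable_nind hA).comp ((measurable_vact v).prodMk measurable_mdet)

lemma measurable_cnt {n : ℕ} {A : Set (Fin n → ℝ)} (hA : MeasurableSet A) : Measurable (cnt A) :=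
  Measurable.tsum fun v => (measurable_nind hA).comp ((measurable_vact v.1).prodMk measurable_mdet)

lemma cnt_gact {n : ℕ} (A : Set (Fin n → ℝ)) (γ : SLZ n) (g : RM n) :
    cnt A (gact γ g) = cnt A g := by
  simp_rw [cnt, vact_gact, mdet_gact]
  rw [← ((vecMulEquiv γ).subtypeEquiv (p := fun v => v ≠ 0) (q := fun v => v ≠ 0)
    fun v => ?_).tsum_eq fun v : {v : Fin n → ℤ // v ≠ 0} => nind A (vact v.1 g) (mdet g)]
  · rfl
  · rw [← (vecMulEquiv γ).injective.ne_iff]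
    simp [vecMulEquiv]

lemma tsum_ne_zero_split {n : ℕ} (v : Fin n → ℤ) (F : (Fin n → ℤ) → ℝ≥0∞) :
    ∑' w : {w : Fin n → ℤ // w ≠ 0}, F w.1 =
      (∑' w : {w : Fin n → ℤ // ¬ Dep v w}, F w.1) +
        ∑' w : {w : Fin n → ℤ // w ≠ 0 ∧ Dep v w}, F w.1 := by
  have h0 : Dep v 0 := ⟨0, 1, Or.inr one_ne_zero, by simp⟩
  have h1 := tsum_subtype {w : Fin n → ℤ | w ≠ 0} F
  have h2 := tsum_subtype {w : Fin n → ℤ | ¬ Dep v w} F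
  have h3 := tsum_subtype {w : Fin n → ℤ | w ≠ 0 ∧ Dep v w} F
  refine h1.trans ?_
  refine Eq.trans ?_ (congrArg₂ (· + ·) h2 h3).symm
  rw [← ENNReal.tsum_add]
  refine tsum_congr fun w => ?_
  by_cases hw : w = 0
  · simp [hw, h0]
  · by_cases hd : Dep v w <;> simp [hw, hd]

/-- Normalisation in the first moment. -/
def mom1 (m : ℕ) : ℝ≥0∞ :=
  zetaE (m + 3) * ∫⁻ g in DD (m + 2), wt (m + 2) g * ENNReal.ofReal (mdet g)

/-- Normalisation in the second moment. -/
def mom2 (m : ℕ) : ℝ≥0∞ :=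
  zetaE (m + 3) * (zetaE (m + 2) * ∫⁻ g in DD (m + 1), wt (m + 1) g *
    (ENNReal.ofReal (mdet g) * ENNReal.ofReal (mdet g)))

/-- Constant in the variance bound. -/
def varC (m : ℕ) : ℝ≥0∞ :=
  depConst * ∫⁻ g in DD (m + 2), wt (m + 2) g * ENNReal.ofReal (mdet g)

lemma lintegral_wt_mul_ne_top (m : ℕ) {H : RM (m + 1) → ℝ≥0∞} {c : ℝ≥0∞} (hc : c ≠ ⊤)
    (hH : ∀ g ∈ DD (m + 1), H g ≤ c) : ∫⁻ g in DD (m + 1), wt (m + 1) g * H g ≠ ⊤ := by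
  refine ne_top_of_le_ne_top (ENNReal.mul_ne_top (wtI_ne_top m) hc) ?_
  rw [wtI, ← lintegral_mul_const _ (isWeight_wt _).measurable]
  refine setLIntegral_mono' (measurableSet_DD _) fun g hg => ?_
  gcongr
  exact hH g hg

lemma ofReal_mdet_le {n : ℕ} {g : RM n} (hg : g ∈ DD n) : ENNReal.ofReal (mdet g) ≤ 2 := by
  rw [show (2 : ℝ≥0∞) = ENNReal.ofReal 2 by simp]
  exact ENNReal.ofReal_le_ofReal hg.2

lemma mom1_ne_top (m : ℕ) : mom1 m ≠ ⊤ :=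
  ENNReal.mul_ne_top (zetaE_ne_top (by omega))
    (lintegral_wt_mul_ne_top _ (by norm_num) fun _ hg => ofReal_mdet_le hg)

lemma mom2_ne_top (m : ℕ) : mom2 m ≠ ⊤ :=
  ENNReal.mul_ne_top (zetaE_ne_top (by omega)) (ENNReal.mul_ne_top (zetaE_ne_top (by omega))
    (lintegral_wt_mul_ne_top (c := 2 * 2) _ (by norm_num) fun _ hg =>
      mul_le_mul' (ofReal_mdet_le hg) (ofReal_mdet_le hg)))

lemma varC_ne_top (m : ℕ) : varC m ≠ ⊤ :=
  ENNReal.mul_ne_top depConst_ne_top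
    (lintegral_wt_mul_ne_top _ (by norm_num) fun _ hg => ofReal_mdet_le hg)

lemma setLIntegral_wt_mul_nind {m k : ℕ} {A : Set (Fin (k + 1) → ℝ)} (hA : MeasurableSet A) :
    ∫⁻ z, ∫⁻ g in DD m, wt m g * nind A z (mdet g)
      = (∫⁻ g in DD m, wt m g * ENNReal.ofReal (mdet g)) * volume A := by
  have hw := (isWeight_wt m).measurable
  have hf := measurable_nind hA
  have h1 : Measurable fun q : (Fin (k + 1) → ℝ) × RM m => wt m q.2 * nind A q.1 (mdet q.2) :=
    (hw.comp measurable_snd).fun_mul (hf.comp (measurable_fst.prodMk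
      (measurable_mdet.comp measurable_snd)))
  have h2 : Measurable fun g : RM m => wt m g * ENNReal.ofReal (mdet g) :=
    hw.mul measurable_mdet.ennreal_ofReal
  rw [lintegral_lintegral_swap h1.aemeasurable, ← lintegral_mul_const _ h2]
  refine setLIntegral_congr_fun (measurableSet_DD _) fun g hg => ?_
  have hg0 : 0 < mdet g := one_pos.trans_le hg.1
  rw [lintegral_const_mul _ (measurable_nind_left hA _), lintegral_nind k.succ_ne_zero hA hg0]
  exact (mul_assoc _ _ _).symm

lemma setLIntegral_wt_cnt {m : ℕ} {A : Set (Fin (m + 3) → ℝ)} (hA : MeasurableSet A) :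
    ∫⁻ g in DD (m + 3), wt (m + 3) g * cnt A g = mom1 m * volume A := by
  rw [mom1, mul_assoc, ← setLIntegral_wt_mul_nind hA]
  exact first_moment (m := m + 1) (nind A) (measurable_nind hA)

lemma setLIntegral_wt_cnt_sq {m : ℕ} {A : Set (Fin (m + 3) → ℝ)} (hA : MeasurableSet A) :
    ∃ P, P ≤ varC m * volume A ∧
      ∫⁻ g in DD (m + 3), wt (m + 3) g * (cnt A g * cnt A g)
        = mom2 m * (volume A * volume A) + P := by
  have hf := measurable_nind hA
  have hw := (isWeight_wt (m + 3)).measurable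
  have hfv := measurable_nind_vact hA
  have hdep := dep_moment_le (nind A) hf (nind_le_one A)
  have hindep := indep_moment (nind A) hf
  refine ⟨_, hdep.trans_eq ?_, ?_⟩
  · rw [varC, mul_assoc]
    congr 1
    have h2 : Measurable fun g : RM (m + 2) => wt (m + 2) g * ENNReal.ofReal (mdet g) :=
      (isWeight_wt _).measurable.mul measurable_mdet.ennreal_ofReal
    rw [← lintegral_mul_const _ h2]
    refine setLIntegral_congr_fun (measurableSet_DD _) fun g hg => ?_
    have hg0 : 0 < mdet g := one_pos.trans_le hg.1
    rw [lintegral_nind (Nat.succ_ne_zero _) hA hg0]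
    exact (mul_assoc _ _ _).symm
  · have h2 : mom2 m * (volume A * volume A) = zetaE (m + 3) * (zetaE (m + 2) *
        ∫⁻ g in DD (m + 1), wt (m + 1) g *
          ((∫⁻ y, nind A y (mdet g)) * ∫⁻ y, nind A y (mdet g))) := by
      have h3 : Measurable fun g : RM (m + 1) =>
          wt (m + 1) g * (ENNReal.ofReal (mdet g) * ENNReal.ofReal (mdet g)) :=
        (isWeight_wt _).measurable.mul
          (measurable_mdet.ennreal_ofReal.mul measurable_mdet.ennreal_ofReal)
      rw [mom2, mul_assoc, mul_assoc, ← lintegral_mul_const _ h3]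
      congr 2
      refine setLIntegral_congr_fun (measurableSet_DD _) fun g hg => ?_
      have hg0 : 0 < mdet g := one_pos.trans_le hg.1
      rw [lintegral_nind (Nat.succ_ne_zero _) hA hg0]
      ring
    have h4 : Measurable fun g : RM (m + 3) => wt (m + 3) g *
        ∑' v : {v : Fin (m + 3) → ℤ // v ≠ 0}, nind A (vact v.1 g) (mdet g) *
          ∑' w : {w : Fin (m + 3) → ℤ // ¬ Dep v.1 w}, nind A (vact w.1 g) (mdet g) :=
      hw.mul (Measurable.tsum fun v => (hfv v.1).fun_mul (Measurable.tsum fun w => hfv w.1))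
    rw [h2, ← hindep, ← lintegral_add_left h4]
    refine lintegral_congr fun g => ?_
    rw [← mul_add, ← ENNReal.tsum_add]
    congr 1
    have h5 : ∀ v : {v : Fin (m + 3) → ℤ // v ≠ 0}, cnt A g = _ := fun v =>
      tsum_ne_zero_split v.1 fun w => nind A (vact w g) (mdet g)
    calc cnt A g * cnt A g = ∑' v : {v : Fin (m + 3) → ℤ // v ≠ 0},
          nind A (vact v.1 g) (mdet g) * cnt A g := ENNReal.tsum_mul_right.symm
      _ = _ := tsum_congr fun v => by rw [h5 v, mul_add]

section

open scoped Pointwise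

lemma abs_vecMul_le {m n : ℕ} (x : Fin m → ℝ) (A : Matrix (Fin m) (Fin n) ℝ) {r : ℝ}
    (hx : ∀ i, |x i| ≤ r) (j : Fin n) : |(x ᵥ* A) j| ≤ r * ∑ i, |A i j| := by
  rw [Matrix.vecMul, dotProduct, Finset.mul_sum]
  refine (Finset.abs_sum_le_sum_abs _ _).trans (Finset.sum_le_sum fun i _ => ?_)
  rw [abs_mul]
  gcongr
  exact hx i

lemma finite_intVec_bounded {n : ℕ} (r : ℝ) :
    {v : Fin n → ℤ | ∀ i, |intVec v i| ≤ r}.Finite := by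
  refine (Set.finite_Icc (fun _ : Fin n => -⌈r⌉) (fun _ => ⌈r⌉)).subset fun v hv => ?_
  have h : ∀ i, |v i| ≤ ⌈r⌉ := fun i => by
    have := (hv i).trans (Int.le_ceil r)
    simp only [intVec] at this
    exact_mod_cast this
  exact ⟨fun i => (abs_le.mp (h i)).1, fun i => (abs_le.mp (h i)).2⟩

lemma finite_intVec_vecMul {n : ℕ} {A : Matrix (Fin n) (Fin n) ℝ} (hA : A.det ≠ 0) (r : ℝ) :
    {v : Fin n → ℤ | ∀ i, |(intVec v ᵥ* A) i| ≤ r}.Finite := by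
  refine (finite_intVec_bounded (|r| * ∑ j, ∑ i, |A⁻¹ i j|)).subset fun v hv j => ?_
  have h1 : intVec v = (intVec v ᵥ* A) ᵥ* A⁻¹ := by
    rw [Matrix.vecMul_vecMul, Matrix.mul_nonsing_inv _ (isUnit_iff_ne_zero.mpr hA),
      Matrix.vecMul_one]
  rw [h1]
  refine (abs_vecMul_le _ _ (fun i => (hv i).trans (le_abs_self r)) j).trans ?_
  refine mul_le_mul_of_nonneg_left ?_ (abs_nonneg r)
  exact Finset.single_le_sum (f := fun j => ∑ i, |A⁻¹ i j|)
    (fun j _ => Finset.sum_nonneg fun i _ => abs_nonneg _) (Finset.mem_univ j)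

/-- A half-open box of side `k`. -/
def bx (n k : ℕ) : Set (Fin n → ℝ) := Set.pi Set.univ fun _ => Set.Ioc 0 (k : ℝ)

lemma measurableSet_bx (n k : ℕ) : MeasurableSet (bx n k) :=
  MeasurableSet.univ_pi fun _ => measurableSet_Ioc

lemma volume_bx (n k : ℕ) : volume (bx n k) = (k : ℝ≥0∞) ^ n := by
  rw [bx, volume_pi, Measure.pi_pi]
  simp

/-- The matrix of the normalised lattice. -/
def nmat {n : ℕ} (g : RM n) : Matrix (Fin n) (Fin n) ℝ := scl n (mdet g) • Matrix.of g

lemma scl_smul_vact {n : ℕ} (v : Fin n → ℤ) (g : RM n) :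
    scl n (mdet g) • vact v g = intVec v ᵥ* nmat g := by
  rw [nmat, Matrix.vecMul_smul, vact]

lemma det_nmat {n : ℕ} (hn : n ≠ 0) {g : RM n} (hg : 0 < mdet g) : (nmat g).det = 1 := by
  rw [nmat, Matrix.det_smul, Fintype.card_fin, scl_pow hn hg]
  exact inv_mul_cancel₀ hg.ne'

lemma cnt_eq_encard {n : ℕ} (A : Set (Fin n → ℝ)) (g : RM n) :
    cnt A g = {v : Fin n → ℤ | v ≠ 0 ∧ intVec v ᵥ* nmat g ∈ A}.encard := by
  rw [← ENNReal.tsum_set_one,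
    tsum_subtype {v : Fin n → ℤ | v ≠ 0 ∧ intVec v ᵥ* nmat g ∈ A} fun _ => (1 : ℝ≥0∞), cnt]
  refine (tsum_subtype {v : Fin n → ℤ | v ≠ 0} fun v => nind A (vact v g) (mdet g)).trans ?_
  refine tsum_congr fun v => ?_
  by_cases hv : v = 0
  · simp [hv]
  · by_cases hA : intVec v ᵥ* nmat g ∈ A <;> simp [nind, scl_smul_vact, hv, hA]

lemma tendsto_cnt_bx {n : ℕ} (hn : n ≠ 0) {g : RM n} (hg : 0 < mdet g) :
    Tendsto (fun k : ℕ => cnt (bx n k) g / (k : ℝ≥0∞) ^ n) atTop (nhds 1) := by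
  set A := nmat g with hAdef
  have hA : A.det = 1 := det_nmat hn hg
  have hA0 : IsUnit A.det := by rw [hA]; exact isUnit_one
  set B : Set (Fin n → ℝ) := {x | x ᵥ* A ∈ ubox n} with hB
  have hBvol : volume B = 1 := by
    rw [← volume_ubox n]
    exact (measurePreserving_vecMul A hA).measure_preimage (measurableSet_ubox n).nullMeasurableSet
  have hBm : MeasurableSet B := (measurePreserving_vecMul A hA).measurable (measurableSet_ubox n)
  have hBconv : Convex ℝ B := by
    have h : B = (Matrix.toLin' Aᵀ) ⁻¹' ubox n := by
      ext x
      simp only [hB, Set.mem_preimage, Matrix.toLin'_apply, Matrix.mulVec_transpose,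
        Set.mem_ofPred_eq]
    rw [h]
    exact (convex_pi fun _ _ => convex_Ioc _ _).linear_preimage _
  have hBb : Bornology.IsBounded B := by
    rw [Metric.isBounded_iff_subset_closedBall 0]
    refine ⟨∑ j, ∑ i, |A⁻¹ i j|, fun x hx => ?_⟩
    have h0 : 0 ≤ ∑ j, ∑ i, |A⁻¹ i j| :=
      Finset.sum_nonneg fun j _ => Finset.sum_nonneg fun i _ => abs_nonneg _
    rw [mem_closedBall_zero_iff, pi_norm_le_iff_of_nonneg h0]
    intro j
    have h1 : x = (x ᵥ* A) ᵥ* A⁻¹ := by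
      rw [Matrix.vecMul_vecMul, Matrix.mul_nonsing_inv _ hA0, Matrix.vecMul_one]
    rw [h1, Real.norm_eq_abs]
    refine (abs_vecMul_le (r := 1) _ _ (fun i => ?_) j).trans ?_
    · have := hx i trivial
      rw [abs_of_pos this.1]; exact this.2
    · rw [one_mul]
      exact Finset.single_le_sum (f := fun j => ∑ i, |A⁻¹ i j|)
        (fun j _ => Finset.sum_nonneg fun i _ => abs_nonneg _) (Finset.mem_univ j)
  have key := tendsto_card_div_pow_atTop_volume B hBb hBm (hBconv.addHaar_frontier volume)
  rw [Measure.real, hBvol, ENNReal.toReal_one] at key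
  have key2 := ENNReal.tendsto_ofReal key
  rw [ENNReal.ofReal_one] at key2
  refine key2.congr' ?_
  filter_upwards [eventually_gt_atTop 0] with k hk
  have hk' : (k : ℝ) ≠ 0 := by exact_mod_cast hk.ne'
  have hk0 : (0 : ℝ) < k := by exact_mod_cast hk
  set S : Set (Fin n → ℤ) := {v : Fin n → ℤ | v ≠ 0 ∧ intVec v ᵥ* nmat g ∈ bx n k} with hS
  have hmem : ∀ v : Fin n → ℤ, intVec v ᵥ* A ∈ bx n k ↔ (k : ℝ)⁻¹ • intVec v ∈ B := by
    intro v
    simp only [hB, bx, ubox, Set.mem_pi, Set.mem_univ, true_imp_iff, Set.mem_Ioc,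
      Set.mem_ofPred_eq, Matrix.smul_vecMul, Pi.smul_apply, smul_eq_mul]
    refine forall_congr' fun i => and_congr ?_ ?_
    · rw [mul_pos_iff_of_pos_left (inv_pos.mpr hk0)]
    · rw [inv_mul_le_iff₀ hk0, mul_one]
  have hSfin : S.Finite := by
    refine (finite_intVec_vecMul (A := A) (by rw [hA]; exact one_ne_zero) k).subset
      fun v hv i => ?_
    have := hv.2 i trivial
    rw [abs_of_pos this.1]; exact this.2
  rw [cnt_eq_encard]
  have hcard : Nat.card (B ∩ (k : ℝ)⁻¹ •
      (Submodule.span ℤ (Set.range (Pi.basisFun ℝ (Fin n))) : Set (Fin n → ℝ)) :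
        Set (Fin n → ℝ)) = Nat.card S := by
    symm
    refine Nat.card_eq_of_bijective (fun v => ⟨(k : ℝ)⁻¹ • intVec v.1, (hmem v.1).mp v.2.2,
      Set.smul_mem_smul_set ?_⟩) ⟨?_, ?_⟩
    · rw [SetLike.mem_coe, (Pi.basisFun ℝ (Fin n)).mem_span_iff_repr_mem ℤ]
      intro i; exact ⟨v.1 i, by simp [intVec]⟩
    · intro v w h
      apply Subtype.ext
      have h1 := smul_right_injective _ (inv_ne_zero hk') (Subtype.mk.inj h)
      funext i
      have := congrFun h1 i
      simpa [intVec] using this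
    · rintro ⟨x, hx1, y, hy, rfl⟩
      rw [SetLike.mem_coe, (Pi.basisFun ℝ (Fin n)).mem_span_iff_repr_mem ℤ] at hy
      choose v hv using hy
      have hvx : intVec v = y := by
        funext i
        simpa [intVec] using hv i
      subst hvx
      refine ⟨⟨v, ?_, (hmem v).mpr hx1⟩, rfl⟩
      rintro rfl
      obtain ⟨i⟩ : Nonempty (Fin n) := ⟨⟨0, Nat.pos_of_ne_zero hn⟩⟩
      have h2 := ((hmem 0).mpr hx1) i trivial
      have h3 : intVec (0 : Fin n → ℤ) = 0 := by ext; simp [intVec]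
      simp [h3] at h2
  rw [Fintype.card_fin, hcard, ENNReal.ofReal_div_of_pos (by positivity), ENNReal.ofReal_natCast,
    ENNReal.ofReal_pow (by positivity), ENNReal.ofReal_natCast, Nat.card_coe_set_eq,
    ← hSfin.cast_ncard_eq]
  simp

end

/-- The open cube of side `2`. -/
def cube (n : ℕ) : Set (Fin n → ℝ) := Set.pi Set.univ fun _ => Set.Ioo (-1) 1

lemma measurableSet_cube (n : ℕ) : MeasurableSet (cube n) :=
  MeasurableSet.univ_pi fun _ => measurableSet_Ioo

lemma volume_cube_ne_top (n : ℕ) : volume (cube n) ≠ ⊤ := by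
  rw [cube, volume_pi, Measure.pi_pi]
  simp

lemma intVec_add {n : ℕ} (v w : Fin n → ℤ) : intVec (v + w) = intVec v + intVec w := by
  ext i; simp [intVec]

lemma tsum_translate_ubox_le {n : ℕ} (g : RM n) (x : Fin n → ℝ) :
    ∑' v : Fin n → ℤ, (ubox n).indicator (1 : (Fin n → ℝ) → ℝ≥0∞) (intVec v ᵥ* nmat g - x)
      ≤ 1 + cnt (cube n) g := by
  by_cases h : ∃ v : Fin n → ℤ, intVec v ᵥ* nmat g - x ∈ ubox n
  · obtain ⟨v₀, hv₀⟩ := h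
    rw [← (Equiv.addLeft v₀).tsum_eq]
    have h1 : (1 : ℝ≥0∞) + cnt (cube n) g = ∑' w : Fin n → ℤ, ((if w = 0 then 1 else 0) +
        {w : Fin n → ℤ | w ≠ 0}.indicator (fun w => nind (cube n) (vact w g) (mdet g)) w) := by
      rw [ENNReal.tsum_add, tsum_ite_eq, ← tsum_subtype]
      rfl
    rw [h1]
    refine ENNReal.tsum_le_tsum fun w => ?_
    by_cases hw : w = 0
    · simp only [hw, if_true]
      exact (Set.indicator_le_self' (fun _ _ => zero_le) _).trans le_self_add
    · simp only [hw, if_false, zero_add]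
      refine Set.indicator_apply_le' (fun hmem => ?_) (fun _ => zero_le)
      suffices hm : intVec w ᵥ* nmat g ∈ cube n by
        rw [Set.indicator_of_mem (by exact hw), nind, scl_smul_vact, Set.indicator_of_mem hm]
        rfl
      intro i _
      have h2 := hmem i trivial
      have h3 := hv₀ i trivial
      simp only [Equiv.coe_addLeft, intVec_add, Matrix.add_vecMul, Pi.sub_apply, Pi.add_apply,
        Set.mem_Ioc] at h2 h3
      exact ⟨by linarith [h2.1, h3.2], by linarith [h2.2, h3.1]⟩
  · push Not at h
    simp [h]

lemma cnt_bx_le {n k : ℕ} (g : RM n) :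
    cnt (bx n k) g ≤ (k : ℝ≥0∞) ^ n * (1 + cnt (cube n) g) := by
  have h1 : ∀ z : Fin n → ℝ, (bx n k).indicator (1 : (Fin n → ℝ) → ℝ≥0∞) z
      ≤ ∑ c : Fin n → Fin k, (ubox n).indicator 1 (z - fun i => ((c i : ℕ) : ℝ)) := by
    intro z
    refine Set.indicator_apply_le' (fun hz => ?_) (fun _ => zero_le)
    have h2 : ∀ i, ∃ c : Fin k, z i - ((c : ℕ) : ℝ) ∈ Set.Ioc (0 : ℝ) 1 := by
      intro i
      have hi := hz i trivial
      have h3 : 0 < ⌈z i⌉₊ := Nat.ceil_pos.mpr hi.1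
      have h4 : ⌈z i⌉₊ ≤ k := Nat.ceil_le.mpr hi.2
      refine ⟨⟨⌈z i⌉₊ - 1, by omega⟩, ?_⟩
      have h5 : (((⌈z i⌉₊ - 1 : ℕ)) : ℝ) = ⌈z i⌉₊ - 1 := by
        rw [Nat.cast_sub (by omega)]; simp
      have h6 := Nat.le_ceil (z i)
      have h7 := Nat.ceil_lt_add_one hi.1.le
      simp only [h5, Set.mem_Ioc]
      constructor <;> linarith
    choose c hc using h2
    refine le_trans ?_ (Finset.single_le_sum (f := fun c : Fin n → Fin k =>
      (ubox n).indicator (1 : (Fin n → ℝ) → ℝ≥0∞) (z - fun i => ((c i : ℕ) : ℝ)))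
      (fun _ _ => zero_le) (Finset.mem_univ c))
    have : (z - fun i => ((c i : ℕ) : ℝ)) ∈ ubox n := fun i _ => hc i
    simp [this]
  calc cnt (bx n k) g ≤ ∑' v : {v : Fin n → ℤ // v ≠ 0}, ∑ c : Fin n → Fin k,
        (ubox n).indicator 1 (intVec v.1 ᵥ* nmat g - fun i => ((c i : ℕ) : ℝ)) := by
        refine ENNReal.tsum_le_tsum fun v => ?_
        rw [nind, scl_smul_vact]
        exact h1 _
    _ = ∑ c : Fin n → Fin k, ∑' v : {v : Fin n → ℤ // v ≠ 0},
        (ubox n).indicator 1 (intVec v.1 ᵥ* nmat g - fun i => ((c i : ℕ) : ℝ)) :=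
        Summable.tsum_finsetSum fun _ _ => ENNReal.summable
    _ ≤ ∑ _c : Fin n → Fin k, (1 + cnt (cube n) g) := by
        refine Finset.sum_le_sum fun c _ => ?_
        refine le_trans ?_ (tsum_translate_ubox_le g fun i => ((c i : ℕ) : ℝ))
        exact ENNReal.tsum_comp_le_tsum_of_injective Subtype.val_injective
          fun v => (ubox n).indicator 1 (intVec v ᵥ* nmat g - fun i => ((c i : ℕ) : ℝ))
    _ = _ := by simp [mul_add]

/-- Normalised count in a growing box. -/
def ncount (n k : ℕ) (g : RM n) : ℝ≥0∞ := cnt (bx n (k + 1)) g / ((k + 1 : ℕ) : ℝ≥0∞) ^ n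

lemma measurable_ncount (n k : ℕ) : Measurable (ncount n k) :=
  (measurable_cnt (measurableSet_bx _ _)).div_const _

lemma ncount_le (n k : ℕ) (g : RM n) : ncount n k g ≤ 1 + cnt (cube n) g := by
  rw [ncount]
  refine ENNReal.div_le_of_le_mul' (cnt_bx_le g)

lemma tendsto_ncount {n : ℕ} (hn : n ≠ 0) {g : RM n} (hg : g ∈ DD n) :
    Tendsto (fun k => ncount n k g) atTop (nhds 1) :=
  (tendsto_cnt_bx hn (one_pos.trans_le hg.1)).comp (tendsto_add_atTop_nat 1)

lemma natCast_succ_pow_ne_zero (k n : ℕ) : (((k + 1 : ℕ) : ℝ≥0∞)) ^ n ≠ 0 :=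
  pow_ne_zero _ (by simp)

lemma natCast_succ_pow_ne_top (k n : ℕ) : (((k + 1 : ℕ) : ℝ≥0∞)) ^ n ≠ ⊤ :=
  ENNReal.pow_ne_top (ENNReal.natCast_ne_top _)

lemma lintegral_wt_ncount (m k : ℕ) :
    ∫⁻ g in DD (m + 3), wt (m + 3) g * ncount (m + 3) k g = mom1 m := by
  have hm : Measurable fun g => wt (m + 3) g * cnt (bx (m + 3) (k + 1)) g :=
    (isWeight_wt _).measurable.mul (measurable_cnt (measurableSet_bx _ _))
  have h := setLIntegral_wt_cnt (m := m) (measurableSet_bx (m + 3) (k + 1))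
  rw [volume_bx] at h
  have h2 : ∀ g, wt (m + 3) g * ncount (m + 3) k g =
      wt (m + 3) g * cnt (bx (m + 3) (k + 1)) g * (((k + 1 : ℕ) : ℝ≥0∞) ^ (m + 3))⁻¹ := fun g => by
    rw [ncount, div_eq_mul_inv]; exact (mul_assoc _ _ _).symm
  simp_rw [h2]
  rw [lintegral_mul_const _ hm, h, mul_assoc, ENNReal.mul_inv_cancel
    (natCast_succ_pow_ne_zero _ _) (natCast_succ_pow_ne_top _ _), mul_one]

lemma lintegral_wt_one_add (m : ℕ) :
    ∫⁻ g in DD (m + 3), wt (m + 3) g * ((1 + cnt (cube (m + 3)) g) * (1 + cnt (cube (m + 3)) g))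
      ≠ ⊤ := by
  have hc := measurable_cnt (measurableSet_cube (m + 3))
  have hw := (isWeight_wt (m + 3)).measurable
  obtain ⟨P, hP, h2⟩ := setLIntegral_wt_cnt_sq (m := m) (measurableSet_cube (m + 3))
  have h1 := setLIntegral_wt_cnt (m := m) (measurableSet_cube (m + 3))
  have hv := volume_cube_ne_top (m + 3)
  have e : ∀ w c : ℝ≥0∞, w * ((1 + c) * (1 + c)) = w + (w * c + w * c) + w * (c * c) :=
    fun w c => by ring
  have m1 : Measurable fun g => wt (m + 3) g * cnt (cube (m + 3)) g := hw.mul hc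
  have m2 : Measurable fun g => wt (m + 3) g * (cnt (cube (m + 3)) g * cnt (cube (m + 3)) g) :=
    hw.mul (hc.mul hc)
  have m3 : Measurable fun g => wt (m + 3) g * cnt (cube (m + 3)) g
      + wt (m + 3) g * cnt (cube (m + 3)) g := m1.add m1
  simp_rw [e]
  rw [lintegral_add_right _ m2, lintegral_add_right _ m3, lintegral_add_right _ m1, h1, h2]
  have hP' : P ≠ ⊤ := ne_top_of_le_ne_top (ENNReal.mul_ne_top (varC_ne_top m) hv) hP
  have a1 : mom1 m * volume (cube (m + 3)) ≠ ⊤ := ENNReal.mul_ne_top (mom1_ne_top m) hv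
  have a2 : mom2 m * (volume (cube (m + 3)) * volume (cube (m + 3))) ≠ ⊤ :=
    ENNReal.mul_ne_top (mom2_ne_top m) (ENNReal.mul_ne_top hv hv)
  exact ENNReal.add_ne_top.mpr ⟨ENNReal.add_ne_top.mpr ⟨wtI_ne_top (m + 2),
    ENNReal.add_ne_top.mpr ⟨a1, a1⟩⟩, ENNReal.add_ne_top.mpr ⟨a2, hP'⟩⟩

lemma mom1_eq (m : ℕ) : mom1 m = wtI (m + 3) := by
  have hw := (isWeight_wt (m + 3)).measurable
  have h := tendsto_lintegral_of_dominated_convergence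
    (μ := volume.restrict (DD (m + 3)))
    (F := fun k g => wt (m + 3) g * ncount (m + 3) k g) (f := fun g => wt (m + 3) g)
    (fun g => wt (m + 3) g * ((1 + cnt (cube (m + 3)) g) * (1 + cnt (cube (m + 3)) g)))
    (fun k => hw.mul (measurable_ncount _ _))
    (fun k => ae_of_all _ fun g => by
      refine mul_le_mul' le_rfl ((ncount_le _ k g).trans ?_)
      exact le_mul_of_one_le_left zero_le le_self_add)
    (lintegral_wt_one_add m)
    (ae_restrict_of_forall_mem (measurableSet_DD _) fun g hg => by
      have := ENNReal.Tendsto.const_mul (a := wt (m + 3) g) (tendsto_ncount (by omega) hg)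
        (Or.inl one_ne_zero)
      rwa [mul_one] at this)
  simp_rw [lintegral_wt_ncount] at h
  exact tendsto_nhds_unique tendsto_const_nhds h

lemma mom2_eq (m : ℕ) : mom2 m = wtI (m + 3) := by
  have hw := (isWeight_wt (m + 3)).measurable
  have h := tendsto_lintegral_of_dominated_convergence
    (μ := volume.restrict (DD (m + 3)))
    (F := fun k g => wt (m + 3) g * (ncount (m + 3) k g * ncount (m + 3) k g))
    (f := fun g => wt (m + 3) g)
    (fun g => wt (m + 3) g * ((1 + cnt (cube (m + 3)) g) * (1 + cnt (cube (m + 3)) g)))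
    (fun k => hw.mul ((measurable_ncount _ _).mul (measurable_ncount _ _)))
    (fun k => ae_of_all _ fun g =>
      mul_le_mul' le_rfl (mul_le_mul' (ncount_le _ k g) (ncount_le _ k g)))
    (lintegral_wt_one_add m)
    (ae_restrict_of_forall_mem (measurableSet_DD _) fun g hg => by
      have h1 := tendsto_ncount (by omega) hg
      have h2 := ENNReal.Tendsto.mul h1 (Or.inl one_ne_zero) h1 (Or.inl one_ne_zero)
      have := ENNReal.Tendsto.const_mul (a := wt (m + 3) g) h2 (Or.inl (by simp))
      rwa [mul_one, mul_one] at this)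
  refine tendsto_nhds_unique ?_ h
  have hI : ∀ k, ∃ Q : ℝ≥0∞, Q ≤ varC m * (((k + 1 : ℕ) : ℝ≥0∞) ^ (m + 3))⁻¹ ∧
      ∫⁻ g in DD (m + 3), wt (m + 3) g * (ncount (m + 3) k g * ncount (m + 3) k g)
        = mom2 m + Q := by
    intro k
    set N : ℝ≥0∞ := ((k + 1 : ℕ) : ℝ≥0∞) ^ (m + 3) with hN
    have hN0 : N ≠ 0 := natCast_succ_pow_ne_zero _ _
    have hNt : N ≠ ⊤ := natCast_succ_pow_ne_top _ _
    have hNN : N * N⁻¹ = 1 := ENNReal.mul_inv_cancel hN0 hNt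
    obtain ⟨P, hP, h2⟩ := setLIntegral_wt_cnt_sq (m := m) (measurableSet_bx (m + 3) (k + 1))
    rw [volume_bx] at hP h2
    have hc := measurable_cnt (measurableSet_bx (m + 3) (k + 1))
    have hm : Measurable fun g => wt (m + 3) g *
        (cnt (bx (m + 3) (k + 1)) g * cnt (bx (m + 3) (k + 1)) g) := hw.mul (hc.mul hc)
    have e : ∀ g, wt (m + 3) g * (ncount (m + 3) k g * ncount (m + 3) k g) =
        wt (m + 3) g * (cnt (bx (m + 3) (k + 1)) g * cnt (bx (m + 3) (k + 1)) g)
          * (N⁻¹ * N⁻¹) := fun g => by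
      rw [ncount, div_eq_mul_inv]
      generalize wt (m + 3) g = a
      generalize cnt (bx (m + 3) (k + 1)) g = b
      ring
    refine ⟨P * (N⁻¹ * N⁻¹), ?_, ?_⟩
    · calc P * (N⁻¹ * N⁻¹) ≤ varC m * N * (N⁻¹ * N⁻¹) := mul_le_mul' hP le_rfl
        _ = varC m * N⁻¹ * (N * N⁻¹) := by ring
        _ = _ := by rw [hNN, mul_one]
    · simp_rw [e]
      rw [lintegral_mul_const _ hm, h2, add_mul]
      congr 1
      calc mom2 m * (N * N) * (N⁻¹ * N⁻¹) = mom2 m * ((N * N⁻¹) * (N * N⁻¹)) := by ring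
        _ = _ := by rw [hNN, mul_one, mul_one]
  choose Q hQ hQI using hI
  simp_rw [hQI]
  have hQ0 : Tendsto Q atTop (nhds 0) := by
    have h0 : Tendsto (fun k : ℕ => varC m * ((k + 1 : ℕ) : ℝ≥0∞)⁻¹) atTop (nhds 0) := by
      have := ENNReal.Tendsto.const_mul (a := varC m)
        (ENNReal.tendsto_inv_nat_nhds_zero.comp (tendsto_add_atTop_nat 1))
        (Or.inr (varC_ne_top m))
      rwa [mul_zero] at this
    refine tendsto_of_tendsto_of_tendsto_of_le_of_le tendsto_const_nhds h0 (fun _ => zero_le)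
      fun k => (hQ k).trans (mul_le_mul' le_rfl (ENNReal.inv_le_inv.mpr ?_))
    exact le_self_pow₀ (by simp) (by omega)
  have := (tendsto_const_nhds (x := mom2 m)).add hQ0
  rw [add_zero] at this
  exact this

/-- Distance in `[0, ∞]`. -/
def ediff (a b : ℝ≥0∞) : ℝ≥0∞ := (a - b) + (b - a)

lemma ediff_sq {a b : ℝ≥0∞} (hb : b ≠ ⊤) :
    ediff a b * ediff a b + 2 * (b * a) = a * a + b * b := by
  rcases le_total a b with h | h
  · have ha : a ≠ ⊤ := ne_top_of_le_ne_top hb h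
    obtain ⟨c, rfl⟩ := exists_add_of_le h
    rw [ediff, tsub_eq_zero_of_le h, ENNReal.add_sub_cancel_left ha]
    ring
  · obtain ⟨c, rfl⟩ := exists_add_of_le h
    rw [ediff, tsub_eq_zero_of_le h, ENNReal.add_sub_cancel_left hb]
    ring

lemma measurable_ediff_cnt {n : ℕ} {A : Set (Fin n → ℝ)} (hA : MeasurableSet A) (b : ℝ≥0∞) :
    Measurable fun g => ediff (cnt A g) b :=
  ((measurable_cnt hA).sub_const b).add ((measurable_cnt hA).const_sub b)

lemma setLIntegral_wt_ediff_le {m : ℕ} {A : Set (Fin (m + 3) → ℝ)} (hA : MeasurableSet A)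
    (hv : volume A ≠ ⊤) :
    ∫⁻ g in DD (m + 3), wt (m + 3) g * (ediff (cnt A g) (volume A) * ediff (cnt A g) (volume A))
      ≤ varC m * volume A := by
  obtain ⟨P, hP, h2⟩ := setLIntegral_wt_cnt_sq (m := m) hA
  have h1 := setLIntegral_wt_cnt (m := m) hA
  rw [mom1_eq] at h1
  rw [mom2_eq] at h2
  have hc := measurable_cnt hA
  have hw := (isWeight_wt (m + 3)).measurable
  have hd := measurable_ediff_cnt hA (volume A)
  set V := volume A with hV
  have e : ∀ g, wt (m + 3) g * (ediff (cnt A g) V * ediff (cnt A g) V)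
      + 2 * V * (wt (m + 3) g * cnt A g) =
      wt (m + 3) g * (cnt A g * cnt A g) + wt (m + 3) g * (V * V) := fun g => by
    rw [← mul_add, ← ediff_sq hv]
    generalize wt (m + 3) g = w
    generalize cnt A g = c
    ring
  have m1 : Measurable fun g => wt (m + 3) g * cnt A g := hw.mul hc
  have m2 : Measurable fun g => 2 * V * (wt (m + 3) g * cnt A g) := m1.const_mul _
  have m3 : Measurable fun g => wt (m + 3) g * (V * V) := hw.mul_const _
  have h3 := lintegral_congr (μ := volume.restrict (DD (m + 3))) e
  rw [lintegral_add_right _ m2, lintegral_add_right _ m3, lintegral_const_mul _ m1,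
    lintegral_mul_const _ hw, h1, h2] at h3
  have hw3 : wtI (m + 3) ≠ ⊤ := wtI_ne_top (m + 2)
  change _ = _ + wtI (m + 3) * (V * V) at h3
  have hfin : 2 * V * (wtI (m + 3) * V) ≠ ⊤ :=
    ENNReal.mul_ne_top (ENNReal.mul_ne_top (by norm_num) hv) (ENNReal.mul_ne_top hw3 hv)
  refine le_trans (le_of_eq ?_) hP
  refine (ENNReal.add_left_inj hfin).mp (h3.trans ?_)
  ring

/-- Variance bound over compact sets of lattices. -/
lemma setLIntegral_KK_ediff_le {m : ℕ} (j : ℕ) {A : Set (Fin (m + 3) → ℝ)} (hA : MeasurableSet A)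
    (hv : volume A ≠ ⊤) :
    ∫⁻ g in KK (m + 3) j, ediff (cnt A g) (volume A) * ediff (cnt A g) (volume A)
      ≤ KKbound (m + 3) j * (varC m * volume A) := by
  have hd := measurable_ediff_cnt hA (volume A)
  refine (setLIntegral_KK_le j (hd.mul hd) fun γ g => ?_).trans ?_
  · simp only [Pi.mul_apply, cnt_gact]
  · exact mul_le_mul' le_rfl (setLIntegral_wt_ediff_le hA hv)

/-- Lattices in a compact set whose point count in `A` deviates from the volume by more than `r`. -/
def devSet {n : ℕ} (j : ℕ) (A : Set (Fin n → ℝ)) (r : ℝ) : Set (RM n) :=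
  KK n j ∩ {g | ENNReal.ofReal r ≤ ediff (cnt A g) (volume A)}

lemma volume_devSet_le {m : ℕ} (j : ℕ) {A : Set (Fin (m + 3) → ℝ)} (hA : MeasurableSet A)
    (hv : volume A ≠ ⊤) {r : ℝ} (hr : 0 < r) :
    volume (devSet j A r) ≤
      KKbound (m + 3) j * (varC m * volume A) / ENNReal.ofReal (r ^ 2) := by
  have hd := measurable_ediff_cnt hA (volume A)
  have h1 := meas_ge_le_lintegral_div (μ := volume.restrict (KK (m + 3) j))
    (f := fun g => ediff (cnt A g) (volume A) * ediff (cnt A g) (volume A))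
    (hd.mul hd).aemeasurable (ε := ENNReal.ofReal (r ^ 2)) (by positivity) ENNReal.ofReal_ne_top
  refine le_trans ?_ (h1.trans (ENNReal.div_le_div_right (setLIntegral_KK_ediff_le j hA hv) _))
  rw [Measure.restrict_apply (measurableSet_le measurable_const (hd.fun_mul hd)), devSet,
    Set.inter_comm]
  refine measure_mono fun g hg => ⟨?_, hg.2⟩
  have := hg.1
  simp only [Set.mem_ofPred_eq] at this ⊢
  rw [pow_two, ENNReal.ofReal_mul hr.le]
  exact mul_le_mul' this this

/-- A unimodular matrix as a family of rows. -/
def rowsOf {n : ℕ} (h : SLR n) : RM n := h.1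

lemma isInducing_rowsOf {n : ℕ} : Topology.IsInducing (rowsOf : SLR n → RM n) := ⟨rfl⟩

lemma continuous_rowsOf {n : ℕ} : Continuous (rowsOf : SLR n → RM n) := isInducing_rowsOf.continuous

instance (n : ℕ) : BorelSpace (SLR n) := ⟨rfl⟩

lemma measurable_rowsOf {n : ℕ} : Measurable (rowsOf : SLR n → RM n) :=
  continuous_rowsOf.measurable

lemma mdet_rowsOf {n : ℕ} (h : SLR n) : mdet (rowsOf h) = 1 := h.2

instance (n : ℕ) : SigmaCompactSpace (SLR n) := by
  have h : Topology.IsClosedEmbedding (rowsOf : SLR n → RM n) := by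
    refine ⟨⟨isInducing_rowsOf, Subtype.val_injective⟩, ?_⟩
    have : Set.range (rowsOf : SLR n → RM n) = {g | mdet g = 1} := by
      ext g
      exact ⟨fun ⟨h, hh⟩ => hh ▸ mdet_rowsOf h, fun hg => ⟨⟨g, hg⟩, rfl⟩⟩
    rw [this]
    exact isClosed_eq continuous_mdet continuous_const
  exact h.sigmaCompactSpace

lemma measurable_mul_left_SLR {n : ℕ} (a : SLR n) : Measurable fun h : SLR n => a * h := by
  refine Continuous.measurable ?_
  rw [isInducing_rowsOf.continuous_iff]
  refine continuous_pi fun i => continuous_pi fun j => ?_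
  have : (fun h : SLR n => rowsOf (a * h) i j) = fun h => ∑ k, a.1 i k * rowsOf h k j := by
    funext h
    exact Matrix.mul_apply
  change Continuous fun h : SLR n => rowsOf (a * h) i j
  rw [this]
  refine continuous_finsetSum _ fun k _ => continuous_const.mul ?_
  exact (continuous_apply j).comp ((continuous_apply k).comp continuous_rowsOf)

lemma measurable_rmulR_rowsOf {n : ℕ} :
    Measurable fun p : RM n × SLR n => rmulR p.2.1 p.1 := by
  refine measurable_pi_lambda _ fun i => measurable_pi_lambda _ fun j => ?_
  change Measurable fun p : RM n × SLR n => ∑ k, p.1 i k * rowsOf p.2 k j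
  refine Finset.measurable_fun_sum _ fun k _ => Measurable.fun_mul ?_ ?_
  · exact (measurable_pi_apply k).comp ((measurable_pi_apply i).comp measurable_fst)
  · exact (measurable_pi_apply j).comp ((measurable_pi_apply k).comp
      (measurable_rowsOf.comp measurable_snd))

lemma mdet_rmulR {n : ℕ} (h : SLR n) (g : RM n) : mdet (rmulR h.1 g) = mdet g := by
  have : Matrix.of (rmulR h.1 g) = Matrix.of g * h.1 := by
    ext i j; rfl
  rw [mdet, this, Matrix.det_mul, h.2, mul_one]
  rfl

lemma nmat_rmulR {n : ℕ} (h : SLR n) (g : RM n) : nmat (rmulR h.1 g) = nmat g * h.1 := by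
  have : Matrix.of (rmulR h.1 g) = Matrix.of g * h.1 := by
    ext i j; rfl
  rw [nmat, mdet_rmulR, this, nmat, Matrix.smul_mul]

lemma volume_DD_ne_zero (n : ℕ) : volume (DD (n + 1)) ≠ 0 := by
  have h1 : {g : RM (n + 1) | 1 < mdet g ∧ mdet g < 2} ⊆ DD (n + 1) := fun g hg =>
    ⟨hg.1.le, hg.2.le⟩
  have h2 : IsOpen {g : RM (n + 1) | 1 < mdet g ∧ mdet g < 2} :=
    (isOpen_lt continuous_const continuous_mdet).inter (isOpen_lt continuous_mdet continuous_const)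
  refine ((h2.measure_pos volume ?_).trans_le (measure_mono h1)).ne'
  refine ⟨Matrix.diagonal (Fin.cons (3 / 2) fun _ => 1), ?_⟩
  have : mdet (Matrix.diagonal (Fin.cons (3 / 2) fun _ => 1) : RM (n + 1)) = 3 / 2 := by
    change Matrix.det (Matrix.diagonal _) = _
    rw [Matrix.det_diagonal, Fin.prod_univ_succ]
    simp
  refine ⟨lt_of_lt_of_eq ?_ this.symm, lt_of_eq_of_lt this ?_⟩ <;> norm_num

/-- A property of lattices up to scaling that holds for almost every matrix in `DD n` holds for
almost every unimodular matrix. -/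
lemma ae_haar_of_ae_DD {n : ℕ} (μ : Measure (SLR (n + 1))) [μ.IsHaarMeasure]
    {G : Set (RM (n + 1))} (hG : MeasurableSet G)
    (hscale : ∀ g ∈ DD (n + 1), ∀ h : SLR (n + 1), h.1 = nmat g → (g ∈ G ↔ rowsOf h ∈ G))
    (hae : volume (DD (n + 1) \ G) = 0) : ∀ᵐ h ∂μ, rowsOf h ∈ G := by
  set S : Set (RM (n + 1) × SLR (n + 1)) := {p | rmulR p.2.1 p.1 ∈ Gᶜ} with hS
  have hSm : MeasurableSet S := measurable_rmulR_rowsOf hG.compl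
  have h0 : (volume.restrict (DD (n + 1))).prod μ S = 0 := by
    rw [Measure.prod_apply_symm hSm]
    refine (lintegral_congr fun h => ?_).trans lintegral_zero
    have hm := measurePreserving_rmulR (k := n + 1) h.1 h.2
    rw [Measure.restrict_apply (measurable_prodMk_right hSm),
      ← nonpos_iff_eq_zero, ← hae, ← hm.measure_preimage
        ((measurableSet_DD _).diff hG).nullMeasurableSet]
    refine measure_mono fun g hg => ⟨?_, hg.1⟩
    have := hg.2
    simpa [DD, mdet_rmulR] using this
  have h1 := (Measure.measure_prod_null hSm).mp h0
  have h2 : ∃ g ∈ DD (n + 1), μ (Prod.mk g ⁻¹' S) = 0 := by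
    by_contra! hc
    apply volume_DD_ne_zero n
    rw [Filter.EventuallyEq, ae_restrict_iff' (measurableSet_DD _), ae_iff] at h1
    refine measure_mono_null (fun g hg => ?_) h1
    simp only [Set.mem_ofPred_eq, Classical.not_imp]
    exact ⟨hg, hc g hg⟩
  obtain ⟨g, hg, hgS⟩ := h2
  have hdet := det_nmat (Nat.succ_ne_zero n) (one_pos.trans_le hg.1)
  set a : SLR (n + 1) := ⟨nmat g, hdet⟩ with ha
  rw [ae_iff]
  have hm : MeasurableSet {h : SLR (n + 1) | ¬ rowsOf h ∈ G} := measurable_rowsOf hG.compl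
  have h3 : μ ((fun h => a * h) ⁻¹' {h : SLR (n + 1) | ¬ rowsOf h ∈ G}) = 0 := by
    refine measure_mono_null (fun h hh => ?_) hgS
    intro hmem
    refine hh ?_
    have hmem' : rmulR h.1 g ∈ G := hmem
    refine (hscale (rmulR h.1 g) ?_ (a * h) ?_).mp hmem'
    · simpa [DD, mdet_rmulR] using hg
    · rw [nmat_rmulR]; rfl
  rwa [← Measure.map_apply (measurable_mul_left_SLR a) hm, map_mul_left_eq_self] at h3

lemma setLIntegral_rpow {A a b : ℝ} (hA : 0 < A) (ha : 0 ≤ a) (hab : a ≤ b) :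
    ∫⁻ s in Set.Ioc a b, ENNReal.ofReal (s ^ (A - 1)) = ENNReal.ofReal ((b ^ A - a ^ A) / A) := by
  have h1 : IntervalIntegrable (fun s : ℝ => s ^ (A - 1)) volume a b :=
    intervalIntegral.intervalIntegrable_rpow' (by linarith)
  have h2 := integral_rpow (a := a) (b := b) (r := A - 1) (Or.inl (by linarith))
  rw [sub_add_cancel, intervalIntegral.integral_of_le hab] at h2
  rw [← h2, ofReal_integral_eq_lintegral_ofReal]
  · exact (intervalIntegrable_iff_integrableOn_Ioc_of_le hab).mp h1
  · refine ae_restrict_of_forall_mem measurableSet_Ioc fun s hs => ?_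
    exact Real.rpow_nonneg (ha.trans hs.1.le) _

lemma measurable_ofReal_rpow (a : ℝ) : Measurable fun s : ℝ => ENNReal.ofReal (s ^ a) :=
  (measurable_id.pow_const a).ennreal_ofReal

lemma setLIntegral_small_nonneg {P Q u e : ℝ} (hQ : 0 < Q) (hPQ : 1 < P + Q)
    (hu : 0 ≤ u) (hue : u ≤ e) (he : 0 < e) :
    ∫⁻ s in Set.Ioc 0 e, ENNReal.ofReal ((s + u) ^ (P - 1) * s ^ (Q - 1))
      ≤ ENNReal.ofReal ((2 ^ P / Q + 1 / (P + Q - 1)) * e ^ (P + Q - 1)) := by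
  have hA : 0 < P + Q - 1 := by linarith
  by_cases h1 : 1 ≤ P
  · calc ∫⁻ s in Set.Ioc 0 e, ENNReal.ofReal ((s + u) ^ (P - 1) * s ^ (Q - 1))
        ≤ ∫⁻ s in Set.Ioc 0 e, ENNReal.ofReal ((2 * e) ^ (P - 1)) *
            ENNReal.ofReal (s ^ (Q - 1)) := by
          refine setLIntegral_mono' measurableSet_Ioc fun s hs => ?_
          rw [← ENNReal.ofReal_mul (by positivity)]
          refine ENNReal.ofReal_le_ofReal (mul_le_mul_of_nonneg_right ?_
            (Real.rpow_nonneg hs.1.le _))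
          exact Real.rpow_le_rpow (by linarith [hs.1]) (by linarith [hs.2]) (by linarith)
      _ = ENNReal.ofReal ((2 * e) ^ (P - 1) * (e ^ Q / Q)) := by
          rw [lintegral_const_mul _ (measurable_ofReal_rpow _),
            setLIntegral_rpow hQ le_rfl he.le, Real.zero_rpow hQ.ne', sub_zero,
            ← ENNReal.ofReal_mul (by positivity)]
      _ ≤ _ := by
          refine ENNReal.ofReal_le_ofReal ?_
          rw [Real.mul_rpow two_pos.le he.le]
          have h2 : (2 : ℝ) ^ (P - 1) ≤ 2 ^ P :=
            Real.rpow_le_rpow_of_exponent_le one_le_two (by linarith)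
          have h3 : e ^ (P + Q - 1) = e ^ (P - 1) * e ^ Q := by
            rw [← Real.rpow_add he]; ring_nf
          rw [h3]
          have h4 : 0 ≤ 1 / (P + Q - 1) := by positivity
          calc (2 : ℝ) ^ (P - 1) * e ^ (P - 1) * (e ^ Q / Q)
              = 2 ^ (P - 1) / Q * (e ^ (P - 1) * e ^ Q) := by ring
            _ ≤ _ := by
              refine mul_le_mul_of_nonneg_right ?_ (by positivity)
              have : (2 : ℝ) ^ (P - 1) / Q ≤ 2 ^ P / Q := by gcongr
              linarith
  · push Not at h1
    calc ∫⁻ s in Set.Ioc 0 e, ENNReal.ofReal ((s + u) ^ (P - 1) * s ^ (Q - 1))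
        ≤ ∫⁻ s in Set.Ioc 0 e, ENNReal.ofReal (s ^ (P + Q - 1 - 1)) := by
          refine setLIntegral_mono' measurableSet_Ioc fun s hs => ?_
          refine ENNReal.ofReal_le_ofReal ?_
          rw [show P + Q - 1 - 1 = (P - 1) + (Q - 1) by ring, Real.rpow_add hs.1]
          refine mul_le_mul_of_nonneg_right ?_ (Real.rpow_nonneg hs.1.le _)
          exact Real.rpow_le_rpow_of_nonpos hs.1 (by linarith) (by linarith)
      _ = ENNReal.ofReal (e ^ (P + Q - 1) / (P + Q - 1)) := by
          rw [setLIntegral_rpow hA le_rfl he.le, Real.zero_rpow hA.ne', sub_zero]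
      _ ≤ _ := by
          refine ENNReal.ofReal_le_ofReal ?_
          have : 0 ≤ 2 ^ P / Q * e ^ (P + Q - 1) := by positivity
          rw [add_mul]
          linarith [show e ^ (P + Q - 1) / (P + Q - 1) = 1 / (P + Q - 1) * e ^ (P + Q - 1) by ring]

/-- The part of the weight near the singularity is small. -/
lemma setLIntegral_small {P Q u e : ℝ} (hP : 0 < P) (hQ : 0 < Q) (hPQ : 1 < P + Q)
    (hue : |u| ≤ e) (he : 0 < e) :
    ∫⁻ s in Set.Ioc 0 e ∩ {s | 0 < s + u},
        ENNReal.ofReal ((s + u) ^ (P - 1) * s ^ (Q - 1))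
      ≤ ENNReal.ofReal ((2 ^ P / Q + 2 ^ Q / P + 1 / (P + Q - 1)) * e ^ (P + Q - 1)) := by
  have hA : 0 < P + Q - 1 := by linarith
  have hpow : 0 ≤ e ^ (P + Q - 1) := by positivity
  rcases le_total 0 u with hu | hu
  · refine (lintegral_mono_set Set.inter_subset_left).trans
      ((setLIntegral_small_nonneg hQ hPQ hu (le_of_abs_le hue) he).trans
        (ENNReal.ofReal_le_ofReal (mul_le_mul_of_nonneg_right ?_ hpow)))
    have : 0 ≤ 2 ^ Q / P := by positivity
    linarith
  · have hS : MeasurableSet (Set.Ioc 0 e ∩ {s : ℝ | 0 < s + u}) :=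
      measurableSet_Ioc.inter (measurableSet_lt measurable_const (measurable_id.add_const u))
    rw [← lintegral_indicator hS, ← lintegral_sub_right_eq_self _ u]
    calc ∫⁻ s, (Set.Ioc 0 e ∩ {s : ℝ | 0 < s + u}).indicator
          (fun s => ENNReal.ofReal ((s + u) ^ (P - 1) * s ^ (Q - 1))) (s - u)
        ≤ ∫⁻ s, (Set.Ioc 0 e).indicator
          (fun s => ENNReal.ofReal ((s + -u) ^ (Q - 1) * s ^ (P - 1))) s := by
          refine lintegral_mono fun s => ?_
          refine Set.indicator_apply_le' (fun hs => ?_) (fun _ => zero_le)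
          have h1 := hs.2
          have h2 := hs.1.2
          simp only [Set.mem_ofPred_eq, sub_add_cancel] at h1
          rw [Set.indicator_of_mem (show s ∈ Set.Ioc 0 e from ⟨h1, by linarith⟩)]
          rw [sub_add_cancel, mul_comm, sub_eq_add_neg]
      _ ≤ _ := by
          rw [lintegral_indicator measurableSet_Ioc]
          refine (setLIntegral_small_nonneg hP (by linarith) (by linarith)
            (by linarith [neg_le_of_abs_le hue]) he).trans
            (ENNReal.ofReal_le_ofReal ?_)
          rw [add_comm Q P]
          refine mul_le_mul_of_nonneg_right ?_ hpow
          have : 0 ≤ 2 ^ P / Q := by positivity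
          linarith

lemma rpow_one_add_le {x P e : ℝ} {K : ℕ} (hx : |x| ≤ e) (he : e ≤ 1 / 2) (hP : 0 ≤ P)
    (hPK : P ≤ K) : (1 + x) ^ (P - 1) ≤ (1 + 2 * e) ^ (K + 1) := by
  have hx1 := abs_le.mp hx
  have h0 : 0 < 1 + x := by linarith
  have he0 : 0 ≤ e := (abs_nonneg x).trans hx
  rw [Real.rpow_sub_one h0.ne', div_le_iff₀ h0]
  have h1 : (1 + x) ^ P ≤ (1 + 2 * e) ^ K :=
    calc (1 + x) ^ P ≤ (1 + 2 * e) ^ P := Real.rpow_le_rpow h0.le (by linarith) hP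
      _ ≤ (1 + 2 * e) ^ (K : ℝ) := Real.rpow_le_rpow_of_exponent_le (by linarith) hPK
      _ = _ := Real.rpow_natCast _ _
  have h2 : 1 ≤ (1 + 2 * e) * (1 + x) := by nlinarith
  calc (1 + x) ^ P ≤ (1 + 2 * e) ^ K * 1 := by rw [mul_one]; exact h1
    _ ≤ (1 + 2 * e) ^ K * ((1 + 2 * e) * (1 + x)) := by gcongr
    _ = _ := by ring

lemma le_rpow_one_add {x P e : ℝ} {K : ℕ} (hx : |x| ≤ e) (he : e ≤ 1 / 2) (hP : 0 ≤ P)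
    (hPK : P ≤ K) : (1 - e) ^ (K + 1) ≤ (1 + x) ^ (P - 1) := by
  have hx1 := abs_le.mp hx
  have h0 : 0 < 1 + x := by linarith
  have he0 : 0 ≤ e := (abs_nonneg x).trans hx
  rw [Real.rpow_sub_one h0.ne', le_div_iff₀ h0]
  have h1 : (1 - e) ^ K ≤ (1 + x) ^ P :=
    calc (1 - e) ^ K = (1 - e) ^ (K : ℝ) := (Real.rpow_natCast _ _).symm
      _ ≤ (1 - e) ^ P :=
        Real.rpow_le_rpow_of_exponent_ge (by linarith) (by linarith) hPK
      _ ≤ _ := Real.rpow_le_rpow (by linarith) (by linarith) hP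
  have h2 : (1 - e) * (1 + x) ≤ 1 := by nlinarith
  calc (1 - e) ^ (K + 1) * (1 + x) = (1 - e) ^ K * ((1 - e) * (1 + x)) := by ring
    _ ≤ (1 - e) ^ K * 1 := by
      have : 0 ≤ 1 - e := by linarith
      gcongr
    _ ≤ _ := by rw [mul_one]; exact h1

lemma rpow_weight_eq {P Q u s : ℝ} (hs : 0 < s) (hsu : 0 < s + u) :
    (s + u) ^ (P - 1) * s ^ (Q - 1) = (1 + u / s) ^ (P - 1) * s ^ (P + Q - 1 - 1) := by
  have h1 : s + u = s * (1 + u / s) := by field_simp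
  have h2 : 0 < 1 + u / s := by
    rw [h1] at hsu; exact (mul_pos_iff_of_pos_left hs).mp hsu
  rw [h1, Real.mul_rpow hs.le h2.le, show P + Q - 1 - 1 = (P - 1) + (Q - 1) by ring,
    Real.rpow_add hs]
  ring

lemma abs_div_le_of_sq {u s e : ℝ} (he : 0 < e) (hu : |u| ≤ e ^ 2) (hs : e ≤ s) : |u / s| ≤ e := by
  have hs0 : 0 < s := he.trans_le hs
  rw [abs_div, abs_of_pos hs0, div_le_iff₀ hs0]
  nlinarith

/-- Upper bound for the density of the level sets. -/
lemma setLIntegral_weight_le {P Q u e b : ℝ} {K : ℕ} (hP : 0 < P) (hQ : 0 < Q) (hPQ : 1 < P + Q)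
    (hPK : P ≤ K) (he : 0 < e) (he2 : e ≤ 1 / 2) (hu : |u| ≤ e ^ 2) (hb : e ≤ b)
    {Z : Set ℝ} (hZ : ∀ s ∈ Z, 0 < s ∧ 0 < s + u ∧ (e < s → s ≤ b)) :
    ∫⁻ s in Z, ENNReal.ofReal ((s + u) ^ (P - 1) * s ^ (Q - 1))
      ≤ ENNReal.ofReal ((2 ^ P / Q + 2 ^ Q / P + 1 / (P + Q - 1)) * e ^ (P + Q - 1) +
          (1 + 2 * e) ^ (K + 1) * (b ^ (P + Q - 1) / (P + Q - 1))) := by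
  have hA : 0 < P + Q - 1 := by linarith
  have hsub : Z ⊆ (Set.Ioc 0 e ∩ {s | 0 < s + u}) ∪ Set.Ioc e b := by
    intro s hs
    obtain ⟨h1, h2, h3⟩ := hZ s hs
    rcases le_or_gt s e with h | h
    · exact Or.inl ⟨⟨h1, h⟩, h2⟩
    · exact Or.inr ⟨h, h3 h⟩
  have hue : |u| ≤ e := hu.trans (by nlinarith)
  have hb0 : 0 < b := he.trans_le hb
  rw [ENNReal.ofReal_add (by positivity) (by positivity)]
  refine (lintegral_mono_set hsub).trans ((lintegral_union_le _ _ _).trans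
    (add_le_add (setLIntegral_small hP hQ hPQ hue he) ?_))
  calc ∫⁻ s in Set.Ioc e b, ENNReal.ofReal ((s + u) ^ (P - 1) * s ^ (Q - 1))
      ≤ ∫⁻ s in Set.Ioc e b, ENNReal.ofReal ((1 + 2 * e) ^ (K + 1)) *
          ENNReal.ofReal (s ^ (P + Q - 1 - 1)) := by
        refine setLIntegral_mono' measurableSet_Ioc fun s hs => ?_
        have hs0 : 0 < s := he.trans hs.1
        have hsu : 0 < s + u := by
          have := (abs_le.mp hu).1
          nlinarith [hs.1]
        rw [rpow_weight_eq hs0 hsu, ← ENNReal.ofReal_mul (by positivity)]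
        refine ENNReal.ofReal_le_ofReal (mul_le_mul_of_nonneg_right ?_ (Real.rpow_nonneg hs0.le _))
        exact rpow_one_add_le (abs_div_le_of_sq he hu hs.1.le) he2 hP.le hPK
    _ = ENNReal.ofReal ((1 + 2 * e) ^ (K + 1) *
          ((b ^ (P + Q - 1) - e ^ (P + Q - 1)) / (P + Q - 1))) := by
        rw [lintegral_const_mul _ (measurable_ofReal_rpow _),
          setLIntegral_rpow hA he.le hb, ← ENNReal.ofReal_mul (by positivity)]
    _ ≤ _ := by
        refine ENNReal.ofReal_le_ofReal ?_
        gcongr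
        have : 0 ≤ e ^ (P + Q - 1) := by positivity
        linarith

/-- Lower bound for the density of the level sets. -/
lemma le_setLIntegral_weight {P Q u e b : ℝ} {K : ℕ} (hP : 0 < P) (hPQ : 1 < P + Q)
    (hPK : P ≤ K) (he : 0 < e) (he2 : e ≤ 1 / 2) (hu : |u| ≤ e ^ 2) (hb : e ≤ b)
    {Z : Set ℝ} (hZ : Set.Ioc e b ⊆ Z) :
    ENNReal.ofReal ((1 - e) ^ (K + 1) * ((b ^ (P + Q - 1) - e ^ (P + Q - 1)) / (P + Q - 1))) ≤
      ∫⁻ s in Z, ENNReal.ofReal ((s + u) ^ (P - 1) * s ^ (Q - 1)) := by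
  have hA : 0 < P + Q - 1 := by linarith
  have h1e : 0 ≤ 1 - e := by linarith
  refine le_trans ?_ (lintegral_mono_set hZ)
  rw [ENNReal.ofReal_mul (by positivity), ← setLIntegral_rpow hA he.le hb,
    ← lintegral_const_mul _ (measurable_ofReal_rpow _)]
  refine setLIntegral_mono' measurableSet_Ioc fun s hs => ?_
  have hs0 : 0 < s := he.trans hs.1
  have hsu : 0 < s + u := by
    have := (abs_le.mp hu).1
    nlinarith [hs.1]
  rw [rpow_weight_eq hs0 hsu, ← ENNReal.ofReal_mul (by positivity)]
  refine ENNReal.ofReal_le_ofReal (mul_le_mul_of_nonneg_right ?_ (Real.rpow_nonneg hs0.le _))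
  exact le_rpow_one_add (abs_div_le_of_sq he hu hs.1.le) he2 hP.le hPK

lemma inv_pow_rpow {y A : ℝ} {d a : ℕ} (hy : 0 < y) (h : (d : ℝ) * A = a) :
    ((y ^ d)⁻¹) ^ A = (y ^ a)⁻¹ := by
  rw [Real.inv_rpow (by positivity), ← Real.rpow_natCast y d, ← Real.rpow_mul hy.le, h,
    Real.rpow_natCast]

lemma one_add_pow_le_of_le_one {y : ℝ} (h0 : 0 ≤ y) (h1 : y ≤ 1) (m : ℕ) :
    (1 + y) ^ m ≤ 1 + 2 ^ m * y := by
  have key : (1 + y) ^ m ≤ 1 + (2 ^ m - 1) * y := by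
    induction m with
    | zero => simp
    | succ m ih =>
      have h2 : (1 : ℝ) ≤ 2 ^ m := one_le_pow₀ one_le_two
      calc (1 + y) ^ (m + 1) = (1 + y) ^ m * (1 + y) := pow_succ _ _
        _ ≤ (1 + (2 ^ m - 1) * y) * (1 + y) := by gcongr
        _ ≤ 1 + (2 ^ (m + 1) - 1) * y := by
          rw [pow_succ]
          nlinarith [mul_nonneg (mul_nonneg (sub_nonneg.mpr h2) h0) (sub_nonneg.mpr h1)]
  linarith

lemma main_term_upper {k l e M C : ℝ} {K a : ℕ} (hk : 0 < k) (he : 0 < e)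
    (hM : 2 ≤ M) (hMe : M * e ≤ 1) (hl : l ≤ k * (M * e / 2))
    (hC : 2 ^ (K + 1 + a) * M ≤ C) :
    (1 + 2 * e) ^ (K + 1) * ((k - l) ^ a)⁻¹ ≤ (k ^ a)⁻¹ * (1 + C * e) := by
  have hMe0 : 0 < M * e := by positivity
  have hmin : 0 < k - l := by nlinarith
  have h1 : ((k - l) ^ a)⁻¹ ≤ (k ^ a)⁻¹ * (1 + M * e) ^ a := by
    rw [inv_mul_eq_div, ← div_pow, ← inv_pow]
    refine pow_le_pow_left₀ (by positivity) ?_ _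
    rw [inv_le_iff_one_le_mul₀ hmin, div_mul_eq_mul_div, le_div_iff₀ hk, one_mul]
    have h2 : k * (1 - M * e / 2) ≤ k - l := by linarith
    have h3 : 1 ≤ (1 + M * e) * (1 - M * e / 2) := by nlinarith
    calc k = k * 1 := (mul_one k).symm
      _ ≤ k * ((1 + M * e) * (1 - M * e / 2)) := by gcongr
      _ = (1 + M * e) * (k * (1 - M * e / 2)) := by ring
      _ ≤ _ := by gcongr
  calc (1 + 2 * e) ^ (K + 1) * ((k - l) ^ a)⁻¹
      ≤ (1 + M * e) ^ (K + 1) * ((k ^ a)⁻¹ * (1 + M * e) ^ a) := by gcongr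
    _ = (k ^ a)⁻¹ * (1 + M * e) ^ (K + 1 + a) := by rw [pow_add _ (K + 1) a]; ring
    _ ≤ (k ^ a)⁻¹ * (1 + 2 ^ (K + 1 + a) * (M * e)) := by
      gcongr
      exact one_add_pow_le_of_le_one hMe0.le hMe _
    _ ≤ (k ^ a)⁻¹ * (1 + C * e) := by
      rw [← mul_assoc]
      gcongr

lemma main_term_lower {k l e M C : ℝ} {K a : ℕ} (hk : 0 < k) (he : 0 < e) (hl0 : 0 ≤ l)
    (hM : 2 ≤ M) (hMe : M * e ≤ 1) (hl : l ≤ k * (M * e / 2))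
    (hC : 2 ^ (K + 1 + a) * M ≤ C) :
    (k ^ a)⁻¹ * (1 - C * e) ≤ (1 - e) ^ (K + 1) * ((k + l) ^ a)⁻¹ := by
  have hMe0 : 0 < M * e := by positivity
  have hMe1 : 0 ≤ 1 - M * e := by linarith
  have h1 : (k ^ a)⁻¹ * (1 - M * e) ^ a ≤ ((k + l) ^ a)⁻¹ := by
    rw [inv_mul_eq_div, ← div_pow, ← inv_pow]
    refine pow_le_pow_left₀ (by positivity) ?_ _
    rw [div_le_iff₀ hk, ← div_eq_inv_mul, le_div_iff₀ (by positivity)]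
    calc (1 - M * e) * (k + l) ≤ (1 - M * e) * (k + k * (M * e / 2)) := by gcongr
      _ = k * ((1 - M * e) * (1 + M * e / 2)) := by ring
      _ ≤ k * 1 := by
        gcongr
        nlinarith
      _ = k := mul_one k
  have h5 : ((K + 1 + a : ℕ) : ℝ) ≤ 2 ^ (K + 1 + a) := by exact_mod_cast Nat.lt_two_pow_self.le
  calc (k ^ a)⁻¹ * (1 - C * e) ≤ (k ^ a)⁻¹ * (1 + (K + 1 + a : ℕ) * (-(M * e))) := by
        refine mul_le_mul_of_nonneg_left ?_ (by positivity)
        have h6 : ((K + 1 + a : ℕ) : ℝ) * (M * e) ≤ 2 ^ (K + 1 + a) * (M * e) := by gcongr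
        have h7 : 2 ^ (K + 1 + a) * M * e ≤ C * e := by gcongr
        linarith
    _ ≤ (k ^ a)⁻¹ * (1 + (-(M * e))) ^ (K + 1 + a) := by
        refine mul_le_mul_of_nonneg_left ?_ (by positivity)
        exact one_add_mul_le_pow (by linarith) _
    _ = (1 - M * e) ^ (K + 1) * ((k ^ a)⁻¹ * (1 - M * e) ^ a) := by
        rw [← sub_eq_add_neg, pow_add _ (K + 1) a]; ring
    _ ≤ _ := by
        have : 1 - M * e ≤ 1 - e := by nlinarith
        have h1e : 0 ≤ 1 - e := hMe1.trans this
        gcongr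

/-- Density bounds, uniformly in the scale `k`. -/
lemma exists_weight_bounds {P Q k0 K0 L : ℝ} {d a : ℕ} (hP : 0 < P) (hQ : 0 < Q) (hPQ : 1 < P + Q)
    (hd : (d : ℝ) * (P + Q - 1) = a) (hk0 : 0 < k0) (hkK : k0 ≤ K0) (hL : 0 ≤ L) :
    ∃ C > 0, ∃ e0 > 0, ∀ k e u : ℝ, k0 ≤ k → k ≤ K0 → 0 < e → e ≤ e0 → |u| ≤ e ^ 2 →
      ∀ Z : Set ℝ, (∀ s ∈ Z, 0 < s ∧ 0 < s + u) →
      (∀ s ∈ Z, e < s → s * (k - L * e) ^ d ≤ 1) →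
      (∀ s, e < s → s * (k + L * e) ^ d ≤ 1 → s ∈ Z) →
      ∫⁻ s in Z, ENNReal.ofReal ((s + u) ^ (P - 1) * s ^ (Q - 1)) ≤
        ENNReal.ofReal ((k ^ a)⁻¹ / (P + Q - 1)) * ENNReal.ofReal (1 + C * e) +
          ENNReal.ofReal (C * e ^ (P + Q - 1)) ∧
      ENNReal.ofReal ((k ^ a)⁻¹ / (P + Q - 1)) * ENNReal.ofReal (1 - C * e) ≤
        (∫⁻ s in Z, ENNReal.ofReal ((s + u) ^ (P - 1) * s ^ (Q - 1))) +
          ENNReal.ofReal (C * e ^ (P + Q - 1)) := by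
  have hA : 0 < P + Q - 1 := by linarith
  obtain ⟨K, hK⟩ := exists_nat_ge P
  obtain ⟨M, hM⟩ : ∃ M : ℝ, M = 2 + 2 * (L / k0) := ⟨_, rfl⟩
  have hK0 : 0 < K0 := hk0.trans_le hkK
  have hLk : 0 ≤ L / k0 := by positivity
  have hM2 : 2 ≤ M := by linarith
  have hM0 : 0 < M := by linarith
  obtain ⟨C1, hC1⟩ : ∃ C1 : ℝ, C1 = 2 ^ P / Q + 2 ^ Q / P + 1 / (P + Q - 1) := ⟨_, rfl⟩
  have hC1A : 1 / (P + Q - 1) ≤ C1 := by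
    have : 0 ≤ 2 ^ P / Q + 2 ^ Q / P := by positivity
    linarith
  have hC10 : 0 < C1 := lt_of_lt_of_le (by positivity) hC1A
  have h2M : 0 < 2 ^ (K + 1 + a) * M := by positivity
  obtain ⟨C, hC⟩ : ∃ C : ℝ, C = C1 + 2 ^ (K + 1 + a) * M := ⟨_, rfl⟩
  have hC0 : 0 < C := by linarith
  refine ⟨C, hC0, min (1 / M) ((2 * K0) ^ d)⁻¹, by positivity, ?_⟩
  intro k e u hk hkK he hee hu Z hZ1 hZ2 hZ3
  have hk' : 0 < k := hk0.trans_le hk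
  have he1 : e ≤ 1 / M := hee.trans (min_le_left _ _)
  have heK : e ≤ ((2 * K0) ^ d)⁻¹ := hee.trans (min_le_right _ _)
  have hMe : M * e ≤ 1 := by rwa [le_div_iff₀ hM0, mul_comm] at he1
  have he2 : e ≤ 1 / 2 := by nlinarith
  have hLe : L * e ≤ k * (M * e / 2) := by
    have h1 : L * e = k0 * (L / k0 * e) := by field_simp
    rw [h1]
    have h3 : L / k0 * e ≤ M * e / 2 := by rw [hM]; nlinarith
    exact mul_le_mul hk h3 (by positivity) hk'.le
  have hLe0 : 0 ≤ L * e := by positivity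
  have hmin : 0 < k - L * e := by nlinarith
  have hbm : e ≤ ((k - L * e) ^ d)⁻¹ := by
    refine heK.trans (inv_anti₀ (by positivity) ?_)
    exact pow_le_pow_left₀ hmin.le (by linarith) _
  have hbp : e ≤ ((k + L * e) ^ d)⁻¹ := by
    refine heK.trans (inv_anti₀ (by positivity) ?_)
    exact pow_le_pow_left₀ (by positivity) (by nlinarith) _
  have hpowA : 0 ≤ e ^ (P + Q - 1) := by positivity
  have hka : 0 < (k ^ a)⁻¹ / (P + Q - 1) := by positivity
  constructor
  · refine (setLIntegral_weight_le (K := K) hP hQ hPQ hK he he2 hu hbm (Z := Z) ?_).trans ?_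
    · intro s hs
      refine ⟨(hZ1 s hs).1, (hZ1 s hs).2, fun h => ?_⟩
      rw [← one_div, le_div_iff₀ (by positivity)]
      exact hZ2 s hs h
    · rw [← ENNReal.ofReal_mul hka.le, ← ENNReal.ofReal_add (by positivity) (by positivity)]
      refine ENNReal.ofReal_le_ofReal ?_
      rw [inv_pow_rpow hmin hd, add_comm, ← hC1]
      refine add_le_add ?_ (mul_le_mul_of_nonneg_right (by linarith) hpowA)
      have := main_term_upper (C := C) (K := K) (a := a) hk' he hM2 hMe hLe (by linarith)
      rw [← mul_div_assoc, div_mul_eq_mul_div]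
      gcongr
  · refine le_trans ?_ (add_le_add_left (le_setLIntegral_weight (K := K) (Q := Q) hP hPQ hK he he2
      hu hbp (Z := Z) ?_) _)
    · rw [← ENNReal.ofReal_mul hka.le]
      refine le_trans (ENNReal.ofReal_le_ofReal ?_) ENNReal.ofReal_add_le
      rw [inv_pow_rpow (by positivity) hd]
      have h1e : 0 ≤ 1 - e := by linarith
      have h2 : (1 - e) ^ (K + 1) * (e ^ (P + Q - 1) / (P + Q - 1)) ≤ C * e ^ (P + Q - 1) := by
        have h3 : (1 - e) ^ (K + 1) ≤ 1 := pow_le_one₀ h1e (by linarith)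
        calc (1 - e) ^ (K + 1) * (e ^ (P + Q - 1) / (P + Q - 1))
            ≤ 1 * (e ^ (P + Q - 1) / (P + Q - 1)) := by gcongr
          _ = 1 / (P + Q - 1) * e ^ (P + Q - 1) := by ring
          _ ≤ C * e ^ (P + Q - 1) := mul_le_mul_of_nonneg_right (by linarith) hpowA
      have h4 : (k ^ a)⁻¹ / (P + Q - 1) * (1 - C * e) ≤
          (1 - e) ^ (K + 1) * (((k + L * e) ^ a)⁻¹ / (P + Q - 1)) := by
        have := main_term_lower (C := C) (K := K) (a := a) hk' he hLe0 hM2 hMe hLe (by linarith)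
        rw [← mul_div_assoc, div_mul_eq_mul_div]
        gcongr
      rw [sub_div, mul_sub]
      linarith
    · intro s hs
      refine hZ3 s hs.1 ?_
      have := hs.2
      rwa [← one_div, le_div_iff₀ (by positivity)] at this

/-- The form `∑ xᵢ^d`. -/
def psum {p : ℕ} (d : ℕ) (x : Fin p → ℝ) : ℝ := ∑ i, x i ^ d

lemma continuous_psum (p d : ℕ) : Continuous (psum (p := p) d) :=
  continuous_finsetSum _ fun i _ => (continuous_apply i).pow d

lemma measurable_psum (p d : ℕ) : Measurable (psum (p := p) d) := (continuous_psum p d).measurable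

lemma psum_smul {p : ℕ} (d : ℕ) (c : ℝ) (x : Fin p → ℝ) : psum d (c • x) = c ^ d * psum d x := by
  simp [psum, mul_pow, Finset.mul_sum]

lemma psum_rpow_smul {p d : ℕ} (hd : d ≠ 0) {r : ℝ} (hr : 0 ≤ r) (x : Fin p → ℝ) :
    psum d (r ^ (d : ℝ)⁻¹ • x) = r * psum d x := by
  rw [psum_smul, Real.rpow_inv_natCast_pow hr hd]

lemma psum_pos {p d : ℕ} (hd : Even d) {x : Fin p → ℝ} (hx : x ≠ 0) : 0 < psum d x := by
  obtain ⟨i, hi⟩ := Function.ne_iff.mp hx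
  exact Finset.sum_pos' (fun j _ => hd.pow_nonneg _) ⟨i, Finset.mem_univ i, hd.pow_pos hi⟩

lemma abs_pow_le_psum {p d : ℕ} (hd : Even d) (x : Fin p → ℝ) (i : Fin p) :
    |x i| ^ d ≤ psum d x := by
  rw [hd.pow_abs]
  exact Finset.single_le_sum (f := fun j => x j ^ d) (fun j _ => hd.pow_nonneg _)
    (Finset.mem_univ i)

lemma setLIntegral_Ioi_mul_left (g : ℝ → ℝ≥0∞) (hg : Measurable g) {c : ℝ} (hc : 0 < c) :
    ∫⁻ r in Set.Ioi 0, g r = ENNReal.ofReal c * ∫⁻ r in Set.Ioi 0, g (c * r) := by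
  rw [← lintegral_indicator measurableSet_Ioi, ← lintegral_indicator measurableSet_Ioi]
  have h := Real.smul_map_volume_mul_left hc.ne'
  conv_lhs => rw [← h]
  have hm : Measurable ((Set.Ioi (0 : ℝ)).indicator g) := hg.indicator measurableSet_Ioi
  rw [lintegral_smul_measure, lintegral_map hm (measurable_const_mul c), abs_of_pos hc, smul_eq_mul]
  congr 1
  refine lintegral_congr fun r => ?_
  by_cases hr : 0 < r
  · rw [Set.indicator_of_mem (show c * r ∈ Set.Ioi (0 : ℝ) from mul_pos hc hr),
      Set.indicator_of_mem (show r ∈ Set.Ioi (0 : ℝ) from hr)]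
  · rw [Set.indicator_of_notMem (show c * r ∉ Set.Ioi (0 : ℝ) from
        fun h => hr ((mul_pos_iff_of_pos_left hc).mp h)),
      Set.indicator_of_notMem (show r ∉ Set.Ioi (0 : ℝ) from hr)]

lemma measurable_polar_integrand {p : ℕ} {f : (Fin p → ℝ) → ℝ≥0∞} (hf : Measurable f) (e P : ℝ) :
    Measurable fun z : (Fin p → ℝ) × ℝ =>
      ENNReal.ofReal (z.2 ^ P) * f (z.2 ^ e • z.1) := by
  have h1 : Measurable fun z : (Fin p → ℝ) × ℝ => ENNReal.ofReal (z.2 ^ P) :=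
    (measurable_snd.pow_const P).ennreal_ofReal
  have h2 : Measurable fun z : (Fin p → ℝ) × ℝ => z.2 ^ e • z.1 :=
    (measurable_snd.pow_const e).smul measurable_fst
  exact h1.mul (hf.comp h2)

lemma setLIntegral_inv_shell {R : ℝ} (hR : 0 < R) :
    ∫⁻ r in Set.Ioi 0, (Set.Icc (R / 2) R).indicator (fun r => ENNReal.ofReal r⁻¹) r =
      ENNReal.ofReal (Real.log 2) := by
  rw [lintegral_indicator measurableSet_Icc, Measure.restrict_restrict measurableSet_Icc,
    Set.inter_eq_left.mpr (show Set.Icc (R / 2) R ⊆ Set.Ioi 0 from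
      fun x hx => lt_of_lt_of_le (by positivity) hx.1),
    ← restrict_Ioc_eq_restrict_Icc, ← ofReal_integral_eq_lintegral_ofReal,
    ← intervalIntegral.integral_of_le (by linarith), integral_inv_of_pos (by positivity) hR]
  · congr 2; field_simp
  · refine (intervalIntegrable_iff_integrableOn_Ioc_of_le (by linarith)).mp ?_
    refine intervalIntegral.intervalIntegrable_inv (fun x hx => ?_) continuousOn_id
    rw [Set.uIcc_of_le (by linarith)] at hx
    exact (lt_of_lt_of_le (by positivity) hx.1).ne'
  · refine ae_restrict_of_forall_mem measurableSet_Ioc fun s hs => ?_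
    exact inv_nonneg.mpr (le_trans (by positivity) hs.1.le)

lemma measurableSet_shell (p d : ℕ) : MeasurableSet {x : Fin p → ℝ | psum d x ∈ Set.Icc 1 2} :=
  measurable_psum p d measurableSet_Icc

lemma volume_shell_lt_top {p d : ℕ} (hd0 : d ≠ 0) (hd : Even d) :
    volume {x : Fin p → ℝ | psum d x ∈ Set.Icc 1 2} < ⊤ := by
  refine lt_of_le_of_lt (measure_mono (t := {z | ∀ i, |z i| ≤ 2}) fun x hx i => ?_) ?_
  · have h1 := (abs_pow_le_psum hd x i).trans hx.2
    by_contra h2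
    push Not at h2
    have h3 : (2 : ℝ) ^ d < |x i| ^ d := pow_lt_pow_left₀ h2 two_pos.le hd0
    have h4 : (2 : ℝ) ^ 1 ≤ 2 ^ d := pow_le_pow_right₀ one_le_two (Nat.one_le_iff_ne_zero.mpr hd0)
    linarith
  · rw [volume_supBox]
    exact ENNReal.pow_lt_top ENNReal.ofReal_lt_top

lemma lintegral_shell {p d : ℕ} (hp : 1 ≤ p) (hd0 : d ≠ 0) (hd : Even d)
    {f : (Fin p → ℝ) → ℝ≥0∞} (hf : Measurable f) :
    ∫⁻ x in {x : Fin p → ℝ | psum d x ∈ Set.Icc 1 2}, ∫⁻ r in Set.Ioi (0 : ℝ),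
      ENNReal.ofReal (r ^ ((p : ℝ) / d - 1)) * f (r ^ (d : ℝ)⁻¹ • x) =
    ENNReal.ofReal (Real.log 2) * ∫⁻ x, f x := by
  have hd' : (d : ℝ) ≠ 0 := by exact_mod_cast hd0
  have hΦ := measurable_polar_integrand hf (d : ℝ)⁻¹ ((p : ℝ) / d - 1)
  have hlog : ENNReal.ofReal (Real.log 2) ≠ ⊤ := ENNReal.ofReal_ne_top
  rw [lintegral_lintegral_swap hΦ.aemeasurable]
  have hG : Measurable fun z : ℝ × (Fin p → ℝ) =>
      (Set.Icc (psum d z.2 / 2) (psum d z.2)).indicator (fun r => ENNReal.ofReal r⁻¹) z.1 *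
        f z.2 := by
    have h1 : Measurable fun z : ℝ × (Fin p → ℝ) => ENNReal.ofReal (z.1)⁻¹ :=
      measurable_fst.inv.ennreal_ofReal
    have h2 : MeasurableSet {z : ℝ × (Fin p → ℝ) | z.1 ∈ Set.Icc (psum d z.2 / 2) (psum d z.2)} := by
      have h3 : Measurable fun z : ℝ × (Fin p → ℝ) => psum d z.2 :=
        (measurable_psum p d).comp measurable_snd
      exact (measurableSet_le (h3.div_const 2) measurable_fst).inter
        (measurableSet_le measurable_fst h3)
    exact (h1.indicator h2).mul (hf.comp measurable_snd)
  calc ∫⁻ r in Set.Ioi (0 : ℝ), ∫⁻ x in {x : Fin p → ℝ | psum d x ∈ Set.Icc 1 2},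
        ENNReal.ofReal (r ^ ((p : ℝ) / d - 1)) * f (r ^ (d : ℝ)⁻¹ • x)
      = ∫⁻ r in Set.Ioi (0 : ℝ), ∫⁻ x,
        (Set.Icc (psum d x / 2) (psum d x)).indicator (fun r => ENNReal.ofReal r⁻¹) r * f x := by
        refine setLIntegral_congr_fun measurableSet_Ioi fun r hr => ?_
        have hr : 0 < r := hr
        rw [← lintegral_indicator (measurableSet_shell p d)]
        have h1 : Measurable fun y : Fin p → ℝ =>
            (Set.Icc (psum d y / 2) (psum d y)).indicator (fun _ => f y) r := by
          have h2 : Measurable (psum (p := p) d) := measurable_psum p d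
          have h3 : MeasurableSet {y : Fin p → ℝ | r ∈ Set.Icc (psum d y / 2) (psum d y)} :=
            (measurableSet_le (h2.div_const 2) measurable_const).inter
              (measurableSet_le measurable_const h2)
          exact hf.indicator h3
        have h4 := lintegral_comp_smul_pi h1 (Real.rpow_pos_of_pos hr (d : ℝ)⁻¹)
        have h5 : ∀ x : Fin p → ℝ, {x : Fin p → ℝ | psum d x ∈ Set.Icc 1 2}.indicator
            (fun x => ENNReal.ofReal (r ^ ((p : ℝ) / d - 1)) * f (r ^ (d : ℝ)⁻¹ • x)) x =
            ENNReal.ofReal (r ^ ((p : ℝ) / d - 1)) *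
            (Set.Icc (psum d (r ^ (d : ℝ)⁻¹ • x) / 2) (psum d (r ^ (d : ℝ)⁻¹ • x))).indicator
              (fun _ => f (r ^ (d : ℝ)⁻¹ • x)) r := by
          intro x
          rw [psum_rpow_smul hd0 hr.le]
          by_cases hx : psum d x ∈ Set.Icc 1 2
          · rw [Set.indicator_of_mem (by exact hx), Set.indicator_of_mem]
            constructor <;> nlinarith [hx.1, hx.2]
          · rw [Set.indicator_of_notMem (by exact hx), Set.indicator_of_notMem, mul_zero]
            intro h
            refine hx ⟨?_, ?_⟩
            · exact le_of_mul_le_mul_left (by linarith [h.2]) hr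
            · exact le_of_mul_le_mul_left (by linarith [h.1]) hr
        simp_rw [h5]
        have h6 : Measurable fun x : Fin p → ℝ =>
            (Set.Icc (psum d (r ^ (d : ℝ)⁻¹ • x) / 2) (psum d (r ^ (d : ℝ)⁻¹ • x))).indicator
              (fun _ => f (r ^ (d : ℝ)⁻¹ • x)) r :=
          h1.comp (measurable_const_smul (r ^ (d : ℝ)⁻¹))
        rw [lintegral_const_mul _ h6, h4, ← mul_assoc,
          ← ENNReal.ofReal_mul (by positivity), ← lintegral_const_mul _ h1]
        refine lintegral_congr fun x => ?_
        have h7 : r ^ ((p : ℝ) / d - 1) * ((r ^ (d : ℝ)⁻¹) ^ p)⁻¹ = r⁻¹ := by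
          rw [← Real.rpow_natCast (r ^ (d : ℝ)⁻¹) p, ← Real.rpow_mul hr.le, ← Real.rpow_neg hr.le,
            ← Real.rpow_add hr, show (p : ℝ) / d - 1 + -((d : ℝ)⁻¹ * p) = -1 by ring,
            Real.rpow_neg_one]
        rw [h7]
        by_cases hx : r ∈ Set.Icc (psum d x / 2) (psum d x)
        · rw [Set.indicator_of_mem hx, Set.indicator_of_mem hx]
        · rw [Set.indicator_of_notMem hx, Set.indicator_of_notMem hx, mul_zero, zero_mul]
    _ = ∫⁻ x, ∫⁻ r in Set.Ioi (0 : ℝ),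
        (Set.Icc (psum d x / 2) (psum d x)).indicator (fun r => ENNReal.ofReal r⁻¹) r * f x :=
        lintegral_lintegral_swap hG.aemeasurable
    _ = ∫⁻ x, ENNReal.ofReal (Real.log 2) * f x := by
        have : Nonempty (Fin p) := ⟨⟨0, hp⟩⟩
        have h0 : ∀ᵐ x : Fin p → ℝ, x ≠ 0 := by
          rw [ae_iff]; simp
        refine lintegral_congr_ae ?_
        filter_upwards [h0] with x hx
        have h1 : Measurable fun r : ℝ => (Set.Icc (psum d x / 2) (psum d x)).indicator
            (fun r => ENNReal.ofReal r⁻¹) r :=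
          (measurable_inv.ennreal_ofReal).indicator measurableSet_Icc
        rw [lintegral_mul_const _ h1, setLIntegral_inv_shell (psum_pos hd hx)]
    _ = _ := lintegral_const_mul _ hf

/-- Polar coordinates adapted to `∑ xᵢ^d`. -/
lemma exists_polar {p d : ℕ} (hp : 1 ≤ p) (hd0 : d ≠ 0) (hd : Even d) :
    ∃ m : Measure (Fin p → ℝ), IsFiniteMeasure m ∧ m ≠ 0 ∧ (∀ᵐ x ∂m, psum d x = 1) ∧
      ∀ f : (Fin p → ℝ) → ℝ≥0∞, Measurable f →
        ∫⁻ x, f x = ∫⁻ x, (∫⁻ r in Set.Ioi (0 : ℝ),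
          ENNReal.ofReal (r ^ ((p : ℝ) / d - 1)) * f (r ^ (d : ℝ)⁻¹ • x)) ∂m := by
  have hd' : (d : ℝ) ≠ 0 := by exact_mod_cast hd0
  set S : Set (Fin p → ℝ) := {x | psum d x ∈ Set.Icc 1 2} with hS
  have hSm : MeasurableSet S := measurableSet_shell p d
  have hlog : 0 < Real.log 2 := Real.log_pos one_lt_two
  set w : (Fin p → ℝ) → ℝ≥0∞ := fun x =>
    ENNReal.ofReal ((Real.log 2)⁻¹ * psum d x ^ (-((p : ℝ) / d))) with hw
  have hwm : Measurable w :=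
    (((measurable_psum p d).pow_const _).const_mul _).ennreal_ofReal
  set a : (Fin p → ℝ) → (Fin p → ℝ) := fun x => (psum d x ^ (-(d : ℝ)⁻¹)) • x with ha
  have ham : Measurable a := ((measurable_psum p d).pow_const _).smul measurable_id
  set m0 := (volume.restrict S).withDensity w with hm0
  have hac : m0 ≪ volume.restrict S := withDensity_absolutelyContinuous _ _
  have hfin : IsFiniteMeasure m0 := by
    refine isFiniteMeasure_withDensity ?_
    refine ne_of_lt (lt_of_le_of_lt (setLIntegral_mono' hSm
      (g := fun _ => ENNReal.ofReal (Real.log 2)⁻¹) fun x hx => ?_) ?_)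
    · refine ENNReal.ofReal_le_ofReal (mul_le_of_le_one_right (by positivity) ?_)
      exact Real.rpow_le_one_of_one_le_of_nonpos hx.1 (by simp; positivity)
    · rw [setLIntegral_const]
      exact ENNReal.mul_lt_top ENNReal.ofReal_lt_top (volume_shell_lt_top hd0 hd)
  have hmain : ∀ f : (Fin p → ℝ) → ℝ≥0∞, Measurable f →
        ∫⁻ x, f x = ∫⁻ x, (∫⁻ r in Set.Ioi (0 : ℝ),
          ENNReal.ofReal (r ^ ((p : ℝ) / d - 1)) * f (r ^ (d : ℝ)⁻¹ • x)) ∂(m0.map a) := by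
    intro f hf
    have hΦ := measurable_polar_integrand hf (d : ℝ)⁻¹ ((p : ℝ) / d - 1)
    have hI : Measurable fun x : Fin p → ℝ => ∫⁻ r in Set.Ioi (0 : ℝ),
          ENNReal.ofReal (r ^ ((p : ℝ) / d - 1)) * f (r ^ (d : ℝ)⁻¹ • x) :=
      hΦ.lintegral_prod_right'
    have hIa : Measurable fun x : Fin p → ℝ => ∫⁻ r in Set.Ioi (0 : ℝ),
          ENNReal.ofReal (r ^ ((p : ℝ) / d - 1)) * f (r ^ (d : ℝ)⁻¹ • a x) := hI.comp ham
    rw [lintegral_map hI ham, hm0, lintegral_withDensity_eq_lintegral_mul _ hwm hIa]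
    have h1 : ∀ x ∈ S, (w * fun x => ∫⁻ r in Set.Ioi (0 : ℝ),
          ENNReal.ofReal (r ^ ((p : ℝ) / d - 1)) * f (r ^ (d : ℝ)⁻¹ • a x)) x =
        ENNReal.ofReal (Real.log 2)⁻¹ * ∫⁻ r in Set.Ioi (0 : ℝ),
          ENNReal.ofReal (r ^ ((p : ℝ) / d - 1)) * f (r ^ (d : ℝ)⁻¹ • x) := by
      intro x hx
      have hR : 0 < psum d x := one_pos.trans_le hx.1
      have hm1 : Measurable fun r : ℝ => ENNReal.ofReal (r ^ ((p : ℝ) / d - 1)) *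
          f (r ^ (d : ℝ)⁻¹ • a x) := hΦ.comp measurable_prodMk_left
      have hm2 : Measurable fun r : ℝ => ENNReal.ofReal (r ^ ((p : ℝ) / d - 1)) *
          f (r ^ (d : ℝ)⁻¹ • x) := hΦ.comp measurable_prodMk_left
      rw [Pi.mul_apply, setLIntegral_Ioi_mul_left _ hm1 hR, ← mul_assoc, hw,
        ← ENNReal.ofReal_mul (by positivity), mul_assoc (Real.log 2)⁻¹,
        ENNReal.ofReal_mul (by positivity), mul_assoc]
      congr 1
      have hm3 : Measurable fun r : ℝ => ENNReal.ofReal ((psum d x * r) ^ ((p : ℝ) / d - 1)) *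
          f ((psum d x * r) ^ (d : ℝ)⁻¹ • a x) := hm1.comp (measurable_const_mul _)
      rw [← lintegral_const_mul _ hm3]
      refine setLIntegral_congr_fun measurableSet_Ioi fun r hr => ?_
      have hr : 0 < r := hr
      rw [← mul_assoc, ← ENNReal.ofReal_mul (by positivity)]
      congr 2
      · rw [Real.mul_rpow hR.le hr.le, ← mul_assoc, ← Real.rpow_add_one hR.ne',
          ← Real.rpow_add hR]
        simp
      · rw [ha]
        simp only [smul_smul]
        rw [Real.mul_rpow hR.le hr.le, mul_right_comm, ← Real.rpow_add hR]
        simp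
    have h2 : ∫⁻ x in S, (w * fun x => ∫⁻ r in Set.Ioi (0 : ℝ),
          ENNReal.ofReal (r ^ ((p : ℝ) / d - 1)) * f (r ^ (d : ℝ)⁻¹ • a x)) x =
        ∫⁻ x in S, ENNReal.ofReal (Real.log 2)⁻¹ * ∫⁻ r in Set.Ioi (0 : ℝ),
          ENNReal.ofReal (r ^ ((p : ℝ) / d - 1)) * f (r ^ (d : ℝ)⁻¹ • x) :=
      setLIntegral_congr_fun hSm h1
    refine Eq.trans ?_ h2.symm
    rw [lintegral_const_mul _ hI, lintegral_shell hp hd0 hd hf, ← mul_assoc,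
      ← ENNReal.ofReal_mul (by positivity), inv_mul_cancel₀ hlog.ne', ENNReal.ofReal_one, one_mul]
  refine ⟨m0.map a, inferInstance, ?_, ?_, hmain⟩
  · intro h0
    have : Nonempty (Fin p) := ⟨⟨0, hp⟩⟩
    have := hmain (fun _ => 1) measurable_const
    rw [h0, lintegral_zero_measure, lintegral_one] at this
    simp at this
  · have hms : MeasurableSet {x : Fin p → ℝ | psum d x = 1} :=
      measurable_psum p d (measurableSet_singleton 1)
    rw [ae_map_iff ham.aemeasurable hms]
    refine hac.ae_le (ae_restrict_of_forall_mem hSm fun x hx => ?_)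
    have hR : 0 < psum d x := one_pos.trans_le hx.1
    rw [ha]
    simp only
    rw [psum_smul, ← Real.rpow_natCast, ← Real.rpow_mul hR.le, neg_mul, inv_mul_cancel₀ hd',
      Real.rpow_neg_one, inv_mul_cancel₀ hR.ne']

lemma measurable_append (p q : ℕ) :
    Measurable fun z : (Fin p → ℝ) × (Fin q → ℝ) => Fin.append z.1 z.2 := by
  refine measurable_pi_iff.mpr fun i => ?_
  refine Fin.addCases (fun j => ?_) (fun j => ?_) i
  · simp only [Fin.append_left]
    exact (measurable_pi_apply j).comp measurable_fst
  · simp only [Fin.append_right]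
    exact (measurable_pi_apply j).comp measurable_snd

lemma measurePreserving_append (p q : ℕ) :
    MeasurePreserving (fun z : (Fin p → ℝ) × (Fin q → ℝ) => Fin.append z.1 z.2)
      volume volume where
  measurable := measurable_append p q
  map_eq := by
    refine (Measure.pi_eq fun s hs => ?_).symm
    have h1 : (fun z : (Fin p → ℝ) × (Fin q → ℝ) => Fin.append z.1 z.2) ⁻¹' (Set.univ.pi s) =
        (Set.univ.pi fun i => s (Fin.castAdd q i)) ×ˢ (Set.univ.pi fun i => s (Fin.natAdd p i)) := by
      ext z
      simp only [Set.mem_preimage, Set.mem_pi, Set.mem_univ, true_imp_iff, Set.mem_prod,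
        Fin.forall_fin_add, Fin.append_left, Fin.append_right]
    rw [Measure.map_apply (measurable_append p q) (MeasurableSet.univ_pi hs), h1,
      Measure.volume_eq_prod, Measure.prod_prod, volume_pi, volume_pi, Measure.pi_pi,
      Measure.pi_pi, Fin.prod_univ_add]

lemma F0_append (p q d : ℕ) (x : Fin p → ℝ) (y : Fin q → ℝ) :
    F0 p q d (Fin.append x y) = psum d x - psum d y := by
  simp [F0, psum, Fin.sum_univ_add, sub_eq_add_neg]

lemma continuous_F0 (p q d : ℕ) : Continuous (F0 p q d) :=
  continuous_finsetSum _ fun i _ => continuous_const.mul ((continuous_apply i).pow d)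

lemma lintegral_lintegral_shear {H : ℝ × ℝ → ℝ≥0∞} (hH : Measurable H) :
    ∫⁻ r, ∫⁻ s, H (r, s) = ∫⁻ u, ∫⁻ s, H (s + u, s) := by
  rw [lintegral_lintegral_swap (f := fun r s => H (r, s)) hH.aemeasurable]
  have h1 : ∀ s : ℝ, ∫⁻ r, H (r, s) = ∫⁻ u, H (s + u, s) := fun s =>
    (lintegral_add_left_eq_self (fun r => H (r, s)) s).symm
  have h2 : Measurable fun z : ℝ × ℝ => H (z.1 + z.2, z.1) :=
    hH.comp ((measurable_fst.add measurable_snd).prodMk measurable_fst)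
  simp_rw [h1]
  exact lintegral_lintegral_swap (f := fun s u => H (s + u, s)) h2.aemeasurable

/-- The set of radii `s` on the level set `u` along a ray. -/
def rayFiber {p q : ℕ} (d : ℕ) (N : (Fin (p + q) → ℝ) → ℝ) (x : Fin p → ℝ) (y : Fin q → ℝ)
    (u : ℝ) : Set ℝ :=
  {s | 0 < s ∧ 0 < s + u ∧
    N (Fin.append ((s + u) ^ (d : ℝ)⁻¹ • x) (s ^ (d : ℝ)⁻¹ • y)) ≤ 1}

lemma measurable_ray {p q : ℕ} (e : ℝ) (x : Fin p → ℝ) (y : Fin q → ℝ) :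
    Measurable fun z : ℝ × ℝ => Fin.append (z.1 ^ e • x) (z.2 ^ e • y) := by
  have h1 : Measurable fun z : ℝ × ℝ => z.1 ^ e • x :=
    (measurable_fst.pow_const e).smul measurable_const
  have h2 : Measurable fun z : ℝ × ℝ => z.2 ^ e • y :=
    (measurable_snd.pow_const e).smul measurable_const
  exact (measurable_append p q).comp (h1.prodMk h2)

lemma lintegral_ray_eq {p q d : ℕ} (hd0 : d ≠ 0) {N : (Fin (p + q) → ℝ) → ℝ} (hN : Measurable N)
    {J : Set ℝ} (hJ : MeasurableSet J) {x : Fin p → ℝ} {y : Fin q → ℝ} (hx : psum d x = 1)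
    (hy : psum d y = 1) (P Q : ℝ) :
    ∫⁻ r in Set.Ioi (0 : ℝ), ENNReal.ofReal (r ^ (P - 1)) * ∫⁻ s in Set.Ioi (0 : ℝ),
      ENNReal.ofReal (s ^ (Q - 1)) * {z | F0 p q d z ∈ J ∧ N z ≤ 1}.indicator (fun _ => 1)
        (Fin.append (r ^ (d : ℝ)⁻¹ • x) (s ^ (d : ℝ)⁻¹ • y)) =
    ∫⁻ u in J, ∫⁻ s in rayFiber d N x y u,
      ENNReal.ofReal ((s + u) ^ (P - 1) * s ^ (Q - 1)) := by
  set T : Set (ℝ × ℝ) := {z | 0 < z.1 ∧ 0 < z.2 ∧ z.1 - z.2 ∈ J ∧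
    N (Fin.append (z.1 ^ (d : ℝ)⁻¹ • x) (z.2 ^ (d : ℝ)⁻¹ • y)) ≤ 1} with hT
  have hNr : Measurable fun z : ℝ × ℝ =>
      N (Fin.append (z.1 ^ (d : ℝ)⁻¹ • x) (z.2 ^ (d : ℝ)⁻¹ • y)) := hN.comp (measurable_ray _ x y)
  have hTm : MeasurableSet T := by
    refine (measurableSet_lt measurable_const measurable_fst).inter
      ((measurableSet_lt measurable_const measurable_snd).inter
      (MeasurableSet.inter ?_ (measurableSet_le hNr measurable_const)))
    exact (measurable_fst.sub measurable_snd) hJ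
  set H : ℝ × ℝ → ℝ≥0∞ := T.indicator fun z => ENNReal.ofReal (z.1 ^ (P - 1) * z.2 ^ (Q - 1)) with hH
  have hHm : Measurable H := by
    have h1 : Measurable fun z : ℝ × ℝ => ENNReal.ofReal (z.1 ^ (P - 1) * z.2 ^ (Q - 1)) :=
      ((measurable_fst.pow_const _).mul (measurable_snd.pow_const _)).ennreal_ofReal
    exact h1.indicator hTm
  have hA : MeasurableSet {z | F0 p q d z ∈ J ∧ N z ≤ 1} :=
    ((continuous_F0 p q d).measurable hJ).inter (measurableSet_le hN measurable_const)
  have hf : ∀ r : ℝ, Measurable fun s : ℝ => ENNReal.ofReal (s ^ (Q - 1)) *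
      {z | F0 p q d z ∈ J ∧ N z ≤ 1}.indicator (fun _ => (1 : ℝ≥0∞))
        (Fin.append (r ^ (d : ℝ)⁻¹ • x) (s ^ (d : ℝ)⁻¹ • y)) := fun r =>
    (measurable_ofReal_rpow _).mul ((measurable_const.indicator hA).comp
      ((measurable_ray _ x y).comp measurable_prodMk_left))
  calc _ = ∫⁻ r, ∫⁻ s, H (r, s) := by
        rw [← lintegral_indicator measurableSet_Ioi]
        refine lintegral_congr fun r => ?_
        by_cases hr : 0 < r
        · rw [Set.indicator_of_mem (show r ∈ Set.Ioi (0 : ℝ) from hr),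
            ← lintegral_const_mul _ (hf r), ← lintegral_indicator measurableSet_Ioi]
          refine lintegral_congr fun s => ?_
          by_cases hs : 0 < s
          · rw [Set.indicator_of_mem (show s ∈ Set.Ioi (0 : ℝ) from hs)]
            have hF : F0 p q d (Fin.append (r ^ (d : ℝ)⁻¹ • x) (s ^ (d : ℝ)⁻¹ • y)) = r - s := by
              rw [F0_append, psum_rpow_smul hd0 hr.le, psum_rpow_smul hd0 hs.le, hx, hy, mul_one,
                mul_one]
            by_cases hz : (r, s) ∈ T
            · rw [hH, Set.indicator_of_mem hz, Set.indicator_of_mem, mul_one,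
                ENNReal.ofReal_mul (by positivity)]
              exact ⟨by rw [hF]; exact hz.2.2.1, hz.2.2.2⟩
            · rw [hH, Set.indicator_of_notMem hz, Set.indicator_of_notMem, mul_zero, mul_zero]
              rintro ⟨h1, h2⟩
              rw [hF] at h1
              exact hz ⟨hr, hs, h1, h2⟩
          · rw [Set.indicator_of_notMem (show s ∉ Set.Ioi (0 : ℝ) from hs), hH,
              Set.indicator_of_notMem (fun h => hs h.2.1)]
        · rw [Set.indicator_of_notMem (show r ∉ Set.Ioi (0 : ℝ) from hr)]
          symm
          have h0 : ∀ s, H (r, s) = 0 := fun s => Set.indicator_of_notMem (fun h => hr h.1) _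
          simp [h0]
    _ = ∫⁻ u, ∫⁻ s, H (s + u, s) := lintegral_lintegral_shear hHm
    _ = _ := by
        rw [← lintegral_indicator hJ]
        refine lintegral_congr fun u => ?_
        by_cases hu : u ∈ J
        · have hm : MeasurableSet (rayFiber d N x y u) := by
            have h1 : Measurable fun s : ℝ => s + u := measurable_id.add_const u
            have h2 : Measurable fun s : ℝ =>
                N (Fin.append ((s + u) ^ (d : ℝ)⁻¹ • x) (s ^ (d : ℝ)⁻¹ • y)) :=
              hNr.comp (h1.prodMk measurable_id)
            exact (measurableSet_lt measurable_const measurable_id).inter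
              ((measurableSet_lt measurable_const h1).inter (measurableSet_le h2 measurable_const))
          rw [Set.indicator_of_mem hu, ← lintegral_indicator hm]
          refine lintegral_congr fun s => ?_
          by_cases hs : s ∈ rayFiber d N x y u
          · rw [Set.indicator_of_mem hs, hH, Set.indicator_of_mem]
            exact ⟨hs.2.1, hs.1, by simpa using hu, hs.2.2⟩
          · rw [Set.indicator_of_notMem hs, hH, Set.indicator_of_notMem]
            exact fun h => hs ⟨h.2.1, h.1, h.2.2.2⟩
        · rw [Set.indicator_of_notMem hu]
          have : ∀ s, H (s + u, s) = 0 := fun s =>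
            Set.indicator_of_notMem (fun h => hu (by simpa using h.2.2.1)) _
          simp [this]

lemma lintegral_double_polar {p q d : ℕ} {mp : Measure (Fin p → ℝ)}
    {mq : Measure (Fin q → ℝ)} [IsFiniteMeasure mp] [IsFiniteMeasure mq]
    (hp : ∀ f : (Fin p → ℝ) → ℝ≥0∞, Measurable f →
        ∫⁻ x, f x = ∫⁻ x, (∫⁻ r in Set.Ioi (0 : ℝ),
          ENNReal.ofReal (r ^ ((p : ℝ) / d - 1)) * f (r ^ (d : ℝ)⁻¹ • x)) ∂mp)
    (hq : ∀ f : (Fin q → ℝ) → ℝ≥0∞, Measurable f →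
        ∫⁻ x, f x = ∫⁻ x, (∫⁻ r in Set.Ioi (0 : ℝ),
          ENNReal.ofReal (r ^ ((q : ℝ) / d - 1)) * f (r ^ (d : ℝ)⁻¹ • x)) ∂mq)
    {f : (Fin (p + q) → ℝ) → ℝ≥0∞} (hfm : Measurable f) :
    ∫⁻ z, f z = ∫⁻ x, ∫⁻ y, (∫⁻ r in Set.Ioi (0 : ℝ), ENNReal.ofReal (r ^ ((p : ℝ) / d - 1)) *
      ∫⁻ s in Set.Ioi (0 : ℝ), ENNReal.ofReal (s ^ ((q : ℝ) / d - 1)) *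
        f (Fin.append (r ^ (d : ℝ)⁻¹ • x) (s ^ (d : ℝ)⁻¹ • y))) ∂mq ∂mp := by
  have hfa : Measurable fun z : (Fin p → ℝ) × (Fin q → ℝ) => f (Fin.append z.1 z.2) :=
    hfm.comp (measurable_append p q)
  have hsm : ∀ k : ℕ, Measurable fun z : (Fin k → ℝ) × ℝ => z.2 ^ (d : ℝ)⁻¹ • z.1 := fun k =>
    (measurable_snd.pow_const _).smul measurable_fst
  have h1 : Measurable fun z : ((Fin p → ℝ) × (Fin q → ℝ)) × ℝ =>
      ENNReal.ofReal (z.2 ^ ((q : ℝ) / d - 1)) *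
        f (Fin.append z.1.1 (z.2 ^ (d : ℝ)⁻¹ • z.1.2)) := by
    have h0 : Measurable fun z : ((Fin p → ℝ) × (Fin q → ℝ)) × ℝ =>
        (z.1.1, z.2 ^ (d : ℝ)⁻¹ • z.1.2) :=
      (measurable_fst.comp measurable_fst).prodMk
        ((measurable_snd.pow_const _).smul (measurable_snd.comp measurable_fst))
    have h0' : Measurable fun z : ((Fin p → ℝ) × (Fin q → ℝ)) × ℝ =>
      ENNReal.ofReal (z.2 ^ ((q : ℝ) / d - 1)) := (measurable_snd.pow_const _).ennreal_ofReal
    have h0'' : Measurable fun z : ((Fin p → ℝ) × (Fin q → ℝ)) × ℝ =>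
      f (Fin.append z.1.1 (z.2 ^ (d : ℝ)⁻¹ • z.1.2)) := hfa.comp h0
    exact h0'.fun_mul h0''
  have h2 : Measurable fun z : (Fin p → ℝ) × (Fin q → ℝ) => ∫⁻ s in Set.Ioi (0 : ℝ),
      ENNReal.ofReal (s ^ ((q : ℝ) / d - 1)) * f (Fin.append z.1 (s ^ (d : ℝ)⁻¹ • z.2)) :=
    h1.lintegral_prod_right'
  have h3 : Measurable fun x : Fin p → ℝ => ∫⁻ y, (∫⁻ s in Set.Ioi (0 : ℝ),
      ENNReal.ofReal (s ^ ((q : ℝ) / d - 1)) * f (Fin.append x (s ^ (d : ℝ)⁻¹ • y))) ∂mq :=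
    h2.lintegral_prod_right'
  calc ∫⁻ z, f z = ∫⁻ z : (Fin p → ℝ) × (Fin q → ℝ), f (Fin.append z.1 z.2) :=
        ((measurePreserving_append p q).lintegral_comp hfm).symm
    _ = ∫⁻ x, ∫⁻ y, f (Fin.append x y) := by
        rw [Measure.volume_eq_prod, lintegral_prod _ hfa.aemeasurable]
    _ = ∫⁻ x, ∫⁻ y, (∫⁻ s in Set.Ioi (0 : ℝ),
          ENNReal.ofReal (s ^ ((q : ℝ) / d - 1)) * f (Fin.append x (s ^ (d : ℝ)⁻¹ • y))) ∂mq := by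
        refine lintegral_congr fun x => ?_
        exact hq (fun y => f (Fin.append x y)) (hfa.comp measurable_prodMk_left)
    _ = ∫⁻ x, (∫⁻ r in Set.Ioi (0 : ℝ), ENNReal.ofReal (r ^ ((p : ℝ) / d - 1)) *
          ∫⁻ y, (∫⁻ s in Set.Ioi (0 : ℝ), ENNReal.ofReal (s ^ ((q : ℝ) / d - 1)) *
            f (Fin.append (r ^ (d : ℝ)⁻¹ • x) (s ^ (d : ℝ)⁻¹ • y))) ∂mq) ∂mp := hp _ h3
    _ = _ := by
        refine lintegral_congr fun x => ?_
        have h4 : Measurable fun z : ℝ × (Fin q → ℝ) => ∫⁻ s in Set.Ioi (0 : ℝ),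
            ENNReal.ofReal (s ^ ((q : ℝ) / d - 1)) *
              f (Fin.append (z.1 ^ (d : ℝ)⁻¹ • x) (s ^ (d : ℝ)⁻¹ • z.2)) := by
          have h5 : Measurable fun z : ℝ × (Fin q → ℝ) => (z.1 ^ (d : ℝ)⁻¹ • x, z.2) :=
            ((hsm p).comp (measurable_const.prodMk measurable_fst)).prodMk measurable_snd
          exact h2.comp h5
        have h6 : Measurable fun z : ℝ × (Fin q → ℝ) => ENNReal.ofReal (z.1 ^ ((p : ℝ) / d - 1)) *
            ∫⁻ s in Set.Ioi (0 : ℝ), ENNReal.ofReal (s ^ ((q : ℝ) / d - 1)) *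
              f (Fin.append (z.1 ^ (d : ℝ)⁻¹ • x) (s ^ (d : ℝ)⁻¹ • z.2)) :=
          ((measurable_ofReal_rpow _).comp measurable_fst).mul h4
        have h7 : ∀ r : ℝ, ENNReal.ofReal (r ^ ((p : ℝ) / d - 1)) *
            ∫⁻ y, (∫⁻ s in Set.Ioi (0 : ℝ), ENNReal.ofReal (s ^ ((q : ℝ) / d - 1)) *
              f (Fin.append (r ^ (d : ℝ)⁻¹ • x) (s ^ (d : ℝ)⁻¹ • y))) ∂mq =
            ∫⁻ y, (ENNReal.ofReal (r ^ ((p : ℝ) / d - 1)) * ∫⁻ s in Set.Ioi (0 : ℝ),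
              ENNReal.ofReal (s ^ ((q : ℝ) / d - 1)) *
              f (Fin.append (r ^ (d : ℝ)⁻¹ • x) (s ^ (d : ℝ)⁻¹ • y))) ∂mq := fun r =>
          (lintegral_const_mul _ (h4.comp measurable_prodMk_left)).symm
        simp_rw [h7]
        exact lintegral_lintegral_swap h6.aemeasurable

/-- The volume of a region of a level set of `F₀` in polar coordinates. -/
lemma volume_level_region {p q d : ℕ} (hd0 : d ≠ 0) {N : (Fin (p + q) → ℝ) → ℝ}
    (hN : Measurable N) {J : Set ℝ} (hJ : MeasurableSet J) {mp : Measure (Fin p → ℝ)}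
    {mq : Measure (Fin q → ℝ)} [IsFiniteMeasure mp] [IsFiniteMeasure mq]
    (hp1 : ∀ᵐ x ∂mp, psum d x = 1) (hq1 : ∀ᵐ x ∂mq, psum d x = 1)
    (hp : ∀ f : (Fin p → ℝ) → ℝ≥0∞, Measurable f →
        ∫⁻ x, f x = ∫⁻ x, (∫⁻ r in Set.Ioi (0 : ℝ),
          ENNReal.ofReal (r ^ ((p : ℝ) / d - 1)) * f (r ^ (d : ℝ)⁻¹ • x)) ∂mp)
    (hq : ∀ f : (Fin q → ℝ) → ℝ≥0∞, Measurable f →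
        ∫⁻ x, f x = ∫⁻ x, (∫⁻ r in Set.Ioi (0 : ℝ),
          ENNReal.ofReal (r ^ ((q : ℝ) / d - 1)) * f (r ^ (d : ℝ)⁻¹ • x)) ∂mq) :
    volume {z | F0 p q d z ∈ J ∧ N z ≤ 1} =
      ∫⁻ x, ∫⁻ y, (∫⁻ u in J, ∫⁻ s in rayFiber d N x y u,
        ENNReal.ofReal ((s + u) ^ ((p : ℝ) / d - 1) * s ^ ((q : ℝ) / d - 1))) ∂mq ∂mp := by
  have hAm : MeasurableSet {z | F0 p q d z ∈ J ∧ N z ≤ 1} :=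
    ((continuous_F0 p q d).measurable hJ).inter (measurableSet_le hN measurable_const)
  have hfm : Measurable ({z | F0 p q d z ∈ J ∧ N z ≤ 1}.indicator fun _ => (1 : ℝ≥0∞)) :=
    measurable_const.indicator hAm
  have h1 := lintegral_double_polar hp hq hfm
  rw [lintegral_indicator_const hAm, one_mul] at h1
  rw [h1]
  refine lintegral_congr_ae ?_
  filter_upwards [hp1] with x hx
  refine lintegral_congr_ae ?_
  filter_upwards [hq1] with y hy
  exact lintegral_ray_eq hd0 hN hJ hx hy _ _

/-- A positively homogeneous Lipschitz function comparable to the norm. -/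
structure IsGauge {n : ℕ} (N : (Fin n → ℝ) → ℝ) (L c : ℝ) : Prop where
  pos : 0 < c
  nonneg : 0 ≤ L
  smul : ∀ r : ℝ, 0 ≤ r → ∀ z, N (r • z) = r * N z
  lip : ∀ z z', |N z - N z'| ≤ L * ‖z - z'‖
  lower : ∀ z, c * ‖z‖ ≤ N z

lemma IsGauge.continuous {n : ℕ} {N : (Fin n → ℝ) → ℝ} {L c : ℝ} (h : IsGauge N L c) :
    Continuous N := by
  have : LipschitzWith ⟨L, h.nonneg⟩ N := LipschitzWith.of_dist_le_mul fun z z' => by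
    rw [Real.dist_eq, dist_eq_norm]; exact h.lip z z'
  exact this.continuous

lemma IsGauge.upper {n : ℕ} {N : (Fin n → ℝ) → ℝ} {L c : ℝ} (h : IsGauge N L c) (z : Fin n → ℝ) :
    N z ≤ L * ‖z‖ := by
  have h0 : N 0 = 0 := by simpa using h.smul 0 le_rfl 0
  have := h.lip z 0
  rw [h0, sub_zero, sub_zero] at this
  exact (le_abs_self _).trans this

lemma norm_le_one_of_psum {p d : ℕ} (hd0 : d ≠ 0) (hd : Even d) {x : Fin p → ℝ}
    (hx : psum d x = 1) : ‖x‖ ≤ 1 := by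
  refine (pi_norm_le_iff_of_nonneg zero_le_one).mpr fun i => ?_
  rw [Real.norm_eq_abs, ← pow_le_one_iff_of_nonneg (abs_nonneg _) hd0]
  exact (abs_pow_le_psum hd x i).trans hx.le

lemma le_norm_of_psum {p d : ℕ} (hd0 : d ≠ 0) (hd : Even d) {x : Fin p → ℝ}
    (hx : psum d x = 1) : 1 ≤ p * ‖x‖ := by
  have h1 := norm_le_one_of_psum hd0 hd hx
  have h2 : psum d x ≤ ∑ _i : Fin p, ‖x‖ := by
    refine Finset.sum_le_sum fun i _ => ?_
    rw [← hd.pow_abs]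
    calc |x i| ^ d ≤ ‖x‖ ^ d := by
          gcongr; exact norm_le_pi_norm x i
      _ ≤ ‖x‖ := pow_le_of_le_one (norm_nonneg _) h1 hd0
  rw [hx] at h2
  simpa using h2

lemma append_smul {p q : ℕ} (r : ℝ) (x : Fin p → ℝ) (y : Fin q → ℝ) :
    Fin.append (r • x) (r • y) = r • Fin.append x y := by
  ext i
  refine Fin.addCases (fun j => ?_) (fun j => ?_) i <;> simp

lemma norm_append_le {p q : ℕ} {x : Fin p → ℝ} {y : Fin q → ℝ} {r : ℝ} (hr : 0 ≤ r)
    (hx : ‖x‖ ≤ r) (hy : ‖y‖ ≤ r) : ‖Fin.append x y‖ ≤ r := by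
  refine (pi_norm_le_iff_of_nonneg hr).mpr fun i => ?_
  refine Fin.addCases (fun j => ?_) (fun j => ?_) i
  · simpa using (norm_le_pi_norm x j).trans hx
  · simpa using (norm_le_pi_norm y j).trans hy

lemma le_norm_append {p q : ℕ} (x : Fin p → ℝ) (y : Fin q → ℝ) : ‖x‖ ≤ ‖Fin.append x y‖ := by
  refine (pi_norm_le_iff_of_nonneg (norm_nonneg _)).mpr fun i => ?_
  simpa using norm_le_pi_norm (Fin.append x y) (Fin.castAdd q i)

lemma abs_rpow_sub_one_le {v θ : ℝ} (hv : 0 ≤ 1 + v) (h0 : 0 ≤ θ) (h1 : θ ≤ 1) :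
    |(1 + v) ^ θ - 1| ≤ |v| := by
  rcases le_total 0 v with h | h
  · rw [abs_of_nonneg h, abs_of_nonneg (sub_nonneg.mpr (Real.one_le_rpow (by linarith) h0))]
    have := Real.rpow_le_rpow_of_exponent_le (show 1 ≤ 1 + v by linarith) h1
    rw [Real.rpow_one] at this
    linarith
  · have h2 := Real.rpow_le_one hv (by linarith) h0
    rw [abs_of_nonpos h, abs_of_nonpos (by linarith)]
    rcases hv.eq_or_lt with h3 | h3
    · have := Real.rpow_nonneg hv θ
      linarith
    · have := Real.rpow_le_rpow_of_exponent_ge h3 (by linarith) h1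
      rw [Real.rpow_one] at this
      linarith

lemma IsGauge.abs_ray_sub_le {p q d : ℕ} {N : (Fin (p + q) → ℝ) → ℝ} {L c : ℝ} (h : IsGauge N L c)
    (hd0 : d ≠ 0) {x : Fin p → ℝ} (hx : ‖x‖ ≤ 1) (y : Fin q → ℝ) {s u e : ℝ} (he : 0 < e)
    (he1 : e ≤ 1) (hu : |u| ≤ e ^ 2) (hs : e < s) :
    |N (Fin.append ((s + u) ^ (d : ℝ)⁻¹ • x) (s ^ (d : ℝ)⁻¹ • y)) -
      s ^ (d : ℝ)⁻¹ * N (Fin.append x y)| ≤ s ^ (d : ℝ)⁻¹ * (L * e) := by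
  have hs0 : 0 < s := he.trans hs
  have hr0 : 0 ≤ s ^ (d : ℝ)⁻¹ := by positivity
  have hv := abs_div_le_of_sq he hu hs.le
  have hv0 : 0 ≤ 1 + u / s := by linarith [(abs_le.mp hv).1]
  have hd1 : ((d : ℝ))⁻¹ ≤ 1 := by
    have : (1 : ℝ) ≤ d := by exact_mod_cast Nat.one_le_iff_ne_zero.mpr hd0
    exact inv_le_one_of_one_le₀ this
  have h1 : s + u = s * (1 + u / s) := by field_simp
  rw [← h.smul _ hr0, ← append_smul]
  refine (h.lip _ _).trans ?_
  have h2 : Fin.append ((s + u) ^ (d : ℝ)⁻¹ • x) (s ^ (d : ℝ)⁻¹ • y) -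
      Fin.append (s ^ (d : ℝ)⁻¹ • x) (s ^ (d : ℝ)⁻¹ • y) =
      Fin.append (((s + u) ^ (d : ℝ)⁻¹ - s ^ (d : ℝ)⁻¹) • x) (0 : Fin q → ℝ) := by
    ext i
    refine Fin.addCases (fun j => ?_) (fun j => ?_) i <;> simp [sub_mul]
  have h3 : ‖((s + u) ^ (d : ℝ)⁻¹ - s ^ (d : ℝ)⁻¹) • x‖ ≤ s ^ (d : ℝ)⁻¹ * e := by
    rw [norm_smul, h1, Real.mul_rpow hs0.le hv0, Real.norm_eq_abs]
    have h4 : s ^ (d : ℝ)⁻¹ * (1 + u / s) ^ (d : ℝ)⁻¹ - s ^ (d : ℝ)⁻¹ =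
        s ^ (d : ℝ)⁻¹ * ((1 + u / s) ^ (d : ℝ)⁻¹ - 1) := by ring
    rw [h4, abs_mul, abs_of_nonneg hr0]
    calc _ ≤ s ^ (d : ℝ)⁻¹ * e * 1 := by
          gcongr
          exact (abs_rpow_sub_one_le hv0 (by positivity) hd1).trans hv
      _ = _ := mul_one _
  rw [h2]
  have h5 : ‖Fin.append (((s + u) ^ (d : ℝ)⁻¹ - s ^ (d : ℝ)⁻¹) • x) (0 : Fin q → ℝ)‖ ≤
      s ^ (d : ℝ)⁻¹ * e := norm_append_le (by positivity) h3 (by rw [norm_zero]; positivity)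
  calc _ ≤ L * (s ^ (d : ℝ)⁻¹ * e) := mul_le_mul_of_nonneg_left h5 h.nonneg
    _ = _ := by ring

/-- Density bounds along the fibers over the unit level sets. -/
lemma exists_rayFiber_bounds {p q d : ℕ} (hp : 1 ≤ p) (hq : 1 ≤ q) (hd0 : d ≠ 0) (hd : Even d)
    (hnd : d < p + q) {N : (Fin (p + q) → ℝ) → ℝ} {L c : ℝ} (hN : IsGauge N L c) :
    ∃ C > 0, ∃ e0 > 0, ∀ e u : ℝ, 0 < e → e ≤ e0 → |u| ≤ e ^ 2 →
      ∀ (x : Fin p → ℝ) (y : Fin q → ℝ), psum d x = 1 → psum d y = 1 →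
      ∫⁻ s in rayFiber d N x y u,
          ENNReal.ofReal ((s + u) ^ ((p : ℝ) / d - 1) * s ^ ((q : ℝ) / d - 1)) ≤
        ENNReal.ofReal ((N (Fin.append x y) ^ (p + q - d))⁻¹ / ((p : ℝ) / d + (q : ℝ) / d - 1)) *
          ENNReal.ofReal (1 + C * e) +
          ENNReal.ofReal (C * e ^ ((p : ℝ) / d + (q : ℝ) / d - 1)) ∧
      ENNReal.ofReal ((N (Fin.append x y) ^ (p + q - d))⁻¹ / ((p : ℝ) / d + (q : ℝ) / d - 1)) *
          ENNReal.ofReal (1 - C * e) ≤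
        (∫⁻ s in rayFiber d N x y u,
          ENNReal.ofReal ((s + u) ^ ((p : ℝ) / d - 1) * s ^ ((q : ℝ) / d - 1))) +
          ENNReal.ofReal (C * e ^ ((p : ℝ) / d + (q : ℝ) / d - 1)) ∧
      c / p ≤ N (Fin.append x y) ∧ N (Fin.append x y) ≤ L + c / p := by
  have hdpos : (0 : ℝ) < d := by exact_mod_cast Nat.pos_of_ne_zero hd0
  have hp' : (0 : ℝ) < p := by exact_mod_cast hp
  have hq' : (0 : ℝ) < q := by exact_mod_cast hq
  have hnd' : (d : ℝ) < p + q := by exact_mod_cast hnd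
  have hPQ : 1 < (p : ℝ) / d + (q : ℝ) / d := by
    rw [← add_div, one_lt_div hdpos]; exact hnd'
  have hda : (d : ℝ) * ((p : ℝ) / d + (q : ℝ) / d - 1) = (p + q - d : ℕ) := by
    rw [Nat.cast_sub hnd.le]; push_cast; field_simp
  have hk0 : 0 < c / p := div_pos hN.pos hp'
  obtain ⟨C, hC, e0, he0, hb⟩ := exists_weight_bounds (P := (p : ℝ) / d) (Q := (q : ℝ) / d)
    (by positivity) (by positivity) hPQ hda hk0 (K0 := L + c / p) (by linarith [hN.nonneg]) hN.nonneg
  refine ⟨C, hC, min (min e0 1) (c / p / (L + 1)), ?_, ?_⟩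
  · have := hN.nonneg
    positivity
  intro e u he hee hu x y hx hy
  have hee0 : e ≤ e0 := hee.trans ((min_le_left _ _).trans (min_le_left _ _))
  have hee1 : e ≤ 1 := hee.trans ((min_le_left _ _).trans (min_le_right _ _))
  have heL : e * (L + 1) ≤ c / p := by
    rw [← le_div_iff₀ (by linarith [hN.nonneg])]; exact hee.trans (min_le_right _ _)
  have hx1 := norm_le_one_of_psum hd0 hd hx
  have hy1 := norm_le_one_of_psum hd0 hd hy
  have hkl : c / p ≤ N (Fin.append x y) := by
    refine le_trans ?_ (hN.lower _)
    rw [div_le_iff₀ hp', mul_assoc]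
    have h1 := (le_norm_of_psum hd0 hd hx).trans
      (mul_le_mul_of_nonneg_left (le_norm_append x y) hp'.le)
    nlinarith [hN.pos]
  have hku : N (Fin.append x y) ≤ L + c / p := by
    have := (hN.upper (Fin.append x y)).trans
      (mul_le_mul_of_nonneg_left (norm_append_le zero_le_one hx1 hy1) hN.nonneg)
    linarith
  have hroot : ∀ s : ℝ, 0 < s → ∀ k : ℝ, (s ^ (d : ℝ)⁻¹ * k) ^ d = s * k ^ d := fun s hs k => by
    rw [mul_pow, Real.rpow_inv_natCast_pow hs.le hd0]
  have key := hb (N (Fin.append x y)) e u hkl hku he hee0 hu (rayFiber d N x y u)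
    (fun s hs => ⟨hs.1, hs.2.1⟩) ?_ ?_
  · exact ⟨key.1, key.2, hkl, hku⟩
  · intro s hs hes
    have h1 := (abs_le.mp (hN.abs_ray_sub_le hd0 hx1 y he hee1 hu hes)).1
    have h2 : 0 ≤ N (Fin.append x y) - L * e := by nlinarith
    rw [← hroot s hs.1]
    refine pow_le_one₀ (mul_nonneg (Real.rpow_nonneg hs.1.le _) h2) ?_
    have := hs.2.2
    linarith
  · intro s hes hs
    have hs0 : 0 < s := he.trans hes
    have h1 := (abs_le.mp (hN.abs_ray_sub_le hd0 hx1 y he hee1 hu hes)).2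
    rw [← hroot s hs0, pow_le_one_iff_of_nonneg] at hs
    · refine ⟨hs0, ?_, by linarith⟩
      have := (abs_le.mp hu).1
      nlinarith
    · have : 0 ≤ N (Fin.append x y) + L * e := by
        have := mul_nonneg hN.nonneg he.le
        linarith
      positivity
    · exact hd0

lemma lintegral_lintegral_le_of_ae {α β : Type*} [MeasurableSpace α] [MeasurableSpace β]
    {m₁ : Measure α} {m₂ : Measure β} {F X : α → β → ℝ≥0∞} {a b : ℝ≥0∞} (ha : a ≠ ⊤)
    (h : ∀ᵐ x ∂m₁, ∀ᵐ y ∂m₂, F x y ≤ X x y * a + b) :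
    ∫⁻ x, ∫⁻ y, F x y ∂m₂ ∂m₁ ≤
      (∫⁻ x, ∫⁻ y, X x y ∂m₂ ∂m₁) * a + b * m₂ Set.univ * m₁ Set.univ := by
  rw [← lintegral_mul_const' _ _ ha, ← lintegral_const, ← lintegral_add_right _ measurable_const]
  refine lintegral_mono_ae (h.mono fun x hx => ?_)
  rw [← lintegral_mul_const' _ _ ha, ← lintegral_const, ← lintegral_add_right _ measurable_const]
  exact lintegral_mono_ae hx

lemma le_lintegral_lintegral_of_ae {α β : Type*} [MeasurableSpace α] [MeasurableSpace β]
    {m₁ : Measure α} {m₂ : Measure β} {F X : α → β → ℝ≥0∞} {a b : ℝ≥0∞} (ha : a ≠ ⊤)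
    (h : ∀ᵐ x ∂m₁, ∀ᵐ y ∂m₂, X x y * a ≤ F x y + b) :
    (∫⁻ x, ∫⁻ y, X x y ∂m₂ ∂m₁) * a ≤
      (∫⁻ x, ∫⁻ y, F x y ∂m₂ ∂m₁) + b * m₂ Set.univ * m₁ Set.univ := by
  rw [← lintegral_mul_const' _ _ ha, ← lintegral_const, ← lintegral_add_right _ measurable_const]
  refine lintegral_mono_ae (h.mono fun x hx => ?_)
  rw [← lintegral_mul_const' _ _ ha, ← lintegral_const, ← lintegral_add_right _ measurable_const]
  exact lintegral_mono_ae hx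

/-- Twice this number is the smaller of `1` and `(p + q) / d - 1`. -/
def volExp (p q d : ℕ) : ℝ := min 1 ((p : ℝ) / d + (q : ℝ) / d - 1) / 2

lemma volExp_base_pos {p q d : ℕ} (hd0 : d ≠ 0) (hnd : d < p + q) :
    0 < (p : ℝ) / d + (q : ℝ) / d - 1 := by
  have hd' : (0 : ℝ) < d := by positivity
  have : (d : ℝ) < p + q := by exact_mod_cast hnd
  rw [← add_div, sub_pos, one_lt_div hd']
  exact this

lemma volExp_pos {p q d : ℕ} (hd0 : d ≠ 0) (hnd : d < p + q) : 0 < volExp p q d :=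
  half_pos (lt_min one_pos (volExp_base_pos hd0 hnd))

lemma exists_volume_unit_asymp {p q d : ℕ} (hp : 1 ≤ p) (hq : 1 ≤ q) (hd0 : d ≠ 0) (hd : Even d)
    (hnd : d < p + q) {N : (Fin (p + q) → ℝ) → ℝ} {L c : ℝ} (hN : IsGauge N L c) :
    ∃ K > 0, ∃ C > 0, ∃ w0 > 0, ∀ w : ℝ, 0 < w → w ≤ w0 → ∀ J : Set ℝ, MeasurableSet J →
      J ⊆ Set.Icc (-w) w →
      volume {z | F0 p q d z ∈ J ∧ N z ≤ 1} ≠ ⊤ ∧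
      |(volume {z | F0 p q d z ∈ J ∧ N z ≤ 1}).toReal - K * (volume J).toReal| ≤
        C * (volume J).toReal * w ^ volExp p q d := by
  obtain ⟨mp, hfp, hp0, hp1, hpi⟩ := exists_polar hp hd0 hd
  obtain ⟨mq, hfq, hq0, hq1, hqi⟩ := exists_polar hq hd0 hd
  obtain ⟨C, hC, e0, he0, hb⟩ := exists_rayFiber_bounds hp hq hd0 hd hnd hN
  have hA := volExp_base_pos hd0 hnd
  obtain ⟨A, hAdef⟩ : ∃ A, A = (p : ℝ) / d + (q : ℝ) / d - 1 := ⟨_, rfl⟩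
  rw [← hAdef] at hA
  simp_rw [← hAdef] at hb
  obtain ⟨X, hX⟩ : ∃ X : (Fin p → ℝ) → (Fin q → ℝ) → ℝ≥0∞, X = fun x y =>
    ENNReal.ofReal ((N (Fin.append x y) ^ (p + q - d))⁻¹ / A) := ⟨_, rfl⟩
  have hXb : ∀ x y, psum d x = 1 → psum d y = 1 →
      X x y ≤ ENNReal.ofReal (((c / p) ^ (p + q - d))⁻¹ / A) ∧
      ENNReal.ofReal (((L + c / p) ^ (p + q - d))⁻¹ / A) ≤ X x y := by
    intro x y hx hy
    obtain ⟨-, -, h1, h2⟩ := hb e0 0 he0 le_rfl (by rw [abs_zero]; positivity) x y hx hy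
    have hcp : 0 < c / p := div_pos hN.pos (by exact_mod_cast hp)
    have hNp : 0 < N (Fin.append x y) := hcp.trans_le h1
    subst hX
    constructor <;> refine ENNReal.ofReal_le_ofReal ?_ <;> gcongr
  obtain ⟨Kc, hKc⟩ : ∃ Kc, Kc = ∫⁻ x, ∫⁻ y, X x y ∂mq ∂mp := ⟨_, rfl⟩
  have hKtop : Kc ≠ ⊤ := by
    have h1 := lintegral_lintegral_le_of_ae (m₁ := mp) (m₂ := mq) (F := X) (X := 0) (a := 0)
      (b := ENNReal.ofReal (((c / p) ^ (p + q - d))⁻¹ / A)) ENNReal.zero_ne_top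
      (hp1.mono fun x hx => hq1.mono fun y hy => by simpa using (hXb x y hx hy).1)
    rw [← hKc] at h1
    refine ne_top_of_le_ne_top ?_ h1
    simp [ENNReal.mul_eq_top]
  have hK0 : Kc ≠ 0 := by
    have h1 := le_lintegral_lintegral_of_ae (m₁ := mp) (m₂ := mq) (F := X) (X := fun _ _ => 1)
      (a := ENNReal.ofReal (((L + c / p) ^ (p + q - d))⁻¹ / A)) (b := 0) ENNReal.ofReal_ne_top
      (hp1.mono fun x hx => hq1.mono fun y hy => by simpa using (hXb x y hx hy).2)
    rw [← hKc] at h1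
    intro h0
    rw [h0] at h1
    have hcp : 0 < c / p := div_pos hN.pos (by exact_mod_cast hp)
    have hL := hN.nonneg
    have hpos : 0 < ((L + c / p) ^ (p + q - d))⁻¹ / A := by positivity
    simp [hp0, hq0, hpos.not_ge] at h1
  obtain ⟨K, hK⟩ : ∃ K, K = Kc.toReal := ⟨_, rfl⟩
  have hKpos : 0 < K := hK ▸ ENNReal.toReal_pos hK0 hKtop
  obtain ⟨D, hD⟩ : ∃ D, D = mq.real Set.univ * mp.real Set.univ := ⟨_, rfl⟩
  have hD0 : 0 ≤ D := by rw [hD]; positivity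
  have hKof : Kc = ENNReal.ofReal K := by rw [hK, ENNReal.ofReal_toReal hKtop]
  have hDof : mq Set.univ * mp Set.univ = ENNReal.ofReal D := by
    rw [hD, ENNReal.ofReal_mul measureReal_nonneg, ofReal_measureReal, ofReal_measureReal]
  refine ⟨K, hKpos, K * C + D * C + 1, by positivity, min (e0 ^ 2) 1, by positivity,
    fun w hw0 hw J hJ hJw => ?_⟩
  obtain ⟨e, he⟩ : ∃ e, e = Real.sqrt w := ⟨_, rfl⟩
  have hepos : 0 < e := he ▸ Real.sqrt_pos.mpr hw0
  have hesq : e ^ 2 = w := he ▸ Real.sq_sqrt hw0.le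
  have hee0 : e ≤ e0 := by
    rw [he]
    exact Real.sqrt_le_iff.mpr ⟨he0.le, hw.trans (min_le_left _ _)⟩
  have he1 : e ≤ 1 := by
    rw [he]
    exact Real.sqrt_le_iff.mpr ⟨zero_le_one, by simpa using hw.trans (min_le_right _ _)⟩
  have hJtop : volume J ≠ ⊤ :=
    ne_top_of_le_ne_top (by simp) (measure_mono hJw)
  obtain ⟨l, hl⟩ : ∃ l, l = (volume J).toReal := ⟨_, rfl⟩
  have hl0 : 0 ≤ l := hl ▸ ENNReal.toReal_nonneg
  have hlof : volume J = ENNReal.ofReal l := by rw [hl, ENNReal.ofReal_toReal hJtop]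
  have hV := volume_level_region hd0 hN.continuous.measurable hJ hp1 hq1 hpi hqi
  obtain ⟨V, hVdef⟩ : ∃ V, V = volume {z | F0 p q d z ∈ J ∧ N z ≤ 1} := ⟨_, rfl⟩
  rw [← hVdef] at hV ⊢
  have hup : V ≤ Kc * (ENNReal.ofReal (1 + C * e) * volume J) +
      ENNReal.ofReal (C * e ^ A) * volume J * mq Set.univ * mp Set.univ := by
    rw [hV, hKc]
    refine lintegral_lintegral_le_of_ae (ENNReal.mul_ne_top ENNReal.ofReal_ne_top hJtop)
      (hp1.mono fun x hx => hq1.mono fun y hy => ?_)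
    rw [← mul_assoc, ← add_mul, ← setLIntegral_const]
    refine setLIntegral_mono' hJ fun u hu => ?_
    have := (hb e u hepos hee0 (by rw [hesq]; exact abs_le.mpr (hJw hu)) x y hx hy).1
    rw [hX]
    exact this
  have hlow : Kc * (ENNReal.ofReal (1 - C * e) * volume J) ≤ V +
      ENNReal.ofReal (C * e ^ A) * volume J * mq Set.univ * mp Set.univ := by
    rw [hV, hKc]
    refine le_lintegral_lintegral_of_ae (ENNReal.mul_ne_top ENNReal.ofReal_ne_top hJtop)
      (hp1.mono fun x hx => hq1.mono fun y hy => ?_)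
    rw [← mul_assoc, ← setLIntegral_const, ← setLIntegral_const,
      ← lintegral_add_right _ measurable_const]
    refine setLIntegral_mono' hJ fun u hu => ?_
    have := (hb e u hepos hee0 (by rw [hesq]; exact abs_le.mpr (hJw hu)) x y hx hy).2.1
    rw [hX]
    exact this
  have hCe : 0 ≤ C * e ^ A := by positivity
  have hup' : V ≤ ENNReal.ofReal (K * ((1 + C * e) * l) + C * e ^ A * l * D) := by
    refine hup.trans_eq ?_
    rw [mul_assoc (_ * _), hDof, hKof, hlof, ← ENNReal.ofReal_mul (by positivity),
      ← ENNReal.ofReal_mul hKpos.le, ← ENNReal.ofReal_mul hCe,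
      ← ENNReal.ofReal_mul (by positivity), ← ENNReal.ofReal_add (by positivity) (by positivity)]
  have hVtop : V ≠ ⊤ := ne_top_of_le_ne_top ENNReal.ofReal_ne_top hup'
  have hVof : V = ENNReal.ofReal V.toReal := (ENNReal.ofReal_toReal hVtop).symm
  have hup2 : V.toReal ≤ K * ((1 + C * e) * l) + C * e ^ A * l * D :=
    ENNReal.toReal_le_of_le_ofReal (by positivity) hup'
  have hlow' : ENNReal.ofReal (K * ((1 - C * e) * l)) ≤
      ENNReal.ofReal (V.toReal + C * e ^ A * l * D) := by
    refine le_trans (le_of_eq ?_) (hlow.trans_eq ?_)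
    · rw [hKof, hlof, ← ENNReal.ofReal_mul' hl0, ← ENNReal.ofReal_mul hKpos.le]
    · rw [mul_assoc (_ * _), hDof, hlof, ← ENNReal.ofReal_mul hCe,
        ← ENNReal.ofReal_mul (by positivity),
        ENNReal.ofReal_add ENNReal.toReal_nonneg (by positivity), ← hVof]
  have hlow2 : K * ((1 - C * e) * l) ≤ V.toReal + C * e ^ A * l * D := by
    rwa [ENNReal.ofReal_le_ofReal_iff (by positivity)] at hlow'
  have hγ : w ^ volExp p q d = e ^ min 1 A := by
    rw [← hesq, ← Real.rpow_natCast, ← Real.rpow_mul hepos.le, volExp, ← hAdef]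
    congr 1
    push_cast
    ring
  have h1 : e ≤ e ^ min 1 A := by
    conv_lhs => rw [← Real.rpow_one e]
    exact Real.rpow_le_rpow_of_exponent_ge hepos he1 (min_le_left _ _)
  have h2 : e ^ A ≤ e ^ min 1 A :=
    Real.rpow_le_rpow_of_exponent_ge hepos he1 (min_le_right _ _)
  refine ⟨hVtop, ?_⟩
  rw [hγ, ← hl]
  have h3 : K * C * l * e ≤ K * C * l * e ^ min 1 A := by gcongr
  have h4 : C * l * D * e ^ A ≤ C * l * D * e ^ min 1 A := by gcongr
  have h5 : 0 ≤ l * e ^ min 1 A := by positivity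
  rw [abs_le]
  constructor <;> nlinarith

lemma F0_smul (p q d : ℕ) (r : ℝ) (z : Fin (p + q) → ℝ) :
    F0 p q d (r • z) = r ^ d * F0 p q d z := by
  simp only [F0, Finset.mul_sum, Pi.smul_apply, smul_eq_mul, mul_pow]
  exact Finset.sum_congr rfl fun i _ => by ring

lemma volume_level_region_scale {p q d : ℕ} {N : (Fin (p + q) → ℝ) → ℝ} {L c : ℝ}
    (hN : IsGauge N L c) {τ : ℝ} (hτ : 0 < τ) (J : Set ℝ) :
    volume {z | F0 p q d z ∈ J ∧ N z ≤ τ} = ENNReal.ofReal (τ ^ (p + q)) *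
      volume {z | F0 p q d z ∈ (τ ^ d * ·) ⁻¹' J ∧ N z ≤ 1} := by
  have h1 : (τ • ·) ⁻¹' {z | F0 p q d z ∈ J ∧ N z ≤ τ} =
      {z | F0 p q d z ∈ (τ ^ d * ·) ⁻¹' J ∧ N z ≤ 1} := by
    ext z
    simp only [Set.mem_preimage, Set.mem_ofPred_eq, F0_smul, hN.smul τ hτ.le,
      mul_le_iff_le_one_right hτ]
  rw [← h1, Measure.addHaar_preimage_smul _ hτ.ne', Module.finrank_fin_fun, ← mul_assoc,
    abs_of_pos (by positivity), ← ENNReal.ofReal_mul (by positivity),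
    mul_inv_cancel₀ (by positivity), ENNReal.ofReal_one, one_mul]

lemma exists_volume_asymp {p q d : ℕ} (hp : 1 ≤ p) (hq : 1 ≤ q) (hd0 : d ≠ 0) (hd : Even d)
    (hnd : d < p + q) {N : (Fin (p + q) → ℝ) → ℝ} {L c : ℝ} (hN : IsGauge N L c) :
    ∃ K > 0, ∃ C > 0, ∃ w0 > 0, ∀ τ w : ℝ, 0 < τ → 0 < w → w / τ ^ d ≤ w0 → ∀ J : Set ℝ,
      MeasurableSet J → J ⊆ Set.Icc (-w) w →
      volume {z | F0 p q d z ∈ J ∧ N z ≤ τ} ≠ ⊤ ∧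
      |(volume {z | F0 p q d z ∈ J ∧ N z ≤ τ}).toReal -
          K * (volume J).toReal * τ ^ (p + q - d)| ≤
        C * (volume J).toReal * τ ^ (p + q - d) * (w / τ ^ d) ^ volExp p q d := by
  obtain ⟨K, hK, C, hC, w0, hw0, h⟩ := exists_volume_unit_asymp hp hq hd0 hd hnd hN
  refine ⟨K, hK, C, hC, w0, hw0, fun τ w hτ hw hle J hJ hJw => ?_⟩
  have hτd : 0 < τ ^ d := by positivity
  obtain ⟨h1, h2⟩ := h (w / τ ^ d) (by positivity) hle ((τ ^ d * ·) ⁻¹' J)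
    (measurable_const_mul _ hJ) fun u hu => by
      have := hJw hu
      simp only [Set.mem_Icc] at this ⊢
      rw [le_div_iff₀ hτd, ← neg_div, div_le_iff₀ hτd]
      constructor <;> linarith
  rw [volume_level_region_scale hN hτ]
  refine ⟨ENNReal.mul_ne_top ENNReal.ofReal_ne_top h1, ?_⟩
  rw [Real.volume_preimage_mul_left hτd.ne', ENNReal.toReal_mul,
    abs_of_pos (inv_pos.mpr hτd), ENNReal.toReal_ofReal (by positivity)] at h2
  rw [ENNReal.toReal_mul, ENNReal.toReal_ofReal (by positivity)]
  obtain ⟨l, hl⟩ : ∃ l, l = (volume J).toReal := ⟨_, rfl⟩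
  rw [← hl] at h2 ⊢
  have hpow : τ ^ (p + q) = τ ^ (p + q - d) * τ ^ d := by
    rw [← pow_add]; congr 1; omega
  have h3 := mul_le_mul_of_nonneg_left h2 (show 0 ≤ τ ^ (p + q) by positivity)
  nth_rw 1 [← abs_of_nonneg (show 0 ≤ τ ^ (p + q) by positivity)] at h3
  rw [← abs_mul] at h3
  refine le_trans (le_of_eq ?_) (h3.trans_eq ?_)
  · rw [mul_sub, hpow]
    congr 2
    field_simp
  · rw [hpow]
    field_simp

lemma eucNorm_eq_norm {n : ℕ} (z : Fin n → ℝ) : eucNorm z = ‖WithLp.toLp 2 z‖ := by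
  simp [EuclideanSpace.norm_eq, eucNorm]

lemma eucNorm_nonneg {n : ℕ} (z : Fin n → ℝ) : 0 ≤ eucNorm z := Real.sqrt_nonneg _

lemma eucNorm_smul {n : ℕ} {r : ℝ} (hr : 0 ≤ r) (z : Fin n → ℝ) :
    eucNorm (r • z) = r * eucNorm z := by
  rw [eucNorm_eq_norm, WithLp.toLp_smul, norm_smul, Real.norm_of_nonneg hr, eucNorm_eq_norm]

lemma abs_eucNorm_sub_le {n : ℕ} (y z : Fin n → ℝ) : |eucNorm y - eucNorm z| ≤ eucNorm (y - z) := by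
  rw [eucNorm_eq_norm, eucNorm_eq_norm, eucNorm_eq_norm, WithLp.toLp_sub]
  exact abs_norm_sub_norm_le _ _

lemma norm_le_eucNorm {n : ℕ} (z : Fin n → ℝ) : ‖z‖ ≤ eucNorm z :=
  (pi_norm_le_iff_of_nonneg (eucNorm_nonneg z)).mpr fun i => by
    rw [eucNorm_eq_norm]
    exact PiLp.norm_apply_le (WithLp.toLp 2 z) i

lemma eucNorm_le {n : ℕ} (z : Fin n → ℝ) : eucNorm z ≤ n * ‖z‖ := by
  refine Real.sqrt_le_iff.mpr ⟨by positivity, ?_⟩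
  calc ∑ i, z i ^ 2 ≤ ∑ _i : Fin n, ‖z‖ ^ 2 := by
        refine Finset.sum_le_sum fun i _ => ?_
        rw [← sq_abs]
        gcongr
        exact norm_le_pi_norm z i
    _ = n * ‖z‖ ^ 2 := by simp
    _ ≤ n * (n * ‖z‖ ^ 2) := by
        rcases Nat.eq_zero_or_pos n with rfl | hn
        · simp
        · have : (1 : ℝ) ≤ n := by exact_mod_cast hn
          have h2 : 0 ≤ n * ‖z‖ ^ 2 := by positivity
          nlinarith
    _ = (n * ‖z‖) ^ 2 := by ring

lemma norm_vecMul_le {n : ℕ} {A : Matrix (Fin n) (Fin n) ℝ} {b : ℝ} (hb : ∀ i j, |A i j| ≤ b)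
    (hb0 : 0 ≤ b) (z : Fin n → ℝ) : ‖z ᵥ* A‖ ≤ n * b * ‖z‖ := by
  refine (pi_norm_le_iff_of_nonneg (by positivity)).mpr fun j => ?_
  refine (abs_vecMul_le z A (fun i => norm_le_pi_norm z i) j).trans ?_
  calc ‖z‖ * ∑ i, |A i j| ≤ ‖z‖ * ∑ _i : Fin n, b := by gcongr; exact hb _ _
    _ = n * b * ‖z‖ := by simp; ring

lemma exists_entry_bound {n : ℕ} (A : Fin n → Fin n → ℝ) : ∃ b : ℕ, ∀ i j, |A i j| ≤ b := by
  obtain ⟨b, hb⟩ := exists_nat_ge (∑ i, ∑ j, |A i j|)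
  refine ⟨b, fun i j => le_trans ?_ hb⟩
  exact (Finset.single_le_sum (f := fun j => |A i j|) (fun j _ => abs_nonneg _)
    (Finset.mem_univ j)).trans (Finset.single_le_sum (f := fun i => ∑ j, |A i j|)
    (fun i _ => Finset.sum_nonneg fun j _ => abs_nonneg _) (Finset.mem_univ i))

lemma isGauge_norm (n : ℕ) : IsGauge (fun z : Fin n → ℝ => ‖z‖) 1 1 where
  pos := one_pos
  nonneg := zero_le_one
  smul r hr z := by rw [norm_smul, Real.norm_of_nonneg hr]
  lip z z' := by rw [one_mul]; exact abs_norm_sub_norm_le z z'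
  lower z := by rw [one_mul]

lemma exists_isGauge_vecMul {n : ℕ} {A B : Matrix (Fin n) (Fin n) ℝ} (hAB : A * B = 1) :
    ∃ L c, IsGauge (fun z => eucNorm (z ᵥ* A)) L c := by
  obtain ⟨a, ha⟩ := exists_entry_bound A
  obtain ⟨b, hb⟩ := exists_entry_bound B
  have hpos : (0 : ℝ) < n * b + 1 := by positivity
  refine ⟨n * (n * a), (n * b + 1 : ℝ)⁻¹, by positivity, by positivity, fun r hr z => ?_,
    fun z z' => ?_, fun z => ?_⟩
  · rw [Matrix.smul_vecMul, eucNorm_smul hr]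
  · refine (abs_eucNorm_sub_le _ _).trans ?_
    rw [← Matrix.sub_vecMul, mul_assoc]
    exact (eucNorm_le _).trans (by gcongr; exact norm_vecMul_le ha a.cast_nonneg _)
  · rw [inv_mul_le_iff₀ hpos]
    have h1 := norm_vecMul_le hb b.cast_nonneg (z ᵥ* A)
    rw [Matrix.vecMul_vecMul, hAB, Matrix.vecMul_one] at h1
    refine h1.trans ?_
    have h2 := norm_le_eucNorm (z ᵥ* A)
    gcongr
    linarith

lemma cnt_congr_nmat {n : ℕ} (A : Set (Fin n → ℝ)) {g g' : RM n} (h : nmat g = nmat g') :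
    cnt A g = cnt A g' := by
  rw [cnt_eq_encard, cnt_eq_encard, h]

lemma nmat_rowsOf {n : ℕ} (h : SLR n) : nmat (rowsOf h) = h.1 := by
  rw [nmat, mdet_rowsOf, scl, Real.one_rpow, one_smul]
  rfl

/-- The matrices for which all but finitely many of the counting problems `A j k i` with
`i ∈ Idx j k` have a small discrepancy, for every large `j`. -/
def goodSet {n : ℕ} {ι : Type*} (Idx : ℕ → ℕ → Finset ι) (A : ℕ → ℕ → ι → Set (Fin n → ℝ))
    (r : ℕ → ℝ) : Set (RM n) :=
  {g | ∃ j0 : ℕ, ∀ j ≥ j0, ∀ᶠ k in atTop, ∀ i ∈ Idx j k,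
    ediff (cnt (A j k i) g) (volume (A j k i)) < ENNReal.ofReal (r k)}

lemma measurableSet_goodSet {n : ℕ} {ι : Type*} (Idx : ℕ → ℕ → Finset ι)
    {A : ℕ → ℕ → ι → Set (Fin n → ℝ)} (hA : ∀ j k i, MeasurableSet (A j k i)) (r : ℕ → ℝ) :
    MeasurableSet (goodSet Idx A r) := by
  have h : goodSet Idx A r = ⋃ j0 : ℕ, ⋂ j ≥ j0, ⋃ k0 : ℕ, ⋂ k ≥ k0, ⋂ i ∈ Idx j k,
      {g | ediff (cnt (A j k i) g) (volume (A j k i)) < ENNReal.ofReal (r k)} := by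
    ext g
    simp [goodSet, eventually_atTop]
  rw [h]
  refine MeasurableSet.iUnion fun j0 => MeasurableSet.iInter fun j => MeasurableSet.iInter fun _ =>
    MeasurableSet.iUnion fun k0 => MeasurableSet.iInter fun k => MeasurableSet.iInter fun _ =>
    Finset.measurableSet_biInter _ fun i _ => ?_
  exact measurableSet_lt (measurable_ediff_cnt (hA j k i) _) measurable_const

lemma ae_eventually_notMem_devSet {m : ℕ} {ι : Type*} (j : ℕ) (Idx : ℕ → Finset ι)
    {A : ℕ → ι → Set (Fin (m + 3) → ℝ)} (hA : ∀ k i, MeasurableSet (A k i)) {r : ℕ → ℝ}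
    (hr : ∀ k, 0 < r k) {C ρ : ℝ} (hρ0 : 0 ≤ ρ) (hρ : ρ < 1)
    (hb : ∀ᶠ k in atTop, ∃ B ≥ 0, (∀ i ∈ Idx k, volume (A k i) ≤ ENNReal.ofReal B) ∧
      (Idx k).card * B / r k ^ 2 ≤ C * ρ ^ k) :
    ∀ᵐ g, ∀ᶠ k in atTop, ∀ i ∈ Idx k, g ∉ devSet j (A k i) (r k) := by
  obtain ⟨k0, hk0⟩ := eventually_atTop.mp hb
  obtain ⟨V, hV⟩ : ∃ V, V = KKbound (m + 3) j * (varC m).toReal := ⟨_, rfl⟩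
  have hV0 : 0 ≤ V := by rw [hV]; positivity
  have hvar : varC m = ENNReal.ofReal (varC m).toReal :=
    (ENNReal.ofReal_toReal (varC_ne_top m)).symm
  have hE : ∀ k ≥ k0, volume (⋃ i ∈ Idx k, devSet j (A k i) (r k)) ≤
      ENNReal.ofReal (V * C * ρ ^ k) := by
    intro k hk
    obtain ⟨B, hB0, hB, hC⟩ := hk0 k hk
    refine (measure_biUnion_finset_le _ _).trans ?_
    have h1 : ∀ i ∈ Idx k, volume (devSet j (A k i) (r k)) ≤
        ENNReal.ofReal (V * B / r k ^ 2) := by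
      intro i hi
      have hrk := hr k
      refine (volume_devSet_le j (hA k i) (ne_top_of_le_ne_top ENNReal.ofReal_ne_top (hB i hi))
        hrk).trans ?_
      rw [ENNReal.ofReal_div_of_pos (by positivity), hV, mul_assoc,
        ENNReal.ofReal_mul (Nat.cast_nonneg _), ENNReal.ofReal_mul ENNReal.toReal_nonneg,
        ENNReal.ofReal_natCast, ← hvar]
      gcongr
      exact hB i hi
    refine (Finset.sum_le_sum h1).trans ?_
    rw [Finset.sum_const, nsmul_eq_mul, ← ENNReal.ofReal_natCast,
      ← ENNReal.ofReal_mul (Nat.cast_nonneg _)]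
    refine ENNReal.ofReal_le_ofReal ?_
    calc ((Idx k).card : ℝ) * (V * B / r k ^ 2) = V * ((Idx k).card * B / r k ^ 2) := by ring
      _ ≤ V * (C * ρ ^ k) := by gcongr
      _ = V * C * ρ ^ k := by ring
  have hsum : ∑' k, volume (⋃ i ∈ Idx (k + k0), devSet j (A (k + k0) i) (r (k + k0))) ≠ ⊤ := by
    have h2 : Summable fun k : ℕ => |V * C| * ρ ^ (k + k0) :=
      ((summable_nat_add_iff k0).mpr (summable_geometric_of_lt_one hρ0 hρ)).mul_left _
    refine ne_top_of_le_ne_top h2.tsum_ofReal_ne_top (ENNReal.tsum_le_tsum fun k => ?_)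
    refine (hE (k + k0) (Nat.le_add_left _ _)).trans (ENNReal.ofReal_le_ofReal ?_)
    gcongr
    exact le_abs_self _
  filter_upwards [ae_eventually_notMem hsum] with g hg
  have h3 := (eventually_atTop.mp hg)
  obtain ⟨k1, hk1⟩ := h3
  refine eventually_atTop.mpr ⟨k1 + k0, fun k hk i hi hmem => ?_⟩
  refine hk1 (k - k0) (by omega) ?_
  rw [Nat.sub_add_cancel (by omega)]
  exact Set.mem_biUnion hi hmem

lemma ae_haar_mem_goodSet {n : ℕ} (hn : 3 ≤ n) (μ : Measure (SLR n)) [μ.IsHaarMeasure]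
    {ι : Type*} (Idx : ℕ → ℕ → Finset ι) {A : ℕ → ℕ → ι → Set (Fin n → ℝ)}
    (hA : ∀ j k i, MeasurableSet (A j k i)) {r : ℕ → ℝ} (hr : ∀ k, 0 < r k) {ρ : ℝ}
    (hρ0 : 0 ≤ ρ) (hρ : ρ < 1)
    (hb : ∀ j, ∃ C : ℝ, ∀ᶠ k in atTop, ∃ B ≥ 0,
      (∀ i ∈ Idx j k, volume (A j k i) ≤ ENNReal.ofReal B) ∧
      (Idx j k).card * B / r k ^ 2 ≤ C * ρ ^ k) :
    ∀ᵐ h ∂μ, rowsOf h ∈ goodSet Idx A r := by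
  obtain ⟨m, rfl⟩ : ∃ m, n = m + 3 := ⟨n - 3, by omega⟩
  refine ae_haar_of_ae_DD μ (measurableSet_goodSet Idx hA r) (fun g _ h hh => ?_) ?_
  · have : ∀ j k i, cnt (A j k i) (rowsOf h) = cnt (A j k i) g := fun j k i =>
      cnt_congr_nmat _ ((nmat_rowsOf h).trans hh)
    simp only [goodSet, Set.mem_ofPred_eq, this]
  · have h1 : ∀ᵐ g : RM (m + 3), ∀ j, ∀ᶠ k in atTop, ∀ i ∈ Idx j k,
        g ∉ devSet j (A j k i) (r k) := by
      refine ae_all_iff.mpr fun j => ?_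
      obtain ⟨C, hC⟩ := hb j
      exact ae_eventually_notMem_devSet j (Idx j) (hA j) hr hρ0 hρ hC
    refine measure_mono_null (fun g hg => ?_) h1
    intro hgood
    obtain ⟨b, hb⟩ := exists_entry_bound g
    refine hg.2 ⟨b, fun j hj => (hgood j).mono fun k hk i hi => ?_⟩
    by_contra hlt
    push Not at hlt
    refine hk i hi ⟨⟨hg.1, fun a c => (hb a c).trans ?_⟩, hlt⟩
    exact_mod_cast hj

/-- The `i`-th interval of the partition of `ℝ` with mesh `δ`. -/
def gridIco (δ : ℝ) (i : ℤ) : Set ℝ := Set.Ico (i * δ) ((i + 1) * δ)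

lemma volume_gridIco (δ : ℝ) (i : ℤ) : volume (gridIco δ i) = ENNReal.ofReal δ := by
  rw [gridIco, Real.volume_Ico]
  congr 1
  ring

lemma measurableSet_gridIco (δ : ℝ) (i : ℤ) : MeasurableSet (gridIco δ i) := measurableSet_Ico

/-- The matrix with entries `ε * m a b`. -/
def netMat {n : ℕ} (ε : ℝ) (m : Fin n → Fin n → ℤ) : Matrix (Fin n) (Fin n) ℝ :=
  Matrix.of fun a b => ε * m a b

/-- The part of the level region `F₀ ∈ J` where `‖z s‖ ≤ T` and `|z|_∞ ≤ R`. -/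
def levelRegion (p q d : ℕ) (J : Set ℝ) (s : Matrix (Fin (p + q)) (Fin (p + q)) ℝ) (T R : ℝ) :
    Set (Fin (p + q) → ℝ) :=
  {z | F0 p q d z ∈ J ∧ eucNorm (z ᵥ* s) ≤ T ∧ ‖z‖ ≤ R}

lemma continuous_eucNorm_vecMul {n : ℕ} (s : Matrix (Fin n) (Fin n) ℝ) :
    Continuous fun z : Fin n → ℝ => eucNorm (z ᵥ* s) := by
  have h : Continuous fun z : Fin n → ℝ => z ᵥ* s := continuous_id.matrix_vecMul continuous_const
  exact Real.continuous_sqrt.comp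
    (continuous_finsetSum _ fun i _ => ((continuous_apply i).comp h).pow 2)

lemma measurableSet_levelRegion (p q d : ℕ) {J : Set ℝ} (hJ : MeasurableSet J)
    (s : Matrix (Fin (p + q)) (Fin (p + q)) ℝ) (T R : ℝ) :
    MeasurableSet (levelRegion p q d J s T R) := by
  have h1 : MeasurableSet {z | F0 p q d z ∈ J} := (continuous_F0 p q d).measurable hJ
  have h2 : MeasurableSet {z : Fin (p + q) → ℝ | eucNorm (z ᵥ* s) ≤ T} :=
    (isClosed_le (continuous_eucNorm_vecMul s) continuous_const).measurableSet
  have h3 : MeasurableSet {z : Fin (p + q) → ℝ | ‖z‖ ≤ R} :=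
    (isClosed_le continuous_norm continuous_const).measurableSet
  exact h1.inter (h2.inter h3)

/-- Indices of grid intervals meeting `[-c T ^ η, c T ^ η]`, paired with net matrices with entries
at most `j` in absolute value. -/
def gridIdx (n : ℕ) (η κ ν c : ℝ) (j k : ℕ) : Finset (ℤ × (Fin n → Fin n → ℤ)) :=
  Finset.Icc (-(⌈c * ((2 : ℝ) ^ k) ^ (η + κ + ν)⌉₊ : ℤ)) ⌈c * ((2 : ℝ) ^ k) ^ (η + κ + ν)⌉₊ ×ˢ
    Fintype.piFinset fun _ => Fintype.piFinset fun _ =>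
      Finset.Icc (-(⌈j * ((2 : ℝ) ^ k) ^ ν⌉₊ : ℤ)) ⌈j * ((2 : ℝ) ^ k) ^ ν⌉₊

/-- The family of regions used to approximate all counting problems at scale `2 ^ k`. -/
def gridRegion (p q d : ℕ) (κ ν : ℝ) (j k : ℕ) (i : ℤ × (Fin (p + q) → Fin (p + q) → ℤ)) :
    Set (Fin (p + q) → ℝ) :=
  levelRegion p q d (gridIco (((2 : ℝ) ^ k) ^ (-(κ + ν))) i.1)
    (netMat (((2 : ℝ) ^ k) ^ (-ν)) i.2) (2 ^ k) ((j + 1) * 2 ^ k)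

lemma card_gridIdx_le (n : ℕ) {η κ ν c : ℝ} (hη : 0 ≤ η) (hκ : 0 ≤ κ) (hν : 0 ≤ ν) (hc : 0 ≤ c)
    (j k : ℕ) :
    ((gridIdx n η κ ν c j k).card : ℝ) ≤ ((2 * c + 3) * (2 * j + 3) ^ (n ^ 2)) *
      ((2 : ℝ) ^ k) ^ (η + κ + ν + n ^ 2 * ν) := by
  obtain ⟨T, hT⟩ : ∃ T, T = (2 : ℝ) ^ k := ⟨_, rfl⟩
  have hT1 : 1 ≤ T := hT ▸ one_le_pow₀ one_le_two
  have hT0 : 0 < T := one_pos.trans_le hT1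
  have key : ∀ (a x : ℝ), 0 ≤ a → 0 ≤ x →
      2 * (⌈a * T ^ x⌉₊ : ℝ) + 1 ≤ (2 * a + 3) * T ^ x := by
    intro a x ha hx
    have h1 := Nat.ceil_lt_add_one (show 0 ≤ a * T ^ x by positivity)
    have h2 := Real.one_le_rpow hT1 hx
    nlinarith
  have hcard : ∀ M : ℕ, (Finset.Icc (-(M : ℤ)) M).card = 2 * M + 1 := by
    intro M
    rw [Int.card_Icc]
    omega
  rw [gridIdx, Finset.card_product, ← hT, hcard]
  simp only [Fintype.card_piFinset, hcard, Finset.prod_const, Finset.card_univ, Fintype.card_fin]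
  push_cast
  have hpow : T ^ (η + κ + ν + n ^ 2 * ν) = T ^ (η + κ + ν) * (T ^ ν) ^ (n ^ 2) := by
    rw [Real.rpow_add hT0, mul_comm ((n : ℝ) ^ 2) ν, Real.rpow_mul hT0.le, ← Nat.cast_pow,
      Real.rpow_natCast]
  rw [← pow_mul, ← sq, hpow, mul_mul_mul_comm, ← mul_pow]
  gcongr
  · exact key c _ hc (by positivity)
  · exact key j ν (Nat.cast_nonneg j) hν

lemma gridIco_subset {T η κ ν c : ℝ} (hT : 1 ≤ T) (hη : 0 ≤ η) (hκν : 0 ≤ κ + ν) (hc : 0 ≤ c)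
    {i : ℤ} (hi : |i| ≤ ⌈c * T ^ (η + κ + ν)⌉₊) :
    gridIco (T ^ (-(κ + ν))) i ⊆ Set.Icc (-((c + 2) * T ^ η)) ((c + 2) * T ^ η) := by
  have hT0 : 0 < T := one_pos.trans_le hT
  have h1 := Nat.ceil_lt_add_one (show 0 ≤ c * T ^ (η + κ + ν) by positivity)
  have h2 : |(i : ℝ)| ≤ ⌈c * T ^ (η + κ + ν)⌉₊ := by exact_mod_cast hi
  have h3 : T ^ (-(κ + ν)) ≤ 1 := Real.rpow_le_one_of_one_le_of_nonpos hT (by linarith)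
  have h4 : 1 ≤ T ^ η := Real.one_le_rpow hT hη
  have h5 : T ^ (η + κ + ν) * T ^ (-(κ + ν)) = T ^ η := by
    rw [← Real.rpow_add hT0]; congr 1; ring
  obtain ⟨δ, hδ⟩ : ∃ δ, δ = T ^ (-(κ + ν)) := ⟨_, rfl⟩
  have hδ0 : 0 < δ := hδ ▸ by positivity
  rw [← hδ] at h3 h5 ⊢
  obtain ⟨h6, h7⟩ := abs_le.mp h2
  intro x hx
  have h8 : (i : ℝ) * δ ≤ (c * T ^ (η + κ + ν) + 1) * δ := by gcongr; linarith
  have h9 : -(c * T ^ (η + κ + ν) + 1) * δ ≤ i * δ := by gcongr; linarith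
  have h10 : c * T ^ (η + κ + ν) * δ = c * T ^ η := by rw [mul_assoc, h5]
  constructor <;> nlinarith [hx.1, hx.2]

lemma tendsto_two_pow_rpow_neg {x : ℝ} (hx : 0 < x) :
    Tendsto (fun k : ℕ => ((2 : ℝ) ^ k) ^ (-x)) atTop (nhds 0) :=
  (tendsto_rpow_neg_atTop hx).comp (tendsto_pow_atTop_atTop_of_one_lt one_lt_two)

lemma gridRegion_summable_bound {p q d : ℕ} (hp : 1 ≤ p) (hq : 1 ≤ q) (hd0 : d ≠ 0) (hd : Even d)
    (hnd : d < p + q) {η κ ν c : ℝ} (hη : 0 ≤ η) (hηd : η < d) (hκ : 0 ≤ κ) (hν : 0 ≤ ν)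
    (hc : 0 ≤ c) (j : ℕ) :
    ∃ C : ℝ, ∀ᶠ k : ℕ in atTop, ∃ B ≥ 0,
      (∀ i ∈ gridIdx (p + q) η κ ν c j k,
        volume (gridRegion p q d κ ν j k i) ≤ ENNReal.ofReal B) ∧
      (gridIdx (p + q) η κ ν c j k).card * B /
        (((2 : ℝ) ^ k) ^ ((p + q : ℝ) - d - κ - 2 * ν)) ^ 2 ≤
        C * ((2 : ℝ) ^ (-((p + q : ℝ) - d - η - 2 * κ - ((p + q : ℝ) ^ 2 + 4) * ν))) ^ k := by
  obtain ⟨K, hK, C, hC, w0, hw0, h⟩ := exists_volume_asymp hp hq hd0 hd hnd (isGauge_norm (p + q))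
  have ha : ((p + q - d : ℕ) : ℝ) = (p + q : ℝ) - d := by
    rw [Nat.cast_sub hnd.le]; push_cast; ring
  obtain ⟨D, hD⟩ : ∃ D, D = (K + C * w0 ^ volExp p q d) * (j + 1 : ℝ) ^ (p + q - d) := ⟨_, rfl⟩
  have hD0 : 0 ≤ D := by rw [hD]; positivity
  refine ⟨((2 * c + 3) * (2 * j + 3) ^ ((p + q) ^ 2)) * D, ?_⟩
  have hlim := (tendsto_two_pow_rpow_neg (sub_pos.mpr hηd)).const_mul (c + 2)
  rw [mul_zero] at hlim
  filter_upwards [hlim.eventually_le_const hw0] with k hk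
  have hcard := card_gridIdx_le (p + q) hη hκ hν hc j k
  rw [Real.rpow_pow_comm two_pos.le]
  simp only [gridIdx, gridRegion, Finset.mem_product, Finset.mem_Icc] at hcard ⊢
  obtain ⟨T, hT⟩ : ∃ T, T = (2 : ℝ) ^ k := ⟨_, rfl⟩
  have hT1 : 1 ≤ T := hT ▸ one_le_pow₀ one_le_two
  have hT0 : 0 < T := one_pos.trans_le hT1
  rw [← hT] at hk hcard ⊢
  refine ⟨D * T ^ ((p + q : ℝ) - d - κ - ν), by positivity, fun i hi => ?_, ?_⟩
  · have hδ : 0 < T ^ (-(κ + ν)) := by positivity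
    obtain ⟨τ, hτ⟩ : ∃ τ, τ = (j + 1 : ℝ) * T := ⟨_, rfl⟩
    have hTτ : T ≤ τ := by
      rw [hτ]
      exact le_mul_of_one_le_left hT0.le (by linarith [(Nat.cast_nonneg j : (0 : ℝ) ≤ j)])
    have hτ0 : 0 < τ := hT0.trans_le hTτ
    have hw : (c + 2) * T ^ η / τ ^ d ≤ w0 := by
      refine le_trans ?_ hk
      rw [neg_sub, Real.rpow_sub hT0, Real.rpow_natCast, ← mul_div_assoc]
      gcongr
    obtain ⟨h1, h2⟩ := h τ ((c + 2) * T ^ η) hτ0 (by positivity) hw _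
      (measurableSet_gridIco (T ^ (-(κ + ν))) i.1)
      (gridIco_subset hT1 hη (by positivity) hc (abs_le.mpr hi.1))
    rw [volume_gridIco, ENNReal.toReal_ofReal hδ.le] at h2
    refine (measure_mono (t := {z | F0 p q d z ∈ gridIco (T ^ (-(κ + ν))) i.1 ∧ ‖z‖ ≤ τ})
      fun z hz => ⟨hz.1, hτ ▸ hz.2.2⟩).trans ?_
    rw [ENNReal.le_ofReal_iff_toReal_le h1 (by positivity)]
    have h3 : C * T ^ (-(κ + ν)) * τ ^ (p + q - d) * ((c + 2) * T ^ η / τ ^ d) ^ volExp p q d ≤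
        C * T ^ (-(κ + ν)) * τ ^ (p + q - d) * w0 ^ volExp p q d := by
      have := (volExp_pos hd0 hnd).le
      gcongr
    have h4 : D * T ^ ((p + q : ℝ) - d - κ - ν) =
        (K + C * w0 ^ volExp p q d) * T ^ (-(κ + ν)) * τ ^ (p + q - d) := by
      rw [hD, hτ, mul_pow, ← Real.rpow_natCast T, ha,
        show (p + q : ℝ) - d - κ - ν = -(κ + ν) + ((p + q : ℝ) - d) by ring, Real.rpow_add hT0]
      ring
    rw [h4]
    linarith [(abs_le.mp h2).2]
  · rw [div_le_iff₀ (by positivity)]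
    calc _ ≤ ((2 * c + 3) * (2 * j + 3) ^ ((p + q) ^ 2) *
          T ^ (η + κ + ν + (p + q : ℕ) ^ 2 * ν)) * (D * T ^ ((p + q : ℝ) - d - κ - ν)) := by
          gcongr
      _ = _ := by
          rw [sq (T ^ _), ← Real.rpow_add hT0]
          rw [mul_assoc _ (T ^ _) (_ * _), ← mul_assoc (T ^ _) D, mul_comm (T ^ _) D,
            mul_assoc D, ← Real.rpow_add hT0, mul_assoc (_ * D) (T ^ _), ← Real.rpow_add hT0,
            mul_assoc (_ * _) D]
          congr 3
          push_cast
          ring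

/-- The counting measure of the nonzero vectors of the lattice `ℤⁿ h`. -/
def latticeMeasure {n : ℕ} (h : SLR n) : Measure (Fin n → ℝ) :=
  Measure.sum fun v : {v : Fin n → ℤ // v ≠ 0} => Measure.dirac (intVec v.1 ᵥ* h.1)

lemma latticeMeasure_apply {n : ℕ} (h : SLR n) {A : Set (Fin n → ℝ)} (hA : MeasurableSet A) :
    latticeMeasure h A = cnt A (rowsOf h) := by
  rw [latticeMeasure, Measure.sum_apply _ hA, cnt]
  refine tsum_congr fun v => ?_
  rw [Measure.dirac_apply' _ hA, nind, scl_smul_vact, nmat_rowsOf]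

lemma latticeMeasure_eq_encard {n : ℕ} (h : SLR n) {A : Set (Fin n → ℝ)} (hA : MeasurableSet A) :
    latticeMeasure h A = {v : Fin n → ℤ | v ≠ 0 ∧ intVec v ᵥ* h.1 ∈ A}.encard := by
  rw [latticeMeasure_apply h hA, cnt_eq_encard, nmat_rowsOf]

lemma abs_toReal_sub_le_of_ediff {a b : ℝ≥0∞} (hb : b ≠ ⊤) {r : ℝ}
    (h : ediff a b < ENNReal.ofReal r) : a ≠ ⊤ ∧ |a.toReal - b.toReal| ≤ r := by
  have h1 : a - b < ENNReal.ofReal r := lt_of_le_of_lt le_self_add h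
  have h2 : b - a < ENNReal.ofReal r := lt_of_le_of_lt le_add_self h
  have hr : 0 < r := by
    by_contra hr
    rw [ENNReal.ofReal_of_nonpos (not_lt.mp hr)] at h1
    exact not_lt_zero h1
  have h3 : a ≤ ENNReal.ofReal r + b := tsub_le_iff_right.mp h1.le
  have h4 : b ≤ ENNReal.ofReal r + a := tsub_le_iff_right.mp h2.le
  have ha : a ≠ ⊤ := ne_top_of_le_ne_top (ENNReal.add_ne_top.mpr ⟨ENNReal.ofReal_ne_top, hb⟩) h3
  have h5 := ENNReal.toReal_mono (ENNReal.add_ne_top.mpr ⟨ENNReal.ofReal_ne_top, hb⟩) h3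
  have h6 := ENNReal.toReal_mono (ENNReal.add_ne_top.mpr ⟨ENNReal.ofReal_ne_top, ha⟩) h4
  rw [ENNReal.toReal_add ENNReal.ofReal_ne_top hb, ENNReal.toReal_ofReal hr.le] at h5
  rw [ENNReal.toReal_add ENNReal.ofReal_ne_top ha, ENNReal.toReal_ofReal hr.le] at h6
  exact ⟨ha, abs_le.mpr ⟨by linarith, by linarith⟩⟩

lemma abs_latticeMeasure_biUnion_sub_le {n : ℕ} {ι : Type*} (h : SLR n) (S : Finset ι)
    {A : ι → Set (Fin n → ℝ)} (hA : ∀ i ∈ S, MeasurableSet (A i))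
    (hdisj : Set.PairwiseDisjoint (S : Set ι) A) (hv : ∀ i ∈ S, volume (A i) ≠ ⊤) {r : ℝ}
    (hr : ∀ i ∈ S, ediff (cnt (A i) (rowsOf h)) (volume (A i)) < ENNReal.ofReal r) :
    latticeMeasure h (⋃ i ∈ S, A i) ≠ ⊤ ∧
      |(latticeMeasure h (⋃ i ∈ S, A i)).toReal - (volume (⋃ i ∈ S, A i)).toReal| ≤
        S.card * r := by
  have h1 : ∀ i ∈ S, latticeMeasure h (A i) ≠ ⊤ ∧
      |(latticeMeasure h (A i)).toReal - (volume (A i)).toReal| ≤ r := fun i hi => by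
    rw [latticeMeasure_apply h (hA i hi)]
    exact abs_toReal_sub_le_of_ediff (hv i hi) (hr i hi)
  rw [measure_biUnion_finset hdisj hA, measure_biUnion_finset hdisj hA]
  refine ⟨ENNReal.sum_ne_top.mpr fun i hi => (h1 i hi).1, ?_⟩
  rw [ENNReal.toReal_sum fun i hi => (h1 i hi).1, ENNReal.toReal_sum hv, ← Finset.sum_sub_distrib]
  refine (Finset.abs_sum_le_sum_abs _ _).trans ?_
  rw [← nsmul_eq_mul]
  exact Finset.sum_le_card_nsmul _ _ _ fun i hi => (h1 i hi).2

lemma finite_eucNorm_le (n : ℕ) (t : ℝ) : {v : Fin n → ℤ | eucNorm (intVec v) ≤ t}.Finite :=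
  (finite_intVec_bounded t).subset fun v hv i =>
    (norm_le_pi_norm (intVec v) i).trans ((norm_le_eucNorm _).trans hv)

lemma NF_le_latticeMeasure {p q d : ℕ} (h : SLR (p + q)) {I : Set ℝ} {t : ℝ}
    {A : Set (Fin (p + q) → ℝ)} (hA : MeasurableSet A) (hfin : latticeMeasure h A ≠ ⊤)
    (hsub : ∀ v : Fin (p + q) → ℝ, F0 p q d (v ᵥ* h.1) ∈ I → eucNorm v ≤ t → v ᵥ* h.1 ∈ A) :
    (NF p q d h I t : ℝ) ≤ (latticeMeasure h A).toReal + 1 := by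
  rw [latticeMeasure_eq_encard h hA] at hfin ⊢
  obtain ⟨S, hS⟩ : ∃ S, S = {v : Fin (p + q) → ℤ | v ≠ 0 ∧ intVec v ᵥ* h.1 ∈ A} := ⟨_, rfl⟩
  rw [← hS] at hfin ⊢
  have hSfin : S.Finite := by
    rw [← Set.encard_ne_top_iff]
    intro h1
    rw [h1] at hfin
    exact hfin rfl
  have h2 : ((S.encard : ℝ≥0∞)).toReal = S.ncard := by
    rw [← hSfin.cast_ncard_eq]
    simp
  rw [h2, NF]
  have h3 : Nat.card {v : Fin (p + q) → ℤ | Fg p q d h (intVec v) ∈ I ∧ eucNorm (intVec v) ≤ t} ≤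
      (insert 0 S).ncard := by
    rw [Nat.card_coe_set_eq]
    refine Set.ncard_le_ncard (fun v hv => ?_) (hSfin.insert 0)
    by_cases h0 : v = 0
    · exact Or.inl h0
    · exact Or.inr (hS ▸ ⟨h0, hsub _ hv.1 hv.2⟩)
  exact_mod_cast h3.trans (Set.ncard_insert_le 0 S)

lemma latticeMeasure_le_NF {p q d : ℕ} (h : SLR (p + q)) {I : Set ℝ} {t : ℝ}
    {A : Set (Fin (p + q) → ℝ)} (hA : MeasurableSet A)
    (hsub : ∀ v : Fin (p + q) → ℝ, v ᵥ* h.1 ∈ A → F0 p q d (v ᵥ* h.1) ∈ I ∧ eucNorm v ≤ t) :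
    (latticeMeasure h A).toReal ≤ NF p q d h I t := by
  rw [latticeMeasure_eq_encard h hA]
  have hsub' : {v : Fin (p + q) → ℤ | v ≠ 0 ∧ intVec v ᵥ* h.1 ∈ A} ⊆
      {v : Fin (p + q) → ℤ | Fg p q d h (intVec v) ∈ I ∧ eucNorm (intVec v) ≤ t} :=
    fun v hv => hsub _ hv.2
  have hfin : {v : Fin (p + q) → ℤ | Fg p q d h (intVec v) ∈ I ∧ eucNorm (intVec v) ≤ t}.Finite :=
    (finite_eucNorm_le _ t).subset fun v hv => hv.2
  rw [← (hfin.subset hsub').cast_ncard_eq, NF, Nat.card_coe_set_eq]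
  simpa using Set.ncard_le_ncard hsub' hfin

lemma exists_netMat {n : ℕ} {H B : Matrix (Fin n) (Fin n) ℝ} (hBH : B * H = 1) {b : ℕ}
    (hH : ∀ i j, |H i j| ≤ b) (hB : ∀ i j, |B i j| ≤ b) {ε φ : ℝ} (hε : 0 < ε) (hε1 : ε ≤ 1)
    (hφ : 0 ≤ φ) (hφ2 : φ ≤ 2) :
    ∃ m : Fin n → Fin n → ℤ, (∀ i j, |(m i j : ℝ)| ≤ (2 * b + 1) * ε⁻¹) ∧
      ∀ z, |eucNorm (z ᵥ* netMat ε m) - φ * eucNorm (z ᵥ* B)| ≤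
        n ^ 3 * b * ε * eucNorm (z ᵥ* B) := by
  refine ⟨fun i j => ⌊φ * B i j / ε⌋, fun i j => ?_, fun z => ?_⟩
  · have h1 : |φ * B i j / ε| ≤ 2 * b / ε := by
      rw [abs_div, abs_mul, abs_of_nonneg hφ, abs_of_pos hε]
      have := hB i j
      gcongr
    have h2 : |(⌊φ * B i j / ε⌋ : ℝ)| ≤ |φ * B i j / ε| + 1 := by
      have h3 := Int.floor_le (φ * B i j / ε)
      have h4 := Int.lt_floor_add_one (φ * B i j / ε)
      have h5 := abs_le.mp (le_refl |φ * B i j / ε|)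
      exact abs_le.mpr ⟨by linarith, by linarith⟩
    have h6 : 1 ≤ ε⁻¹ := (one_le_inv₀ hε).mpr hε1
    rw [add_mul, one_mul, ← div_eq_mul_inv]
    linarith
  · obtain ⟨E, hE⟩ : ∃ E, E = netMat ε (fun i j => ⌊φ * B i j / ε⌋) - φ • B := ⟨_, rfl⟩
    have hEb : ∀ i j, |E i j| ≤ ε := by
      intro i j
      have h3 := Int.floor_le (φ * B i j / ε)
      have h4 := Int.lt_floor_add_one (φ * B i j / ε)
      rw [le_div_iff₀ hε] at h3
      rw [div_lt_iff₀ hε] at h4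
      simp only [hE, netMat, Matrix.sub_apply, Matrix.of_apply, Matrix.smul_apply, smul_eq_mul]
      exact abs_le.mpr ⟨by linarith, by linarith⟩
    have hz : z = z ᵥ* B ᵥ* H := by rw [Matrix.vecMul_vecMul, hBH, Matrix.vecMul_one]
    have h1 : eucNorm (z ᵥ* E) ≤ n ^ 3 * b * ε * eucNorm (z ᵥ* B) := by
      calc eucNorm (z ᵥ* E) ≤ n * ‖z ᵥ* E‖ := eucNorm_le _
        _ ≤ n * (n * ε * ‖z‖) := by gcongr; exact norm_vecMul_le hEb hε.le z
        _ ≤ n * (n * ε * (n * b * ‖z ᵥ* B‖)) := by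
            gcongr
            conv_lhs => rw [hz]
            exact norm_vecMul_le hH b.cast_nonneg _
        _ ≤ n * (n * ε * (n * b * eucNorm (z ᵥ* B))) := by gcongr; exact norm_le_eucNorm _
        _ = n ^ 3 * b * ε * eucNorm (z ᵥ* B) := by ring
    refine le_trans ?_ h1
    rw [← eucNorm_smul hφ, ← Matrix.vecMul_smul, hE, Matrix.vecMul_sub]
    exact abs_eucNorm_sub_le _ _

lemma exists_volume_approx {p q d : ℕ} (hp : 1 ≤ p) (hq : 1 ≤ q) (hd0 : d ≠ 0) (hd : Even d)
    (hnd : d < p + q) {N : (Fin (p + q) → ℝ) → ℝ} {L c : ℝ} (hN : IsGauge N L c)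
    {η ν c₂ c₃ : ℝ} (hηd : η < d) (hν0 : 0 ≤ ν) (hν : ν ≤ (d - η) * volExp p q d) (hc₂ : 0 ≤ c₂)
    (hc₃ : 0 < c₃) :
    ∃ K > 0, ∃ C > 0, ∀ᶠ t : ℝ in atTop, ∀ l τ : ℝ, 0 ≤ l → t / 2 ≤ τ → τ ≤ 2 * t →
      |τ - t| ≤ c₂ * t ^ (-ν) * t → ∀ J : Set ℝ, MeasurableSet J →
      J ⊆ Set.Icc (-(c₃ * t ^ η)) (c₃ * t ^ η) → |(volume J).toReal - l| ≤ c₂ * t ^ (-ν) * l →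
      volume {z | F0 p q d z ∈ J ∧ N z ≤ τ} ≠ ⊤ ∧
      |(volume {z | F0 p q d z ∈ J ∧ N z ≤ τ}).toReal - K * l * t ^ (p + q - d)| ≤
        C * l * t ^ (p + q - d) * t ^ (-ν) := by
  obtain ⟨K, hK, C, hC, w0, hw0, h⟩ := exists_volume_asymp hp hq hd0 hd hnd hN
  have hγ := volExp_pos hd0 hnd
  obtain ⟨a, ha⟩ : ∃ a, a = p + q - d := ⟨_, rfl⟩
  rw [← ha] at h ⊢
  obtain ⟨D, hD⟩ : ∃ D, D = (c₃ * 2 ^ d) ^ volExp p q d := ⟨_, rfl⟩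
  have hD0 : 0 < D := by rw [hD]; positivity
  refine ⟨K, hK, C * ((1 + c₂) * 2 ^ a * D) + K * (c₂ * 2 ^ a) + K * (c₂ * (a * 2 ^ (a - 1))),
    by positivity, ?_⟩
  have hlim := (tendsto_rpow_neg_atTop (sub_pos.mpr hηd)).const_mul (c₃ * 2 ^ d)
  rw [mul_zero] at hlim
  filter_upwards [hlim.eventually_le_const hw0, eventually_ge_atTop 1] with t ht1 ht l τ hl hτ1 hτ2
    hτ J hJ hJw hJl
  have ht0 : 0 < t := one_pos.trans_le ht
  have hτ0 : 0 < τ := (half_pos ht0).trans_le hτ1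
  obtain ⟨u, hu⟩ : ∃ u, u = t ^ (-ν) := ⟨_, rfl⟩
  have hu0 : 0 < u := by rw [hu]; positivity
  have hu1 : u ≤ 1 := hu ▸ Real.rpow_le_one_of_one_le_of_nonpos ht (by linarith)
  rw [← hu] at hτ hJl ⊢
  have hwle : c₃ * t ^ η / τ ^ d ≤ c₃ * 2 ^ d * t ^ (-(d - η)) := by
    rw [neg_sub, Real.rpow_sub ht0, Real.rpow_natCast, div_le_iff₀ (by positivity)]
    have h1 : t ^ d ≤ (2 * τ) ^ d := by
      gcongr
      linarith
    calc c₃ * t ^ η = c₃ * (t ^ η / t ^ d) * t ^ d := by field_simp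
      _ ≤ c₃ * (t ^ η / t ^ d) * (2 * τ) ^ d := by gcongr
      _ = _ := by rw [mul_pow]; ring
  obtain ⟨h1, h2⟩ := h τ (c₃ * t ^ η) hτ0 (by positivity) (hwle.trans ht1) J hJ hJw
  refine ⟨h1, ?_⟩
  obtain ⟨x, hx⟩ : ∃ x, x = (volume J).toReal := ⟨_, rfl⟩
  have hx0 : 0 ≤ x := hx ▸ ENNReal.toReal_nonneg
  rw [← hx] at h2 hJl
  have h3 : (c₃ * t ^ η / τ ^ d) ^ volExp p q d ≤ D * u := by
    calc _ ≤ (c₃ * 2 ^ d * t ^ (-(d - η))) ^ volExp p q d := by gcongr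
      _ = D * t ^ (-((d - η) * volExp p q d)) := by
          rw [Real.mul_rpow (by positivity) (by positivity), ← Real.rpow_mul ht0.le, hD, neg_mul]
      _ ≤ D * u := by
          rw [hu]
          gcongr
  have hxl : x ≤ (1 + c₂) * l := by
    have : c₂ * u * l ≤ c₂ * 1 * l := by gcongr
    linarith [(abs_le.mp hJl).2]
  have hτa : τ ^ a ≤ 2 ^ a * t ^ a := by
    rw [← mul_pow]
    gcongr
  have e1 : |(volume {z | F0 p q d z ∈ J ∧ N z ≤ τ}).toReal - K * x * τ ^ a| ≤
      C * ((1 + c₂) * 2 ^ a * D) * l * t ^ a * u := by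
    calc _ ≤ _ := h2
      _ ≤ C * ((1 + c₂) * l) * (2 ^ a * t ^ a) * (D * u) := by gcongr
      _ = _ := by ring
  have e2 : |K * x * τ ^ a - K * l * τ ^ a| ≤ K * (c₂ * 2 ^ a) * l * t ^ a * u := by
    calc |K * x * τ ^ a - K * l * τ ^ a| = K * |x - l| * τ ^ a := by
          rw [← sub_mul, ← mul_sub, abs_mul, abs_mul, abs_of_pos hK, abs_of_pos (pow_pos hτ0 a)]
      _ ≤ K * (c₂ * u * l) * (2 ^ a * t ^ a) := by gcongr
      _ = _ := by ring
  have e3 : |K * l * τ ^ a - K * l * t ^ a| ≤ K * (c₂ * (a * 2 ^ (a - 1))) * l * t ^ a * u := by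
    have h4 := abs_pow_sub_pow_le τ t a
    rw [abs_of_pos hτ0, abs_of_pos ht0] at h4
    have h5 : max τ t ≤ 2 * t := max_le hτ2 (by linarith)
    have h6 : t * (a * t ^ (a - 1)) = a * t ^ a := by
      rcases Nat.eq_zero_or_pos a with h0 | h0
      · simp [h0]
      · conv_rhs => rw [← Nat.sub_add_cancel h0, pow_succ]
        rw [Nat.sub_add_cancel h0]
        ring
    calc |K * l * τ ^ a - K * l * t ^ a| = K * l * |τ ^ a - t ^ a| := by
          rw [← mul_sub, abs_mul, abs_of_nonneg (by positivity)]
      _ ≤ K * l * ((c₂ * u * t) * a * (2 * t) ^ (a - 1)) := by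
          gcongr
          exact h4.trans (by gcongr)
      _ = K * (c₂ * 2 ^ (a - 1)) * l * (t * (a * t ^ (a - 1))) * u := by rw [mul_pow]; ring
      _ = _ := by rw [h6]; ring
  have e4 := (abs_sub_le _ (K * x * τ ^ a) (K * l * t ^ a)).trans
    (add_le_add e1 ((abs_sub_le _ (K * l * τ ^ a) _).trans (add_le_add e2 e3)))
  refine e4.trans (le_of_eq ?_)
  ring

lemma exists_endpoints {I : Set ℝ} (hI : I.OrdConnected) {W : ℝ} (hIW : I ⊆ Set.Icc (-W) W)
    (hpos : 0 < (volume I).toReal) :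
    ∃ x y, x ≤ y ∧ (volume I).toReal = y - x ∧ Set.Ioo x y ⊆ I ∧ I ⊆ Set.Icc x y ∧ -W ≤ x ∧
      y ≤ W := by
  have hne : I.Nonempty := by
    by_contra h
    rw [Set.not_nonempty_iff_eq_empty] at h
    simp [h] at hpos
  have hbb : BddBelow I := ⟨-W, fun z hz => (hIW hz).1⟩
  have hba : BddAbove I := ⟨W, fun z hz => (hIW hz).2⟩
  have h1 : Set.Ioo (sInf I) (sSup I) ⊆ I := by
    intro z hz
    obtain ⟨a, ha, haz⟩ := exists_lt_of_csInf_lt hne hz.1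
    obtain ⟨b, hb, hzb⟩ := exists_lt_of_lt_csSup hne hz.2
    exact hI.out ha hb ⟨haz.le, hzb.le⟩
  have h2 : I ⊆ Set.Icc (sInf I) (sSup I) := fun z hz => ⟨csInf_le hbb hz, le_csSup hba hz⟩
  have hle : sInf I ≤ sSup I := by
    obtain ⟨z, hz⟩ := hne
    exact (h2 hz).1.trans (h2 hz).2
  refine ⟨sInf I, sSup I, hle, ?_, h1, h2, le_csInf hne fun z hz => (hIW hz).1,
    csSup_le hne fun z hz => (hIW hz).2⟩
  have h3 : volume I = ENNReal.ofReal (sSup I - sInf I) := by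
    refine le_antisymm ?_ ?_
    · exact (measure_mono h2).trans_eq Real.volume_Icc
    · exact Real.volume_Ioo.symm.trans_le (measure_mono h1)
  rw [h3, ENNReal.toReal_ofReal (by linarith)]

lemma exists_netMat_outer {n : ℕ} {H B : Matrix (Fin n) (Fin n) ℝ} (hBH : B * H = 1) {b : ℕ}
    (hH : ∀ i j, |H i j| ≤ b) (hB : ∀ i j, |B i j| ≤ b) {ε T t : ℝ} (hε : 0 < ε) (hε1 : ε ≤ 1)
    (he : n ^ 3 * b * ε ≤ 1 / 8) (hT : 0 < T) (hTt : T ≤ t) (htT : t ≤ 2 * T) :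
    ∃ m : Fin n → Fin n → ℤ, (∀ i j, |(m i j : ℝ)| ≤ (2 * b + 1) * ε⁻¹) ∧
      (∀ z, eucNorm (z ᵥ* B) ≤ t → eucNorm (z ᵥ* netMat ε m) ≤ T) ∧
      ∀ z, eucNorm (z ᵥ* netMat ε m) ≤ T →
        eucNorm (z ᵥ* B) ≤ t / (1 - 4 * (n ^ 3 * b * ε)) := by
  have ht : 0 < t := hT.trans_le hTt
  have he0 : 0 ≤ n ^ 3 * b * ε := by positivity
  obtain ⟨e, hedef⟩ : ∃ e, e = n ^ 3 * b * ε := ⟨_, rfl⟩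
  obtain ⟨m, hm, hz⟩ := exists_netMat hBH hH hB hε hε1 (φ := (1 - 2 * e) * T / t)
    (div_nonneg (mul_nonneg (by linarith) hT.le) ht.le) (by rw [div_le_iff₀ ht]; nlinarith)
  rw [← hedef] at he he0 hz ⊢
  refine ⟨m, hm, fun z hN => ?_, fun z hX => ?_⟩
  · have h1 := (abs_le.mp (hz z)).2
    have h2 : ((1 - 2 * e) * T / t + e) * eucNorm (z ᵥ* B) ≤ ((1 - 2 * e) * T / t + e) * t := by
      gcongr
      exact add_nonneg (div_nonneg (mul_nonneg (by linarith) hT.le) ht.le) he0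
    have h3 : ((1 - 2 * e) * T / t + e) * t = (1 - 2 * e) * T + e * t := by field_simp
    nlinarith
  · have h1 := (abs_le.mp (hz z)).1
    have hN0 := eucNorm_nonneg (z ᵥ* B)
    rw [le_div_iff₀ (by linarith)]
    have h2 : (1 - 2 * e) * T / t * eucNorm (z ᵥ* B) - e * eucNorm (z ᵥ* B) ≤ T := by linarith
    have h3 := mul_le_mul_of_nonneg_right h2 ht.le
    have h4 : ((1 - 2 * e) * T / t * eucNorm (z ᵥ* B) - e * eucNorm (z ᵥ* B)) * t =
        ((1 - 2 * e) * T - e * t) * eucNorm (z ᵥ* B) := by field_simp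
    rw [h4] at h3
    have h5 : ((1 - 4 * e) * T) * eucNorm (z ᵥ* B) ≤
        ((1 - 2 * e) * T - e * t) * eucNorm (z ᵥ* B) := by
      gcongr
      nlinarith
    have h6 : T * (eucNorm (z ᵥ* B) * (1 - 4 * e)) ≤ T * t := by linarith
    exact le_of_mul_le_mul_left h6 hT

lemma exists_netMat_inner {n : ℕ} {H B : Matrix (Fin n) (Fin n) ℝ} (hBH : B * H = 1) {b : ℕ}
    (hH : ∀ i j, |H i j| ≤ b) (hB : ∀ i j, |B i j| ≤ b) {ε T t : ℝ} (hε : 0 < ε) (hε1 : ε ≤ 1)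
    (he : n ^ 3 * b * ε ≤ 1 / 8) (hT : 0 < T) (hTt : T ≤ t) (htT : t ≤ 2 * T) :
    ∃ m : Fin n → Fin n → ℤ, (∀ i j, |(m i j : ℝ)| ≤ (2 * b + 1) * ε⁻¹) ∧
      (∀ z, eucNorm (z ᵥ* netMat ε m) ≤ T → eucNorm (z ᵥ* B) ≤ t) ∧
      ∀ z, eucNorm (z ᵥ* B) ≤ t / (1 + 4 * (n ^ 3 * b * ε)) →
        eucNorm (z ᵥ* netMat ε m) ≤ T := by
  have ht : 0 < t := hT.trans_le hTt
  have he0 : 0 ≤ n ^ 3 * b * ε := by positivity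
  obtain ⟨e, hedef⟩ : ∃ e, e = n ^ 3 * b * ε := ⟨_, rfl⟩
  obtain ⟨m, hm, hz⟩ := exists_netMat hBH hH hB hε hε1 (φ := (1 + 2 * e) * T / t)
    (div_nonneg (mul_nonneg (by linarith) hT.le) ht.le) (by rw [div_le_iff₀ ht]; nlinarith)
  rw [← hedef] at he he0 hz ⊢
  refine ⟨m, hm, fun z hX => ?_, fun z hN => ?_⟩
  · have h1 := (abs_le.mp (hz z)).1
    have hN0 := eucNorm_nonneg (z ᵥ* B)
    have h2 : (1 + 2 * e) * T / t * eucNorm (z ᵥ* B) - e * eucNorm (z ᵥ* B) ≤ T := by linarith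
    have h3 := mul_le_mul_of_nonneg_right h2 ht.le
    have h4 : ((1 + 2 * e) * T / t * eucNorm (z ᵥ* B) - e * eucNorm (z ᵥ* B)) * t =
        ((1 + 2 * e) * T - e * t) * eucNorm (z ᵥ* B) := by field_simp
    rw [h4] at h3
    have h5 : T * eucNorm (z ᵥ* B) ≤ ((1 + 2 * e) * T - e * t) * eucNorm (z ᵥ* B) := by
      gcongr
      nlinarith
    exact le_of_mul_le_mul_left (h5.trans h3) hT
  · have h1 := (abs_le.mp (hz z)).2
    rw [le_div_iff₀ (by linarith)] at hN
    have h2 : ((1 + 2 * e) * T / t + e) * (eucNorm (z ᵥ* B) * (1 + 4 * e)) ≤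
        ((1 + 2 * e) * T / t + e) * t := by gcongr
    have h3 : ((1 + 2 * e) * T / t + e) * t = (1 + 2 * e) * T + e * t := by field_simp
    have h5 : eucNorm (z ᵥ* netMat ε m) ≤ ((1 + 2 * e) * T / t + e) * eucNorm (z ᵥ* B) := by
      linarith
    have h6 := mul_le_mul_of_nonneg_right h5 (show 0 ≤ 1 + 4 * e by linarith)
    have h7 : eucNorm (z ᵥ* netMat ε m) * (1 + 4 * e) ≤ T * (1 + 4 * e) := by nlinarith
    exact le_of_mul_le_mul_right h7 (by linarith)

lemma levelRegion_biUnion (p q d : ℕ) (S : Finset ℤ) (δ : ℝ)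
    (s : Matrix (Fin (p + q)) (Fin (p + q)) ℝ) (T R : ℝ) :
    levelRegion p q d (⋃ i ∈ S, gridIco δ i) s T R =
      ⋃ i ∈ S, levelRegion p q d (gridIco δ i) s T R := by
  ext z
  simp only [levelRegion, Set.mem_iUnion, Set.mem_ofPred_eq, exists_prop]
  constructor
  · rintro ⟨⟨i, hi, h1⟩, h2⟩
    exact ⟨i, hi, h1, h2⟩
  · rintro ⟨i, hi, h1, h2⟩
    exact ⟨⟨i, hi, h1⟩, h2⟩

lemma mem_gridIco_iff {δ : ℝ} (hδ : 0 < δ) (i : ℤ) (u : ℝ) : u ∈ gridIco δ i ↔ ⌊u / δ⌋ = i := by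
  rw [Int.floor_eq_iff, le_div_iff₀ hδ, div_lt_iff₀ hδ, gridIco, Set.mem_Ico]

lemma pairwiseDisjoint_gridIco {δ : ℝ} (hδ : 0 < δ) (S : Set ℤ) :
    S.PairwiseDisjoint (gridIco δ) := by
  intro i _ i' _ hne
  refine Set.disjoint_left.mpr fun u hu hu' => hne ?_
  rw [mem_gridIco_iff hδ] at hu hu'
  rw [← hu, hu']

lemma volume_biUnion_gridIco {δ : ℝ} (hδ : 0 < δ) (S : Finset ℤ) :
    (volume (⋃ i ∈ S, gridIco δ i)).toReal = S.card * δ := by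
  rw [measure_biUnion_finset (pairwiseDisjoint_gridIco hδ _) fun i _ => measurableSet_gridIco δ i]
  simp [volume_gridIco, hδ.le]

lemma volume_levelRegion_ne_top (p q d : ℕ) (J : Set ℝ)
    (s : Matrix (Fin (p + q)) (Fin (p + q)) ℝ) (T R : ℝ) :
    volume (levelRegion p q d J s T R) ≠ ⊤ := by
  refine ne_top_of_le_ne_top (b := volume (Metric.closedBall (0 : Fin (p + q) → ℝ) R)) ?_
    (measure_mono fun z hz => by simpa using hz.2.2)
  exact (isCompact_closedBall _ _).measure_ne_top

lemma latticeMeasure_grid_sub_le {p q d : ℕ} (h : SLR (p + q)) {δ : ℝ} (hδ : 0 < δ) (S : Finset ℤ)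
    (s : Matrix (Fin (p + q)) (Fin (p + q)) ℝ) (T R : ℝ) {r : ℝ}
    (hr : ∀ i ∈ S, ediff (cnt (levelRegion p q d (gridIco δ i) s T R) (rowsOf h))
      (volume (levelRegion p q d (gridIco δ i) s T R)) < ENNReal.ofReal r) :
    latticeMeasure h (levelRegion p q d (⋃ i ∈ S, gridIco δ i) s T R) ≠ ⊤ ∧
      |(latticeMeasure h (levelRegion p q d (⋃ i ∈ S, gridIco δ i) s T R)).toReal -
        (volume (levelRegion p q d (⋃ i ∈ S, gridIco δ i) s T R)).toReal| ≤ S.card * r := by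
  rw [levelRegion_biUnion]
  refine abs_latticeMeasure_biUnion_sub_le h S
    (fun i _ => measurableSet_levelRegion p q d (measurableSet_gridIco δ i) s T R) ?_
    (fun i _ => volume_levelRegion_ne_top p q d _ s T R) hr
  intro i hi i' hi' hne
  refine Set.disjoint_left.mpr fun z hz hz' => ?_
  exact Set.disjoint_left.mp (pairwiseDisjoint_gridIco hδ _ hi hi' hne) hz.1 hz'.1

lemma exists_grid_cover {x y δ W : ℝ} (hδ : 0 < δ) (hxy : x ≤ y) (hx : -W ≤ x) (hy : y ≤ W) :
    ∃ S : Finset ℤ, Set.Icc x y ⊆ ⋃ i ∈ S, gridIco δ i ∧ |S.card * δ - (y - x)| ≤ 2 * δ ∧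
      ∀ i ∈ S, |(i : ℝ)| ≤ W / δ + 1 := by
  have hx1 := Int.floor_le (x / δ)
  have hx2 := Int.lt_floor_add_one (x / δ)
  have hy1 := Int.floor_le (y / δ)
  have hy2 := Int.lt_floor_add_one (y / δ)
  have hfl : ⌊x / δ⌋ ≤ ⌊y / δ⌋ := Int.floor_le_floor (by gcongr)
  refine ⟨Finset.Icc ⌊x / δ⌋ ⌊y / δ⌋, fun u hu => ?_, ?_, fun i hi => ?_⟩
  · simp only [Set.mem_iUnion, exists_prop]
    refine ⟨⌊u / δ⌋, Finset.mem_Icc.mpr ⟨Int.floor_le_floor ?_, Int.floor_le_floor ?_⟩,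
      (mem_gridIco_iff hδ _ u).mpr rfl⟩
    · have := hu.1
      gcongr
    · have := hu.2
      gcongr
  · have hcard : ((Finset.Icc ⌊x / δ⌋ ⌊y / δ⌋).card : ℝ) = ⌊y / δ⌋ + 1 - ⌊x / δ⌋ := by
      have : ((Finset.Icc ⌊x / δ⌋ ⌊y / δ⌋).card : ℤ) = ⌊y / δ⌋ + 1 - ⌊x / δ⌋ := by
        rw [Int.card_Icc]; omega
      exact_mod_cast this
    have h1 : (⌊y / δ⌋ + 1 - ⌊x / δ⌋ : ℝ) * δ - (y - x) =
        (⌊y / δ⌋ + 1 - ⌊x / δ⌋ - (y / δ - x / δ)) * δ := by field_simp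
    rw [hcard, h1, abs_mul, abs_of_pos hδ]
    gcongr
    exact abs_le.mpr ⟨by linarith, by linarith⟩
  · rw [Finset.mem_Icc] at hi
    have h1 : (⌊x / δ⌋ : ℝ) ≤ i := by exact_mod_cast hi.1
    have h2 : (i : ℝ) ≤ ⌊y / δ⌋ := by exact_mod_cast hi.2
    have h3 : -(W / δ) ≤ x / δ := by rw [← neg_div]; gcongr
    have h4 : y / δ ≤ W / δ := by gcongr
    exact abs_le.mpr ⟨by linarith, by linarith⟩

lemma exists_grid_inner {x y δ W : ℝ} (hδ : 0 < δ) (hxy : x ≤ y) (hx : -W ≤ x) (hy : y ≤ W) :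
    ∃ S : Finset ℤ, ⋃ i ∈ S, gridIco δ i ⊆ Set.Ioo x y ∧ |S.card * δ - (y - x)| ≤ 2 * δ ∧
      ∀ i ∈ S, |(i : ℝ)| ≤ W / δ + 1 := by
  have hx1 := Int.floor_le (x / δ)
  have hx2 := Int.lt_floor_add_one (x / δ)
  have hy1 := Int.floor_le (y / δ)
  have hy2 := Int.lt_floor_add_one (y / δ)
  have hfl : ⌊x / δ⌋ ≤ ⌊y / δ⌋ := Int.floor_le_floor (by gcongr)
  refine ⟨Finset.Icc (⌊x / δ⌋ + 1) (⌊y / δ⌋ - 1), fun u hu => ?_, ?_, fun i hi => ?_⟩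
  · simp only [Set.mem_iUnion, exists_prop] at hu
    obtain ⟨i, hi, hu1, hu2⟩ := hu
    rw [Finset.mem_Icc] at hi
    have h1 : (⌊x / δ⌋ : ℝ) + 1 ≤ i := by exact_mod_cast hi.1
    have h2 : (i : ℝ) ≤ ⌊y / δ⌋ - 1 := by exact_mod_cast hi.2
    have h3 : x < i * δ := (div_lt_iff₀ hδ).mp (by linarith)
    have h4 : (i + 1) * δ ≤ y := (le_div_iff₀ hδ).mp (by linarith)
    exact ⟨h3.trans_le hu1, hu2.trans_le h4⟩
  · have hcard : |((Finset.Icc (⌊x / δ⌋ + 1) (⌊y / δ⌋ - 1)).card : ℝ) - (y / δ - x / δ)| ≤ 2 := by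
      rcases hfl.eq_or_lt with h | h
      · have h0 : (Finset.Icc (⌊x / δ⌋ + 1) (⌊y / δ⌋ - 1)).card = 0 := by
          rw [Int.card_Icc]; omega
        have h' : (⌊x / δ⌋ : ℝ) = ⌊y / δ⌋ := by exact_mod_cast h
        rw [h0, Nat.cast_zero]
        exact abs_le.mpr ⟨by linarith, by linarith⟩
      · have h0 : ((Finset.Icc (⌊x / δ⌋ + 1) (⌊y / δ⌋ - 1)).card : ℝ) = ⌊y / δ⌋ - 1 - ⌊x / δ⌋ := by
          have : ((Finset.Icc (⌊x / δ⌋ + 1) (⌊y / δ⌋ - 1)).card : ℤ) = ⌊y / δ⌋ - 1 - ⌊x / δ⌋ := by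
            rw [Int.card_Icc]; omega
          exact_mod_cast this
        rw [h0]
        exact abs_le.mpr ⟨by linarith, by linarith⟩
    have h1 : ((Finset.Icc (⌊x / δ⌋ + 1) (⌊y / δ⌋ - 1)).card : ℝ) * δ - (y - x) =
        (((Finset.Icc (⌊x / δ⌋ + 1) (⌊y / δ⌋ - 1)).card : ℝ) - (y / δ - x / δ)) * δ := by field_simp
    rw [h1, abs_mul, abs_of_pos hδ]
    gcongr
  · rw [Finset.mem_Icc] at hi
    have h1 : (⌊x / δ⌋ : ℝ) + 1 ≤ i := by exact_mod_cast hi.1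
    have h2 : (i : ℝ) ≤ ⌊y / δ⌋ - 1 := by exact_mod_cast hi.2
    have h3 : -(W / δ) ≤ x / δ := by rw [← neg_div]; gcongr
    have h4 : y / δ ≤ W / δ := by gcongr
    exact abs_le.mpr ⟨by linarith, by linarith⟩

lemma measurableSet_biUnion_gridIco (S : Finset ℤ) (δ : ℝ) :
    MeasurableSet (⋃ i ∈ S, gridIco δ i) :=
  Finset.measurableSet_biUnion _ fun i _ => measurableSet_gridIco δ i

lemma NF_le_volume_add {p q d : ℕ} (h : SLR (p + q)) {b : ℕ} (hH : ∀ i j, |h.1 i j| ≤ b)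
    (hB : ∀ i j, |h⁻¹.1 i j| ≤ b) {ε δ T R t r : ℝ} (hε : 0 < ε) (hε1 : ε ≤ 1)
    (he : ((p + q : ℕ) : ℝ) ^ 3 * b * ε ≤ 1 / 8) (hT : 0 < T) (hTt : T ≤ t) (htT : t ≤ 2 * T)
    (hδ : 0 < δ) (hR : ((p + q : ℕ) : ℝ) * b * t ≤ R) {S : Finset ℤ} {I : Set ℝ}
    (hI : I ⊆ ⋃ i ∈ S, gridIco δ i)
    (hr : ∀ m : Fin (p + q) → Fin (p + q) → ℤ, (∀ i j, |(m i j : ℝ)| ≤ (2 * b + 1) * ε⁻¹) →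
      ∀ i ∈ S, ediff (cnt (levelRegion p q d (gridIco δ i) (netMat ε m) T R) (rowsOf h))
        (volume (levelRegion p q d (gridIco δ i) (netMat ε m) T R)) < ENNReal.ofReal r)
    (hfin : volume {z | F0 p q d z ∈ ⋃ i ∈ S, gridIco δ i ∧
      eucNorm (z ᵥ* h⁻¹.1) ≤ t / (1 - 4 * (((p + q : ℕ) : ℝ) ^ 3 * b * ε))} ≠ ⊤) :
    (NF p q d h I t : ℝ) ≤ (volume {z | F0 p q d z ∈ ⋃ i ∈ S, gridIco δ i ∧
      eucNorm (z ᵥ* h⁻¹.1) ≤ t / (1 - 4 * (((p + q : ℕ) : ℝ) ^ 3 * b * ε))}).toReal +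
        S.card * r + 1 := by
  have hBH : h⁻¹.1 * h.1 = 1 := by
    rw [← Matrix.SpecialLinearGroup.coe_mul, inv_mul_cancel, Matrix.SpecialLinearGroup.coe_one]
  have hHB : h.1 * h⁻¹.1 = 1 := by
    rw [← Matrix.SpecialLinearGroup.coe_mul, mul_inv_cancel, Matrix.SpecialLinearGroup.coe_one]
  obtain ⟨m, hm, hin, hout⟩ := exists_netMat_outer hBH hH hB hε hε1 he hT hTt htT
  obtain ⟨h1, h2⟩ := latticeMeasure_grid_sub_le h hδ S (netMat ε m) T R (hr m hm)
  have h3 := NF_le_latticeMeasure (I := I) (t := t) h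
    (measurableSet_levelRegion p q d (measurableSet_biUnion_gridIco S δ) (netMat ε m) T R) h1
    (fun v hv hvt => by
      have hvB : (v ᵥ* h.1) ᵥ* h⁻¹.1 = v := by rw [vecMul_vecMul, hHB, vecMul_one]
      refine ⟨hI hv, hin _ (by rwa [hvB]), le_trans ?_ hR⟩
      refine (norm_vecMul_le hH b.cast_nonneg v).trans ?_
      have := (norm_le_eucNorm v).trans hvt
      gcongr)
  have h4 : (volume (levelRegion p q d (⋃ i ∈ S, gridIco δ i) (netMat ε m) T R)).toReal ≤ _ :=
    ENNReal.toReal_mono hfin (measure_mono fun z hz => ⟨hz.1, hout z hz.2.1⟩)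
  have h5 := (abs_le.mp h2).2
  linarith

lemma volume_sub_le_NF {p q d : ℕ} (h : SLR (p + q)) {b : ℕ} (hH : ∀ i j, |h.1 i j| ≤ b)
    (hB : ∀ i j, |h⁻¹.1 i j| ≤ b) {ε δ T R t r : ℝ} (hε : 0 < ε) (hε1 : ε ≤ 1)
    (he : ((p + q : ℕ) : ℝ) ^ 3 * b * ε ≤ 1 / 8) (hT : 0 < T) (hTt : T ≤ t) (htT : t ≤ 2 * T)
    (hδ : 0 < δ) (hR : ((p + q : ℕ) : ℝ) * b * t ≤ R) {S : Finset ℤ} {I : Set ℝ}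
    (hI : ⋃ i ∈ S, gridIco δ i ⊆ I)
    (hr : ∀ m : Fin (p + q) → Fin (p + q) → ℤ, (∀ i j, |(m i j : ℝ)| ≤ (2 * b + 1) * ε⁻¹) →
      ∀ i ∈ S, ediff (cnt (levelRegion p q d (gridIco δ i) (netMat ε m) T R) (rowsOf h))
        (volume (levelRegion p q d (gridIco δ i) (netMat ε m) T R)) < ENNReal.ofReal r) :
    (volume {z | F0 p q d z ∈ ⋃ i ∈ S, gridIco δ i ∧
      eucNorm (z ᵥ* h⁻¹.1) ≤ t / (1 + 4 * (((p + q : ℕ) : ℝ) ^ 3 * b * ε))}).toReal -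
        S.card * r ≤ NF p q d h I t := by
  have hBH : h⁻¹.1 * h.1 = 1 := by
    rw [← Matrix.SpecialLinearGroup.coe_mul, inv_mul_cancel, Matrix.SpecialLinearGroup.coe_one]
  have hHB : h.1 * h⁻¹.1 = 1 := by
    rw [← Matrix.SpecialLinearGroup.coe_mul, mul_inv_cancel, Matrix.SpecialLinearGroup.coe_one]
  obtain ⟨m, hm, hin, hout⟩ := exists_netMat_inner hBH hH hB hε hε1 he hT hTt htT
  obtain ⟨h1, h2⟩ := latticeMeasure_grid_sub_le h hδ S (netMat ε m) T R (hr m hm)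
  have h3 := latticeMeasure_le_NF (I := I) (t := t) h
    (measurableSet_levelRegion p q d (measurableSet_biUnion_gridIco S δ) (netMat ε m) T R)
    (fun v hv => by
      have hvB : (v ᵥ* h.1) ᵥ* h⁻¹.1 = v := by rw [vecMul_vecMul, hHB, vecMul_one]
      refine ⟨hI hv.1, ?_⟩
      have := hin _ hv.2.1
      rwa [hvB] at this)
  have ht : 0 ≤ t := hT.le.trans hTt
  have h4 := ENNReal.toReal_mono (volume_levelRegion_ne_top p q d (⋃ i ∈ S, gridIco δ i)
    (netMat ε m) T R) (measure_mono (μ := volume) (s := {z | F0 p q d z ∈ ⋃ i ∈ S, gridIco δ i ∧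
      eucNorm (z ᵥ* h⁻¹.1) ≤ t / (1 + 4 * (((p + q : ℕ) : ℝ) ^ 3 * b * ε))}) fun z hz => by
      refine ⟨hz.1, hout z hz.2, le_trans ?_ hR⟩
      have hzN : eucNorm (z ᵥ* h⁻¹.1) ≤ t := by
        refine hz.2.trans (div_le_self ht ?_)
        have : 0 ≤ ((p + q : ℕ) : ℝ) ^ 3 * b * ε := by positivity
        linarith
      have hzz : (z ᵥ* h⁻¹.1) ᵥ* h.1 = z := by rw [vecMul_vecMul, hBH, vecMul_one]
      have h5 := norm_vecMul_le hH b.cast_nonneg (z ᵥ* h⁻¹.1)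
      rw [hzz] at h5
      refine h5.trans ?_
      have := (norm_le_eucNorm _).trans hzN
      gcongr)
  have h5 := (abs_le.mp h2).1
  linarith

lemma eventually_exists_dyadic {P : ℕ → Prop} (hP : ∀ᶠ k in atTop, P k) :
    ∀ᶠ t : ℝ in atTop, ∃ k, P k ∧ (2 : ℝ) ^ k ≤ t ∧ t ≤ 2 * 2 ^ k := by
  obtain ⟨k0, hk0⟩ := eventually_atTop.mp hP
  filter_upwards [eventually_ge_atTop ((2 : ℝ) ^ k0)] with t ht
  obtain ⟨k, hk1, hk2⟩ := exists_nat_pow_near ((one_le_pow₀ one_le_two).trans ht)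
    (one_lt_two (α := ℝ))
  refine ⟨k, hk0 k ?_, hk1, by rw [pow_succ'] at hk2; exact hk2.le⟩
  have := (pow_lt_pow_iff_right₀ (one_lt_two (α := ℝ))).mp (ht.trans_lt hk2)
  omega

lemma rpow_neg_le_of_le_two_mul {t T x : ℝ} (hT : 0 < T) (ht : 0 < t) (htT : t ≤ 2 * T)
    (hx : 0 ≤ x) : T ^ (-x) ≤ 2 ^ x * t ^ (-x) := by
  have h1 : t ^ x ≤ 2 ^ x * T ^ x := by
    rw [← Real.mul_rpow zero_le_two hT.le]
    exact Real.rpow_le_rpow ht.le htT hx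
  rw [Real.rpow_neg hT.le, Real.rpow_neg ht.le, ← div_eq_mul_inv, le_div_iff₀ (by positivity),
    inv_mul_le_iff₀ (by positivity), mul_comm]
  exact h1

lemma div_one_sub_bounds {e t : ℝ} (ht : 0 ≤ t) (he : 0 ≤ e) (he' : e ≤ 1 / 8) :
    |t / (1 - 4 * e) - t| ≤ 8 * e * t ∧ t / 2 ≤ t / (1 - 4 * e) ∧ t / (1 - 4 * e) ≤ 2 * t := by
  have h0 : (0 : ℝ) < 1 - 4 * e := by linarith
  have h1 : t / (1 - 4 * e) - t = 4 * e * t / (1 - 4 * e) := by field_simp; ring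
  have h2 : 0 ≤ e * t := mul_nonneg he ht
  refine ⟨?_, ?_, ?_⟩
  · rw [h1, abs_of_nonneg (by positivity), div_le_iff₀ h0]
    nlinarith [mul_nonneg h2 (sub_nonneg.mpr he')]
  · rw [le_div_iff₀ h0]; nlinarith
  · rw [div_le_iff₀ h0]; nlinarith

lemma div_one_add_bounds {e t : ℝ} (ht : 0 ≤ t) (he : 0 ≤ e) (he' : e ≤ 1 / 8) :
    |t / (1 + 4 * e) - t| ≤ 8 * e * t ∧ t / 2 ≤ t / (1 + 4 * e) ∧ t / (1 + 4 * e) ≤ 2 * t := by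
  have h0 : (0 : ℝ) < 1 + 4 * e := by linarith
  have h1 : t / (1 + 4 * e) - t = -(4 * e * t / (1 + 4 * e)) := by field_simp; ring
  have h2 : 0 ≤ e * t := mul_nonneg he ht
  refine ⟨?_, ?_, ?_⟩
  · rw [h1, abs_neg, abs_of_nonneg (by positivity), div_le_iff₀ h0]
    nlinarith [mul_nonneg h2 he]
  · rw [le_div_iff₀ h0]; nlinarith
  · rw [div_le_iff₀ h0]; nlinarith

lemma counting_of_goodSet {p q d : ℕ} (hp : 1 ≤ p) (hq : 1 ≤ q) (hd0 : d ≠ 0) (hd : Even d)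
    (hnd : d < p + q) {η κ ν c₀ : ℝ} (hη : 0 ≤ η) (hηd : η < d) (hκ : 0 < κ) (hν0 : 0 < ν)
    (hν : ν ≤ (d - η) * volExp p q d) (hνa : ν ≤ (p + q : ℝ) - d - κ) (hc₀ : 0 ≤ c₀)
    (h : SLR (p + q))
    (hgood : rowsOf h ∈ goodSet (gridIdx (p + q) η κ ν (c₀ * 2 ^ η + 1)) (gridRegion p q d κ ν)
      (fun k => ((2 : ℝ) ^ k) ^ ((p + q : ℝ) - d - κ - 2 * ν))) :
    ∃ cF > (0 : ℝ), ∃ CF > (0 : ℝ), ∀ᶠ t : ℝ in atTop, ∀ I : Set ℝ, I.OrdConnected →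
      I ⊆ Set.Icc (-(c₀ * t ^ η)) (c₀ * t ^ η) → t ^ (-κ) ≤ (volume I).toReal →
      |(NF p q d h I t : ℝ) - cF * (volume I).toReal * t ^ ((p + q : ℝ) - d)| ≤
        CF * (volume I).toReal * t ^ ((p + q : ℝ) - d - ν) := by
  obtain ⟨c, hcdef⟩ : ∃ c, c = c₀ * 2 ^ η + 1 := ⟨_, rfl⟩
  obtain ⟨a, hadef⟩ : ∃ a, a = (p + q : ℝ) - d := ⟨_, rfl⟩
  rw [← hcdef, ← hadef] at hgood
  rw [← hadef] at hνa ⊢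
  have hc1 : 1 ≤ c := by rw [hcdef, le_add_iff_nonneg_left]; positivity
  have hBH : h⁻¹.1 * h.1 = 1 := by
    rw [← Matrix.SpecialLinearGroup.coe_mul, inv_mul_cancel, Matrix.SpecialLinearGroup.coe_one]
  obtain ⟨L, c', hgauge⟩ := exists_isGauge_vecMul hBH
  obtain ⟨b1, hb1⟩ := exists_entry_bound h.1
  obtain ⟨b2, hb2⟩ := exists_entry_bound h⁻¹.1
  obtain ⟨b, hbdef⟩ : ∃ b, b = max b1 b2 := ⟨_, rfl⟩
  have hH : ∀ i j, |h.1 i j| ≤ b := fun i j =>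
    (hb1 i j).trans (by rw [hbdef]; exact_mod_cast le_max_left _ _)
  have hB : ∀ i j, |h⁻¹.1 i j| ≤ b := fun i j =>
    (hb2 i j).trans (by rw [hbdef]; exact_mod_cast le_max_right _ _)
  obtain ⟨c₂, hc₂⟩ : ∃ c₂, c₂ = 8 * (((p + q : ℕ) : ℝ) ^ 3 * b * 2 ^ ν) + 2 * 2 ^ (κ + ν) :=
    ⟨_, rfl⟩
  have hc₂0 : 0 ≤ c₂ := by rw [hc₂]; positivity
  obtain ⟨K, hK, C, hC, hvol⟩ := exists_volume_approx hp hq hd0 hd hnd hgauge hηd hν0.le hν hc₂0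
    (show 0 < c + 2 by linarith)
  obtain ⟨j0, hj0⟩ := hgood
  obtain ⟨j, hjdef⟩ : ∃ j, j = max j0 (2 * (p + q) * b + 2 * b + 1) := ⟨_, rfl⟩
  have hj1 : 2 * ((p + q : ℕ) : ℝ) * b + 2 * b + 1 ≤ j := by
    rw [hjdef]; exact_mod_cast le_max_right _ _
  have hjk := hj0 j (by rw [hjdef]; exact le_max_left _ _)
  have hsmall : ∀ᶠ k : ℕ in atTop, ((p + q : ℕ) : ℝ) ^ 3 * b * ((2 : ℝ) ^ k) ^ (-ν) ≤ 1 / 8 := by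
    have := (tendsto_two_pow_rpow_neg hν0).const_mul (((p + q : ℕ) : ℝ) ^ 3 * b)
    rw [mul_zero] at this
    exact this.eventually_le_const (by norm_num)
  refine ⟨K, hK, C + (1 + c₂) + 1, by positivity, ?_⟩
  filter_upwards [hvol, eventually_exists_dyadic (hjk.and hsmall), eventually_ge_atTop 1]
    with t hvolt ⟨k, ⟨hk, he⟩, hTt, htT⟩ ht1 I hI hIW hIl
  obtain ⟨T, hTdef⟩ : ∃ T : ℝ, T = 2 ^ k := ⟨_, rfl⟩
  have hT1 : 1 ≤ T := by rw [hTdef]; exact one_le_pow₀ one_le_two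
  have hT0 : 0 < T := one_pos.trans_le hT1
  have ht0 : 0 < t := one_pos.trans_le ht1
  rw [← hTdef] at hTt htT he
  obtain ⟨x, y, hxy, hℓ, hIoo, hIcc, hxW, hyW⟩ :=
    exists_endpoints hI hIW ((Real.rpow_pos_of_pos ht0 _).trans_le hIl)
  obtain ⟨ℓ, hℓdef⟩ : ∃ ℓ, ℓ = (volume I).toReal := ⟨_, rfl⟩
  rw [← hℓdef] at hIl hℓ ⊢
  have hℓ0 : 0 < ℓ := (Real.rpow_pos_of_pos ht0 _).trans_le hIl
  obtain ⟨u, hudef⟩ : ∃ u, u = t ^ (-ν) := ⟨_, rfl⟩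
  have hu0 : 0 < u := by rw [hudef]; positivity
  have hu1 : u ≤ 1 := by
    rw [hudef]; exact Real.rpow_le_one_of_one_le_of_nonpos ht1 (by linarith)
  obtain ⟨ε, hεdef⟩ : ∃ ε, ε = T ^ (-ν) := ⟨_, rfl⟩
  obtain ⟨δ, hδdef⟩ : ∃ δ, δ = T ^ (-(κ + ν)) := ⟨_, rfl⟩
  have hε0 : 0 < ε := by rw [hεdef]; positivity
  have hδ0 : 0 < δ := by rw [hδdef]; positivity
  have hε1 : ε ≤ 1 := by
    rw [hεdef]; exact Real.rpow_le_one_of_one_le_of_nonpos hT1 (by linarith)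
  have hεu : ε ≤ 2 ^ ν * u := by
    rw [hεdef, hudef]; exact rpow_neg_le_of_le_two_mul hT0 ht0 htT hν0.le
  have hδu : δ ≤ 2 ^ (κ + ν) * (ℓ * u) := by
    have h1 := rpow_neg_le_of_le_two_mul hT0 ht0 htT (show 0 ≤ κ + ν by linarith)
    rw [neg_add, Real.rpow_add ht0, ← neg_add, ← hδdef, ← hudef] at h1
    exact h1.trans (by gcongr)
  rw [← hεdef] at he
  obtain ⟨e, hedef⟩ : ∃ e, e = ((p + q : ℕ) : ℝ) ^ 3 * b * ε := ⟨_, rfl⟩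
  have he0 : 0 ≤ e := by rw [hedef]; positivity
  have he8 : 8 * e ≤ c₂ * u := by
    have h1 : e ≤ ((p + q : ℕ) : ℝ) ^ 3 * b * (2 ^ ν * u) := by rw [hedef]; gcongr
    have h2 : 0 ≤ (2 : ℝ) * 2 ^ (κ + ν) * u := by positivity
    rw [hc₂]
    linarith
  have hδ2 : 2 * δ ≤ c₂ * u * ℓ := by
    have h2 : 0 ≤ 8 * (((p + q : ℕ) : ℝ) ^ 3 * b * 2 ^ ν) * u * ℓ := by positivity
    rw [hc₂]
    linarith
  obtain ⟨R, hRdef⟩ : ∃ R, R = (j + 1) * T := ⟨_, rfl⟩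
  have hR : ((p + q : ℕ) : ℝ) * b * t ≤ R := by
    have h1 : ((p + q : ℕ) : ℝ) * b * t ≤ ((p + q : ℕ) : ℝ) * b * (2 * T) := by gcongr
    have h2 : 2 * ((p + q : ℕ) : ℝ) * b * T ≤ (j + 1) * T := by
      gcongr
      linarith [b.cast_nonneg (α := ℝ)]
    rw [hRdef]
    linarith
  obtain ⟨r, hrdef⟩ : ∃ r, r = T ^ (a - κ - 2 * ν) := ⟨_, rfl⟩
  have hceil : ∀ i : ℤ, |(i : ℝ)| ≤ c₀ * t ^ η / δ + 1 → |i| ≤ ⌈c * T ^ (η + κ + ν)⌉₊ := by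
    intro i hi
    have h1 : t ^ η ≤ 2 ^ η * T ^ η := by
      rw [← Real.mul_rpow zero_le_two hT0.le]
      exact Real.rpow_le_rpow ht0.le htT hη
    have h2 : (c₀ * t ^ η) / δ ≤ c₀ * (2 ^ η * T ^ η) / δ := by gcongr
    have h3 : c₀ * (2 ^ η * T ^ η) / δ = c₀ * 2 ^ η * T ^ (η + κ + ν) := by
      rw [hδdef, Real.rpow_neg hT0.le, div_inv_eq_mul, add_assoc, Real.rpow_add hT0 η]
      ring
    have h4 : 1 ≤ T ^ (η + κ + ν) := Real.one_le_rpow hT1 (by linarith)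
    have h5 : |(i : ℝ)| ≤ c * T ^ (η + κ + ν) := by rw [hcdef]; linarith
    exact_mod_cast h5.trans (Nat.le_ceil _)
  have hr : ∀ S : Finset ℤ, (∀ i ∈ S, |(i : ℝ)| ≤ c₀ * t ^ η / δ + 1) →
      ∀ m : Fin (p + q) → Fin (p + q) → ℤ, (∀ i j, |(m i j : ℝ)| ≤ (2 * b + 1) * ε⁻¹) →
      ∀ i ∈ S, ediff (cnt (levelRegion p q d (gridIco δ i) (netMat ε m) T R) (rowsOf h))
        (volume (levelRegion p q d (gridIco δ i) (netMat ε m) T R)) < ENNReal.ofReal r := by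
    intro S hS m hm i hi
    have hmem : (i, m) ∈ gridIdx (p + q) η κ ν c j k := by
      rw [gridIdx, Finset.mem_product, Finset.mem_Icc, ← abs_le, Fintype.mem_piFinset, ← hTdef]
      refine ⟨hceil i (hS i hi), fun i' => Fintype.mem_piFinset.mpr fun j' => ?_⟩
      rw [Finset.mem_Icc, ← abs_le]
      have h1 : |(m i' j' : ℝ)| ≤ j * T ^ ν := by
        refine (hm i' j').trans ?_
        rw [hεdef, Real.rpow_neg hT0.le, inv_inv]
        gcongr
        have : 0 ≤ 2 * ((p + q : ℕ) : ℝ) * b := by positivity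
        linarith
      exact_mod_cast h1.trans (Nat.le_ceil _)
    have := hk (i, m) hmem
    rwa [gridRegion, ← hTdef, ← hεdef, ← hδdef, ← hRdef, ← hrdef] at this
  have hJ : ∀ S : Finset ℤ, (∀ i ∈ S, |(i : ℝ)| ≤ c₀ * t ^ η / δ + 1) →
      ⋃ i ∈ S, gridIco δ i ⊆ Set.Icc (-((c + 2) * t ^ η)) ((c + 2) * t ^ η) := by
    intro S hS
    refine Set.iUnion₂_subset fun i hi => ?_
    rw [hδdef]
    refine (gridIco_subset hT1 hη (by linarith) (by linarith) (hceil i (hS i hi))).trans ?_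
    have h1 : (c + 2) * T ^ η ≤ (c + 2) * t ^ η := by gcongr
    exact Set.Icc_subset_Icc (by linarith) h1
  have hcard : ∀ S : Finset ℤ, |S.card * δ - (y - x)| ≤ 2 * δ →
      S.card * r ≤ (1 + c₂) * (ℓ * t ^ (a - ν)) := by
    intro S hS
    rw [← hℓ] at hS
    have h1 : r = δ * T ^ (a - ν) := by
      rw [hrdef, hδdef, ← Real.rpow_add hT0]; congr 1; ring
    have h2 : T ^ (a - ν) ≤ t ^ (a - ν) := Real.rpow_le_rpow hT0.le hTt (by linarith)
    have h3 : S.card * δ ≤ (1 + c₂) * ℓ := by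
      have h4 := (abs_le.mp hS).2
      have h5 : c₂ * u * ℓ ≤ c₂ * 1 * ℓ := by gcongr
      linarith
    calc (S.card : ℝ) * r = S.card * δ * T ^ (a - ν) := by rw [h1]; ring
      _ ≤ (1 + c₂) * ℓ * t ^ (a - ν) := by gcongr
      _ = _ := by ring
  have hvolS : ∀ (S : Finset ℤ) (τ : ℝ), |S.card * δ - (y - x)| ≤ 2 * δ →
      (∀ i ∈ S, |(i : ℝ)| ≤ c₀ * t ^ η / δ + 1) → |τ - t| ≤ 8 * e * t → t / 2 ≤ τ → τ ≤ 2 * t →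
      volume {z | F0 p q d z ∈ ⋃ i ∈ S, gridIco δ i ∧ eucNorm (z ᵥ* h⁻¹.1) ≤ τ} ≠ ⊤ ∧
      |(volume {z | F0 p q d z ∈ ⋃ i ∈ S, gridIco δ i ∧ eucNorm (z ᵥ* h⁻¹.1) ≤ τ}).toReal -
        K * ℓ * t ^ a| ≤ C * (ℓ * t ^ (a - ν)) := by
    intro S τ hS hSi hτ hτ1 hτ2
    rw [← hudef] at hvolt
    have h1 := hvolt ℓ τ hℓ0.le hτ1 hτ2 (hτ.trans (by gcongr)) _
      (measurableSet_biUnion_gridIco S δ) (hJ S hSi)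
      (by rw [volume_biUnion_gridIco hδ0, hℓ]; exact hS.trans (by rw [← hℓ]; exact hδ2))
    have h2 : t ^ (p + q - d) = t ^ a := by
      rw [← Real.rpow_natCast, Nat.cast_sub hnd.le, hadef]; push_cast; rfl
    have h3 : t ^ (a - ν) = t ^ a * u := by rw [sub_eq_add_neg, Real.rpow_add ht0, hudef]
    rw [h2] at h1
    refine ⟨h1.1, h1.2.trans_eq ?_⟩
    rw [h3]; ring
  have hone : 1 ≤ ℓ * t ^ (a - ν) := by
    have h1 : t ^ (-κ) * t ^ (a - ν) ≤ ℓ * t ^ (a - ν) := by gcongr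
    rw [← Real.rpow_add ht0] at h1
    exact (Real.one_le_rpow ht1 (by linarith)).trans h1
  obtain ⟨U, hU1, hU2, hU3⟩ := exists_grid_cover hδ0 hxy hxW hyW
  obtain ⟨V, hV1, hV2, hV3⟩ := exists_grid_inner hδ0 hxy hxW hyW
  have he' : e ≤ 1 / 8 := hedef.trans_le he
  obtain ⟨hτ1, hτ2, hτ3⟩ := div_one_sub_bounds ht0.le he0 he'
  obtain ⟨hτ4, hτ5, hτ6⟩ := div_one_add_bounds ht0.le he0 he'
  have hup := hvolS U _ hU2 hU3 hτ1 hτ2 hτ3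
  have hlow := hvolS V _ hV2 hV3 hτ4 hτ5 hτ6
  rw [hedef] at hup hlow
  have h1 := NF_le_volume_add h hH hB hε0 hε1 he hT0 hTt htT hδ0 hR (hIcc.trans hU1)
    (hr U hU3) hup.1
  have h2 := volume_sub_le_NF h hH hB hε0 hε1 he hT0 hTt htT hδ0 hR (hV1.trans hIoo) (hr V hV3)
  have h3 := (abs_le.mp hup.2).2
  have h4 := (abs_le.mp hlow.2).1
  have h5 := hcard U hU2
  have h6 := hcard V hV2
  rw [mul_assoc (C + (1 + c₂) + 1)]
  exact abs_le.mpr ⟨by linarith only [h2, h4, h6, hone], by linarith only [h1, h3, h5, hone]⟩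

theorem uniform_counting_all_intervals
    (p q d : ℕ) (hp : 1 ≤ p) (hq : 1 ≤ q) (hd2 : 2 ≤ d) (hdeven : Even d)
    (hnd : d < p + q)
    (η : ℝ) (hη0 : 0 ≤ η) (hη : η < min (d : ℝ) ((p + q : ℝ) - d))
    (κ : ℝ) (hκ0 : 0 < κ) (hκ : κ < ((p + q : ℝ) - d - η) / 2)
    (N : ℝ → ℝ) (hNmono : Monotone N)
    (hNO : N =O[atTop] fun t : ℝ => t ^ η)
    (μ : Measure (SLR (p + q))) [μ.IsHaarMeasure] :
    ∃ ν > (0 : ℝ), ∀ᵐ g ∂μ, ∃ cF > (0 : ℝ), ∃ CF > (0 : ℝ), ∃ tF > (0 : ℝ),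
      ∀ t > tF, ∀ I : Set ℝ, I.OrdConnected → I ⊆ Set.Icc (-(N t)) (N t) →
        t ^ (-κ) ≤ (volume I).toReal →
        |(NF p q d g I t : ℝ) - cF * (volume I).toReal * t ^ ((p + q : ℝ) - d)|
          ≤ CF * (volume I).toReal * t ^ ((p + q : ℝ) - d - ν) := by
  have hd0 : d ≠ 0 := by omega
  obtain ⟨hηd, hηa⟩ := lt_min_iff.mp hη
  obtain ⟨σ, hσ⟩ : ∃ σ, σ = (p + q : ℝ) - d - η - 2 * κ := ⟨_, rfl⟩
  obtain ⟨w, hw⟩ : ∃ w, w = (p + q : ℝ) ^ 2 + 4 := ⟨_, rfl⟩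
  have hσ0 : 0 < σ := by linarith
  have hw0 : 0 < w := by rw [hw]; positivity
  have hγ := volExp_pos hd0 hnd
  obtain ⟨ν, hνdef⟩ : ∃ ν, ν = min (σ / (2 * w))
    (min ((d - η) * volExp p q d) ((p + q : ℝ) - d - κ)) := ⟨_, rfl⟩
  have hν0 : 0 < ν := by
    rw [hνdef]
    exact lt_min (by positivity) (lt_min (mul_pos (by linarith) hγ) (by linarith))
  have hν1 : ν ≤ σ / (2 * w) := hνdef.trans_le (min_le_left _ _)
  have hν2 : ν ≤ (d - η) * volExp p q d :=
    hνdef.trans_le ((min_le_right _ _).trans (min_le_left _ _))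
  have hν3 : ν ≤ (p + q : ℝ) - d - κ :=
    hνdef.trans_le ((min_le_right _ _).trans (min_le_right _ _))
  obtain ⟨c, hc⟩ := hNO.bound
  obtain ⟨c₀, hc₀def⟩ : ∃ c₀, c₀ = max c 0 := ⟨_, rfl⟩
  have hc₀ : 0 ≤ c₀ := hc₀def ▸ le_max_right _ _
  have hexp : 0 < (p + q : ℝ) - d - η - 2 * κ - ((p + q : ℝ) ^ 2 + 4) * ν := by
    rw [← hσ, ← hw]
    rw [le_div_iff₀ (by positivity)] at hν1
    linarith
  refine ⟨ν, hν0, ?_⟩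
  filter_upwards [ae_haar_mem_goodSet (n := p + q) (by omega) μ
    (gridIdx (p + q) η κ ν (c₀ * 2 ^ η + 1))
    (fun j k i => measurableSet_levelRegion p q d (measurableSet_gridIco _ i.1) _ _ _)
    (r := fun k => ((2 : ℝ) ^ k) ^ ((p + q : ℝ) - d - κ - 2 * ν))
    (fun k => by positivity) (by positivity)
    (Real.rpow_lt_one_of_one_lt_of_neg one_lt_two (neg_lt_zero.mpr hexp))
    (gridRegion_summable_bound hp hq hd0 hdeven hnd hη0 hηd hκ0.le hν0.le (by positivity))]
    with h hh
  obtain ⟨cF, hcF, CF, hCF, hev⟩ := counting_of_goodSet hp hq hd0 hdeven hnd hη0 hηd hκ0 hν0 hν2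
    hν3 hc₀ h hh
  obtain ⟨t₀, ht₀⟩ := eventually_atTop.mp (hev.and hc)
  refine ⟨cF, hcF, CF, hCF, max t₀ 1, by positivity, fun t ht I hI hIN hIl => ?_⟩
  obtain ⟨h1, h2⟩ := ht₀ t ((le_max_left _ _).trans ht.le)
  refine h1 I hI (hIN.trans ?_) hIl
  have ht0 : 0 < t := one_pos.trans_le ((le_max_right _ _).trans ht.le)
  have hNt : N t ≤ c₀ * t ^ η := by
    rw [Real.norm_of_nonneg (Real.rpow_nonneg ht0.le η)] at h2
    refine (le_abs_self _).trans (h2.trans ?_)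
    gcongr
    exact hc₀def ▸ le_max_left _ _
  exact Set.Icc_subset_Icc (by linarith) hNt

end
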